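/- Let K be a quadratic field and let c ∈ K. Then there do not exist α, β ∈ K such that α has preperiodic type 2₂ under f_c and β has exact period 3 under f_c. Moreover, the only pairs (t,w) ∈ ℚ × ℚ satisfying w² = (t³ − 3t − 1)(t³ + 2t² − t − 1)(t⁶ + 2t⁵ + 4t⁴ + 8t³ + 9t² + 4t + 1) are (0,1), (0,−1), (−1,1), and (−1,−1). -/

import Mathlib

/-- The quadratic map `z ↦ z ^ 2 + c`. -/
def fc {K : Type*} [Field K] (c : K) : K → K := fun z => z ^ 2 + c

/-- `α` has exact period `m` under `fc c`. -/
def HasExactPeriod {K : Type*} [Field K] (c : K) (m : ℕ) (α : K) : Prop :=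
  (fc c)^[m] α = α ∧ ∀ j : ℕ, 1 ≤ j → j < m → (fc c)^[j] α ≠ α

/-- `α` has preperiodic type `m_n` under `fc c`: preperiod exactly `n`, eventual period `m`. -/
def HasPreperiodicType {K : Type*} [Field K] (c : K) (m n : ℕ) (α : K) : Prop :=
  HasExactPeriod c m ((fc c)^[n] α) ∧ (fc c)^[n + m - 1] α ≠ (fc c)^[n - 1] α

/-- Coprime positive integers whose product is a perfect power are perfect powers. -/
lemma Int.exists_eq_pow_of_mul_eq_pow_of_pos {a b c : ℤ} {k : ℕ} (h : IsCoprime a b) (ha : 0 < a)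
    (hk : Even k) (habc : a * b = c ^ k) : ∃ d, a = d ^ k := by
  obtain ⟨d, hd⟩ := exists_associated_pow_of_mul_eq_pow' h habc
  refine ⟨d, ?_⟩
  rcases Int.associated_iff.mp hd with h1 | h1
  · exact h1.symm
  · have := hk.pow_nonneg d
    omega

lemma Int.exists_pow_and_pow_of_mul_eq_pow {a b c : ℤ} {k : ℕ} (h : IsCoprime a b) (ha : 0 < a)
    (hb : 0 < b) (hk : Even k) (habc : a * b = c ^ k) : ∃ d e, a = d ^ k ∧ b = e ^ k := by
  obtain ⟨d, hd⟩ := Int.exists_eq_pow_of_mul_eq_pow_of_pos h ha hk habc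
  obtain ⟨e, he⟩ := Int.exists_eq_pow_of_mul_eq_pow_of_pos h.symm hb hk ((mul_comm b a).trans habc)
  exact ⟨d, e, hd, he⟩

/-- Splitting `p * c ^ k` between two coprime positive factors, for `p` prime. -/
lemma Int.split_prime {a b c p : ℤ} (hp : Prime p) (h : IsCoprime a b) (habc : a * b = p * c) :
    (∃ a', a = p * a' ∧ a' * b = c ∧ IsCoprime a' b) ∨
    (∃ b', b = p * b' ∧ a * b' = c ∧ IsCoprime a b') := by
  have hd : p ∣ a * b := ⟨c, habc⟩
  rcases hp.dvd_or_dvd hd with ⟨a', rfl⟩ | ⟨b', rfl⟩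
  · left
    refine ⟨a', rfl, mul_left_cancel₀ hp.ne_zero (by linarith), h.of_mul_left_right⟩
  · right
    refine ⟨b', rfl, mul_left_cancel₀ hp.ne_zero (by linarith), h.of_mul_right_right⟩

lemma Int.exists_sq_eq_eight_mul_add_one {a : ℤ} (h : Odd a) : ∃ k, a ^ 2 = 8 * k + 1 := by
  have := Int.sq_mod_four_eq_one_of_odd h
  obtain ⟨k, rfl⟩ := h
  rcases Int.even_or_odd' k with ⟨j, rfl | rfl⟩
  · exact ⟨2 * j ^ 2 + j, by ring⟩
  · exact ⟨2 * j ^ 2 + 3 * j + 1, by ring⟩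

/-- Coprime positive factors of `65 * c ^ 4`. -/
lemma Int.split_sixty_five {a b c : ℤ} (h : IsCoprime a b) (ha : 0 < a) (hb : 0 < b)
    (habc : a * b = 65 * c ^ 4) : ∃ u v, IsCoprime u v ∧ (u * v) ^ 2 = c ^ 2 ∧
    (a + b = u ^ 4 + 65 * v ^ 4 ∨ a + b = 5 * u ^ 4 + 13 * v ^ 4) := by
  have fin : ∀ {f g : ℤ}, IsCoprime f g → 0 < f → 0 < g → f * g = c ^ 4 →
      ∃ u v, f = u ^ 4 ∧ g = v ^ 4 ∧ IsCoprime u v ∧ (u * v) ^ 2 = c ^ 2 := by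
    intro f g hfg hf hg hm
    obtain ⟨u, v, hu, hv⟩ := Int.exists_pow_and_pow_of_mul_eq_pow hfg hf hg (by decide) hm
    refine ⟨u, v, hu, hv, ?_, ?_⟩
    · subst hu hv
      exact (IsCoprime.pow_iff (by norm_num) (by norm_num)).mp hfg
    have : ((u * v) ^ 2) ^ 2 = (c ^ 2) ^ 2 := by subst hu hv; linear_combination hm
    exact (pow_left_inj₀ (by positivity) (by positivity) two_ne_zero).mp this
  have p5 : Prime (5 : ℤ) := by norm_num
  have p13 : Prime (13 : ℤ) := by norm_num
  rcases Int.split_prime p5 h (c := 13 * c ^ 4) (by linarith)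
    with ⟨a', rfl, h2, h3⟩ | ⟨b', rfl, h2, h3⟩
  · rcases Int.split_prime p13 h3 h2 with ⟨a'', rfl, h4, h5⟩ | ⟨b'', rfl, h4, h5⟩
    · obtain ⟨u, v, rfl, rfl, h7, h6⟩ := fin h5 (by linarith) hb h4
      exact ⟨v, u, h7.symm, by rw [mul_comm, h6], Or.inl (by ring)⟩
    · obtain ⟨u, v, rfl, rfl, h7, h6⟩ := fin h5 (by linarith) (by linarith) h4
      exact ⟨u, v, h7, h6, Or.inr (by ring)⟩
  · rcases Int.split_prime p13 h3 h2 with ⟨a'', rfl, h4, h5⟩ | ⟨b'', rfl, h4, h5⟩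
    · obtain ⟨u, v, rfl, rfl, h7, h6⟩ := fin h5 (by linarith) (by linarith) h4
      exact ⟨v, u, h7.symm, by rw [mul_comm, h6], Or.inr (by ring)⟩
    · obtain ⟨u, v, rfl, rfl, h7, h6⟩ := fin h5 (by linarith) (by linarith) h4
      exact ⟨u, v, h7, h6, Or.inl (by ring)⟩

lemma not_sq_both_odd {x y w : ℤ} (hc : IsCoprime x y) (hx : Odd x) (hy : Odd y)
    (h : w ^ 2 = x ^ 4 + 14 * x ^ 2 * y ^ 2 + 65 * y ^ 4) : False := by
  wlog hw : 0 ≤ w generalizing w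
  · exact this (w := -w) (by rw [neg_sq, h]) (by linarith)
  obtain ⟨a, ha⟩ := Int.exists_sq_eq_eight_mul_add_one hx
  obtain ⟨b, hb⟩ := Int.exists_sq_eq_eight_mul_add_one hy
  have hk : x ^ 2 + 7 * y ^ 2 = 8 * (a + 7 * b + 1) := by linarith
  set k := a + 7 * b + 1 with hkd
  have h1 : w ^ 2 = 16 * (4 * k ^ 2 + y ^ 4) := by
    have : w ^ 2 = (x ^ 2 + 7 * y ^ 2) ^ 2 + 16 * y ^ 4 := by rw [h]; ring
    rw [this, hk]; ring
  have h4 : (4 : ℤ) ∣ w := by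
    have : (4 : ℤ) ^ 2 ∣ w ^ 2 := ⟨4 * k ^ 2 + y ^ 4, by rw [h1]; norm_num⟩
    exact (Int.pow_dvd_pow_iff two_ne_zero).mp this
  obtain ⟨v, rfl⟩ := h4
  have h2 : (v + 2 * k) * (v - 2 * k) = y ^ 4 := by nlinarith
  have hv : 0 ≤ v := by linarith
  have hy0 : y ≠ 0 := by rintro rfl; simp at hy
  have hy4 : 0 < y ^ 4 := by positivity
  have hkpos : 0 < k := by nlinarith [sq_nonneg x, sq_nonneg y, sq_pos_of_ne_zero hy0]
  have hp : 0 < v + 2 * k := by linarith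
  have hm : 0 < v - 2 * k := by
    by_contra hcon
    nlinarith
  have hcop : IsCoprime (v + 2 * k) (v - 2 * k) := by
    refine isCoprime_of_prime_dvd (fun h0 => hp.ne' h0.1) fun p hpi d1 d2 => ?_
    have dy : p ∣ y := hpi.dvd_of_dvd_pow (h2 ▸ d1.mul_right _)
    have d4 : p ∣ 8 * k := by
      have h := (d1.sub d2).mul_left 2
      rwa [show 2 * ((v + 2 * k) - (v - 2 * k)) = 8 * k by ring] at h
    have dx : p ∣ x := by
      apply hpi.dvd_of_dvd_pow (n := 2)
      have e : x ^ 2 = 8 * k - 7 * y ^ 2 := by linarith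
      rw [e]
      exact d4.sub ((dvd_pow dy two_ne_zero).mul_left 7)
    exact hpi.not_isUnit (hc.isUnit_of_dvd' dx dy)
  obtain ⟨s, t, hs, ht⟩ := Int.exists_pow_and_pow_of_mul_eq_pow hcop hp hm (by decide) h2
  have hst : s ^ 2 * t ^ 2 = y ^ 2 := by
    have : (s ^ 2 * t ^ 2) ^ 2 = (y ^ 2) ^ 2 := by rw [hs, ht] at h2; linear_combination h2
    exact (pow_left_inj₀ (by positivity) (by positivity) two_ne_zero).mp this
  have key : x ^ 2 = 2 * s ^ 4 - 7 * (s ^ 2 * t ^ 2) - 2 * t ^ 4 := by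
    rw [hst]; linear_combination hk + 2 * hs - 2 * ht
  have m5 : ∀ s t x : ZMod 5, x ^ 2 = 2 * s ^ 4 - 7 * (s ^ 2 * t ^ 2) - 2 * t ^ 4 →
      s = 0 ∧ t = 0 := by
    decide
  obtain ⟨z1, z2⟩ := m5 s t x (by exact_mod_cast congrArg (Int.cast : ℤ → ZMod 5) key)
  rw [ZMod.intCast_zmod_eq_zero_iff_dvd] at z1 z2
  have u := hcop
  rw [hs, ht] at u
  have := u.isUnit_of_dvd' (dvd_pow z1 four_ne_zero) (dvd_pow z2 four_ne_zero)
  exact absurd this (by norm_num [Int.isUnit_iff])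

lemma not_sq_five_thirteen {u v w : ℤ} (hc : IsCoprime u v)
    (h : w ^ 2 = 5 * u ^ 4 + 14 * (u * v) ^ 2 + 13 * v ^ 4) : False := by
  rcases Int.even_or_odd u with hu | hu <;> rcases Int.even_or_odd v with hv | hv
  · have := hc.isUnit_of_dvd' hu.two_dvd hv.two_dvd
    exact absurd this (by norm_num [Int.isUnit_iff])
  · obtain ⟨b, hb⟩ := Int.exists_sq_eq_eight_mul_add_one hv
    obtain ⟨a, rfl⟩ := hu.two_dvd
    have e : w ^ 2 = 8 * (10 * a ^ 4 + 7 * a ^ 2 * v ^ 2 + 13 * (8 * b ^ 2 + 2 * b) + 1) + 5 := by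
      rw [h]; linear_combination 13 * (v ^ 2 + 8 * b + 1) * hb
    have m : ∀ x : ZMod 8, x ^ 2 ≠ 5 := by decide
    refine m w ?_
    have := congrArg (Int.cast : ℤ → ZMod 8) e
    push_cast at this
    rw [this, show (8 : ZMod 8) = 0 from rfl]; ring
  · obtain ⟨b, hb⟩ := Int.exists_sq_eq_eight_mul_add_one hu
    obtain ⟨a, rfl⟩ := hv.two_dvd
    have e : w ^ 2 = 8 * (26 * a ^ 4 + 7 * a ^ 2 * u ^ 2 + 5 * (8 * b ^ 2 + 2 * b)) + 5 := by
      rw [h]; linear_combination 5 * (u ^ 2 + 8 * b + 1) * hb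
    have m : ∀ x : ZMod 8, x ^ 2 ≠ 5 := by decide
    refine m w ?_
    have := congrArg (Int.cast : ℤ → ZMod 8) e
    push_cast at this
    rw [this, show (8 : ZMod 8) = 0 from rfl]; ring
  · obtain ⟨a, ha⟩ := Int.exists_sq_eq_eight_mul_add_one hu
    obtain ⟨b, hb⟩ := Int.exists_sq_eq_eight_mul_add_one hv
    have e : w ^ 2 = 5 * (8 * a + 1) ^ 2 + 14 * ((8 * a + 1) * (8 * b + 1)) +
        13 * (8 * b + 1) ^ 2 := by
      rw [h, ← ha, ← hb]; ring
    have m : ∀ x : ZMod 64, x ^ 2 ≠ 32 := by decide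
    refine m w ?_
    have e2 : w ^ 2 = 64 * (5 * a ^ 2 + 14 * a * b + 13 * b ^ 2 + 3 * a + 5 * b) + 32 := by
      rw [e]; ring
    have := congrArg (Int.cast : ℤ → ZMod 64) e2
    push_cast at this
    rw [this, show (64 : ZMod 64) = 0 from rfl]; ring

lemma split_sq_sub {s b f g : ℤ} (hs : f + g = s) (hpos : 0 < s) (hb : b ≠ 0)
    (hfg : f * g = 65 * b ^ 4) (hc : ∀ p : ℤ, Prime p → p ∣ f → p ∣ g → p ∣ b → False) :
    ∃ u v, IsCoprime u v ∧ (u * v) ^ 2 = b ^ 2 ∧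
    (s = u ^ 4 + 65 * v ^ 4 ∨ s = 5 * u ^ 4 + 13 * v ^ 4) := by
  have hb4 : 0 < b ^ 4 := by positivity
  have hf : 0 < f := by
    by_contra hcon
    have : g > 0 := by linarith
    nlinarith
  have hg : 0 < g := by
    by_contra hcon
    nlinarith
  rw [← hs]
  refine Int.split_sixty_five ?_ hf hg hfg
  refine isCoprime_of_prime_dvd (fun h0 => hf.ne' h0.1) fun p hp d1 d2 => ?_
  have hpb : ¬ p ∣ b := fun d => hc p hp d1 d2 d
  have h2 : p * p ∣ 65 * b ^ 4 := hfg ▸ mul_dvd_mul d1 d2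
  have h3 : IsCoprime (p * p) (b ^ 4) := by
    have : IsCoprime p b := (hp.coprime_iff_not_dvd).mpr hpb
    exact (this.mul_left this).pow_right
  have h4 := h3.dvd_of_dvd_mul_right h2
  have sf : Squarefree (65 : ℤ) := by
    rw [← Int.squarefree_natAbs]; decide +kernel
  exact hp.not_isUnit (sf p h4)

lemma Int.prime_odd_absurd {p a b : ℤ} {n : ℤ} {k : ℕ} (hp : Prime p) (hb : Odd b)
    (hab : IsCoprime a b)
    (hn : n = 2 ^ k) (hd : p ∣ n * a ^ 2) (hpb : p ∣ b) : False := by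
  subst hn
  rcases hp.dvd_or_dvd hd with h | h
  · have h2 := hp.dvd_of_dvd_pow h
    have : IsCoprime (2 : ℤ) b := (Int.isCoprime_two_left).mpr hb
    exact hp.not_isUnit (this.isUnit_of_dvd' h2 hpb)
  · exact hp.not_isUnit (hab.isUnit_of_dvd' (hp.dvd_of_dvd_pow h) hpb)

/-- The curve `w ^ 2 = x ^ 4 + 14 x ^ 2 y ^ 2 + 65 y ^ 4` has only the trivial coprime points. -/
lemma eq_zero_of_sq_eq_quartic : ∀ (n : ℕ) (x y w : ℤ), y.natAbs = n → IsCoprime x y →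
    w ^ 2 = x ^ 4 + 14 * x ^ 2 * y ^ 2 + 65 * y ^ 4 → y = 0 := by
  intro n
  induction n using Nat.strong_induction_on with
  | _ n ih =>
  intro x y w hn hc h
  by_contra hy0
  wlog hw : 0 ≤ w generalizing w
  · exact this (w := -w) (by rw [neg_sq, h]) (by linarith)
  have hy2 : 0 < y ^ 2 := by positivity
  have hPodd : Odd (x ^ 2 + 7 * y ^ 2) := by
    rcases Int.even_or_odd x with hx | hx <;> rcases Int.even_or_odd y with hy | hy
    · have := hc.isUnit_of_dvd' hx.two_dvd hy.two_dvd
      exact absurd this (by norm_num [Int.isUnit_iff])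
    · exact (hx.pow_of_ne_zero two_ne_zero).add_odd ((by decide : Odd (7:ℤ)).mul hy.pow)
    · exact hx.pow.add_even ((hy.pow_of_ne_zero two_ne_zero).mul_left 7)
    · exact (not_sq_both_odd hc hx hy h).elim
  have hwP : w ^ 2 = (x ^ 2 + 7 * y ^ 2) ^ 2 + 16 * y ^ 4 := by rw [h]; ring
  have hwodd : Odd w := by
    have : Odd (w ^ 2) := by
      rw [hwP]; exact hPodd.pow.add_even ((by decide : Even (16:ℤ)).mul_right _)
    exact (Int.odd_pow' two_ne_zero).mp this
  obtain ⟨A, hA⟩ := (hwodd.sub_odd hPodd).two_dvd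
  have hB : w + (x ^ 2 + 7 * y ^ 2) = 2 * (A + (x ^ 2 + 7 * y ^ 2)) := by linarith
  obtain ⟨B, hBd⟩ : ∃ B, B = A + (x ^ 2 + 7 * y ^ 2) := ⟨_, rfl⟩
  have hAB : A * B = 4 * y ^ 4 := by rw [hBd]; nlinarith
  have hwAB : w = A + B := by linarith
  have hPAB : x ^ 2 + 7 * y ^ 2 = B - A := by linarith
  have hy4 : 0 < y ^ 4 := by positivity
  have hBpos : 0 < B := by nlinarith [sq_nonneg x]
  have hApos : 0 < A := by
    by_contra hcon
    nlinarith
  have hcop : IsCoprime A B := by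
    refine isCoprime_of_prime_dvd (fun h0 => hApos.ne' h0.1) fun p hp d1 d2 => ?_
    have dP : p ∣ x ^ 2 + 7 * y ^ 2 := hPAB ▸ d2.sub d1
    have h4 : p ∣ 4 * y ^ 4 := hAB ▸ d1.mul_right _
    have dy : p ∣ y := by
      rcases hp.dvd_or_dvd h4 with h5 | h5
      · have h6 : p ∣ 2 := hp.dvd_of_dvd_pow (n := 2) (by norm_num; exact h5)
        exact (hp.not_isUnit (((Int.isCoprime_two_left).mpr hPodd).isUnit_of_dvd' h6 dP)).elim
      · exact hp.dvd_of_dvd_pow h5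
    have dx : p ∣ x := hp.dvd_of_dvd_pow (n := 2)
      ((dvd_add_left ((dvd_pow dy two_ne_zero).mul_left 7)).mp dP)
    exact hp.not_isUnit (hc.isUnit_of_dvd' dx dy)
  have hsplit : ∀ {C D : ℤ}, IsCoprime C D → 0 < C → 0 < D → C * D = 4 * y ^ 4 → Even C →
      ∃ a b : ℤ, C = 4 * a ^ 4 ∧ D = b ^ 4 ∧ (a * b) ^ 2 = y ^ 2 ∧ Odd b ∧ IsCoprime a b := by
    intro C D hCD hC hD hm he
    have hDodd : Odd D := by
      by_contra ho
      have := hCD.isUnit_of_dvd' he.two_dvd (Int.not_odd_iff_even.mp ho).two_dvd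
      exact absurd this (by norm_num [Int.isUnit_iff])
    have h4D : IsCoprime (4 : ℤ) D := by
      have := ((Int.isCoprime_two_left).mpr hDodd).pow_left (m := 2)
      norm_num at this; exact this
    obtain ⟨C', rfl⟩ : (4 : ℤ) ∣ C := h4D.dvd_of_dvd_mul_right ⟨_, hm⟩
    have hm' : C' * D = y ^ 4 := by linarith
    obtain ⟨a, b, rfl, rfl⟩ := Int.exists_pow_and_pow_of_mul_eq_pow hCD.of_mul_left_right
      (by linarith) hD (by decide) hm'
    refine ⟨a, b, rfl, rfl, ?_, (Int.odd_pow' four_ne_zero).mp hDodd,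
      (IsCoprime.pow_iff (by norm_num) (by norm_num)).mp hCD.of_mul_left_right⟩
    have : ((a * b) ^ 2) ^ 2 = (y ^ 2) ^ 2 := by linear_combination hm'
    exact (pow_left_inj₀ (by positivity) (by positivity) two_ne_zero).mp this
  rcases Int.even_or_odd A with hAe | hAo
  · obtain ⟨b, a, rfl, rfl, hab, hao, hco⟩ := hsplit hcop hApos hBpos hAB hAe
    have hxa : x ^ 2 = a ^ 4 - 7 * (a * b) ^ 2 - 4 * b ^ 4 := by
      rw [← hab] at hPAB; linear_combination hPAB
    have hb0 : b ≠ 0 := by rintro rfl; simp at hApos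
    have ha2 : 0 < a ^ 2 := by have : a ≠ 0 := (by rintro rfl; simp at hao); positivity
    have hb2 : 0 < b ^ 2 := by positivity
    have hgt : 7 * b ^ 2 < a ^ 2 := by
      by_contra hcon
      nlinarith [sq_nonneg x, mul_pos ha2 hb2]
    rcases Int.even_or_odd b with hbe | hbo
    · obtain ⟨b', rfl⟩ := hbe.two_dvd
      have hxo : Odd x := by
        have : Odd (x ^ 2) := by
          rw [hxa]
          have : Even (7 * (a * (2 * b')) ^ 2 + 4 * (2 * b') ^ 4) :=
            ⟨7 * 2 * (a * b') ^ 2 + 2 * (2 * b') ^ 4, by ring⟩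
          rw [sub_sub]
          exact hao.pow.sub_even this
        exact (Int.odd_pow' two_ne_zero).mp this
      have hev : Even (a ^ 2 - 14 * b' ^ 2 - x) := by
        have : Even (14 * b' ^ 2) := ⟨7 * b' ^ 2, by ring⟩
        exact (hao.pow.sub_even this).sub_odd hxo
      obtain ⟨f, hf⟩ := hev.two_dvd
      obtain ⟨u, v, huv, huvb, h1 | h1⟩ := split_sq_sub (s := a ^ 2 - 14 * b' ^ 2) (b := b')
        (f := f) (g := f + x) (by linarith) (by nlinarith) (by rintro rfl; simp at hb0)
        (by
          have e1 : 2 * f = a ^ 2 - 14 * b' ^ 2 - x := hf.symm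
          have : 4 * (f * (f + x)) = 4 * (65 * b' ^ 4) := by
            have : 4 * (f * (f + x)) = (2 * f) * (2 * f + 2 * x) := by ring
            rw [this, e1]; linear_combination -hxa
          linarith)
        (by
          intro p hp d1 d2 d3
          have : p ∣ 1 * a ^ 2 := by
            have e : 1 * a ^ 2 = f + (f + x) + 14 * b' * b' := by linarith
            rw [e]; exact (d1.add d2).add (d3.mul_left _)
          rw [one_mul] at this
          exact hp.not_isUnit (hco.isUnit_of_dvd' (d3.mul_left 2) (hp.dvd_of_dvd_pow this)))
      · have hv0 : v = 0 := by
          refine ih v.natAbs ?_ u v a rfl huv (by linear_combination h1 - 14 * huvb)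
          rw [← hn, Int.natAbs_lt_iff_sq_lt, ← hab]
          have hu : 0 < u ^ 2 := by
            have : u ≠ 0 := by
              rintro rfl
              have : b' = 0 := by nlinarith
              simp [this] at hb0
            positivity
          nlinarith [sq_nonneg v, mul_pos ha2 hb2]
        subst hv0
        have : b' = 0 := by nlinarith
        simp [this] at hb0
      · exact not_sq_five_thirteen (w := a) huv (by linear_combination h1 - 14 * huvb)
    · obtain ⟨u, v, huv, huvb, h1 | h1⟩ := split_sq_sub (s := 4 * a ^ 2 - 14 * b ^ 2) (b := b)
        (f := 2 * a ^ 2 - 7 * b ^ 2 - 2 * x) (g := 2 * a ^ 2 - 7 * b ^ 2 + 2 * x) (by ring)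
        (by nlinarith) hb0 (by linear_combination -4 * hxa)
        (by
          intro p hp d1 d2 d3
          refine Int.prime_odd_absurd (k := 2) hp hbo hco.symm rfl (?_ : p ∣ 2 ^ 2 * a ^ 2) d3
          have e : 2 ^ 2 * a ^ 2 = (2 * a ^ 2 - 7 * b ^ 2 - 2 * x) +
            (2 * a ^ 2 - 7 * b ^ 2 + 2 * x) + 14 * b * b := by ring
          rw [e]; exact (d1.add d2).add (d3.mul_left _))
      · have hbo2 : Odd ((u * v) ^ 2) := huvb ▸ hbo.pow
        have := Int.odd_mul.mp ((Int.odd_pow' two_ne_zero).mp hbo2)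
        exact not_sq_both_odd (w := 2 * a) huv this.1 this.2 (by linear_combination h1 - 14 * huvb)
      · exact not_sq_five_thirteen (w := 2 * a) huv (by linear_combination h1 - 14 * huvb)
  · have hBe : Even B := by
      by_contra ho
      have := hAo.add_odd (Int.not_even_iff_odd.mp ho)
      rw [← hwAB] at this
      exact (Int.not_odd_iff_even.mpr this) hwodd
    obtain ⟨a, b, rfl, rfl, hab, hbo, hco⟩ := hsplit hcop.symm hBpos hApos
      ((mul_comm _ _).trans hAB) hBe
    have hxa : x ^ 2 = 4 * a ^ 4 - 7 * (a * b) ^ 2 - b ^ 4 := by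
      rw [← hab] at hPAB; linear_combination hPAB
    have hb0 : b ≠ 0 := by rintro rfl; simp at hbo
    have ha2 : 0 < a ^ 2 := by have : a ≠ 0 := (by rintro rfl; simp at hBpos); positivity
    have hb2 : 0 < b ^ 2 := by positivity
    have hgt : 7 * b ^ 2 < 4 * a ^ 2 := by
      by_contra hcon
      nlinarith [sq_nonneg x, mul_pos ha2 hb2]
    obtain ⟨u, v, huv, huvb, h1 | h1⟩ := split_sq_sub (s := 16 * a ^ 2 - 14 * b ^ 2) (b := b)
      (f := 8 * a ^ 2 - 7 * b ^ 2 - 4 * x) (g := 8 * a ^ 2 - 7 * b ^ 2 + 4 * x) (by ring)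
      (by nlinarith) hb0 (by linear_combination -16 * hxa)
      (by
        intro p hp d1 d2 d3
        refine Int.prime_odd_absurd (k := 4) hp hbo hco rfl (?_ : p ∣ 2 ^ 4 * a ^ 2) d3
        have e : 2 ^ 4 * a ^ 2 = (8 * a ^ 2 - 7 * b ^ 2 - 4 * x) +
          (8 * a ^ 2 - 7 * b ^ 2 + 4 * x) + 14 * b * b := by ring
        rw [e]; exact (d1.add d2).add (d3.mul_left _))
    · have hbo2 : Odd ((u * v) ^ 2) := huvb ▸ hbo.pow
      have := Int.odd_mul.mp ((Int.odd_pow' two_ne_zero).mp hbo2)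
      exact not_sq_both_odd (w := 4 * a) huv this.1 this.2 (by linear_combination h1 - 14 * huvb)
    · exact not_sq_five_thirteen (w := 4 * a) huv (by linear_combination h1 - 14 * huvb)

lemma Int.exists_eq_mul_of_mul_eq_mul {m n r s : ℤ} (h : m * n = r * s) (hm : m ≠ 0)
    (hr : r ≠ 0) : ∃ α β γ δ, m = α * β ∧ n = γ * δ ∧ r = α * γ ∧ s = β * δ := by
  obtain ⟨β, hβ⟩ := Int.gcd_dvd_left m r
  obtain ⟨γ, hγ⟩ := Int.gcd_dvd_right m r
  have hg : (m.gcd r : ℤ) ≠ 0 := fun h0 => hm (by rw [hβ, h0, zero_mul])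
  have hβγ : IsCoprime γ β := by
    have h1 : m / m.gcd r = β := (Int.ediv_eq_of_eq_mul_right hg hβ)
    have h2 : r / m.gcd r = γ := (Int.ediv_eq_of_eq_mul_right hg hγ)
    rw [← h1, ← h2, isCoprime_comm, Int.isCoprime_iff_gcd_eq_one]
    exact Int.gcd_ediv_gcd_ediv_gcd (Int.gcd_pos_of_ne_zero_left _ hm)
  generalize (m.gcd r : ℤ) = α at *
  subst hβ hγ
  have e : β * n = γ * s := mul_left_cancel₀ hg (by linear_combination h)
  obtain ⟨δ, rfl⟩ : γ ∣ n := hβγ.dvd_of_dvd_mul_left ⟨s, e⟩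
  exact ⟨α, β, γ, δ, rfl, rfl, rfl,
    mul_left_cancel₀ (right_ne_zero_of_mul hr) (by linear_combination -e)⟩

lemma Int.seven_dvd_of_dvd_add_sq {x y : ℤ} (h : (7 : ℤ) ∣ x ^ 2 + y ^ 2) :
    (7 : ℤ) ∣ x ∧ (7 : ℤ) ∣ y := by
  have key : ∀ x y : ZMod 7, x ^ 2 + y ^ 2 = 0 → x = 0 ∧ y = 0 := by decide
  have := key x y (by exact_mod_cast (ZMod.intCast_zmod_eq_zero_iff_dvd _ 7).mpr h)
  simpa [ZMod.intCast_zmod_eq_zero_iff_dvd] using this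

lemma Int.not_seven_dvd_of_isCoprime {x y : ℤ} (h : IsCoprime x y) (h7 : (7 : ℤ) ∣ x ^ 2 + y ^ 2) :
    False := by
  obtain ⟨h1, h2⟩ := Int.seven_dvd_of_dvd_add_sq h7
  exact absurd (h.isUnit_of_dvd' h1 h2) (by norm_num [Int.isUnit_iff])

lemma Int.eq_one_or_seven {k a b m n : ℤ} (hab : IsCoprime a b) (h1 : 7 * a ^ 2 = k * m)
    (h2 : 7 * b ^ 2 = k * n) (hk : 0 < k) : k = 1 ∨ k = 7 := by
  obtain ⟨u, v, huv⟩ := (hab.pow : IsCoprime (a ^ 2) (b ^ 2))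
  have h7 : k ∣ 7 := ⟨u * m + v * n, by linear_combination (-7) * huv + u * h1 + v * h2⟩
  have : k.natAbs ∣ 7 := by simpa using Int.natAbs_dvd_natAbs.mpr h7
  rcases (Nat.dvd_prime (by norm_num)).mp this with h | h <;> omega

lemma Int.natAbs_lt_of_eq_two_mul {b x g : ℤ} (h : b = 2 * (x * g)) (hx : x ≠ 0) (hg : g ≠ 0) :
    g.natAbs < b.natAbs := by
  rw [h, Int.natAbs_mul, Int.natAbs_mul]
  have h1 := Int.natAbs_pos.mpr hx
  have h2 := Int.natAbs_pos.mpr hg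
  change _ < 2 * _
  nlinarith

/-- `1` and `8` are not simultaneously concordant: the system `a² + b² = c²`, `a² + 8b² = d²`
has only the trivial coprime solutions. -/
lemma eq_zero_of_concordant : ∀ (N : ℕ) (a b c d : ℤ), b.natAbs = N → IsCoprime a b →
    a ^ 2 + b ^ 2 = c ^ 2 → a ^ 2 + 8 * b ^ 2 = d ^ 2 → b = 0 := by
  intro N
  induction N using Nat.strong_induction_on with
  | _ N ih =>
  intro a b c d hN hab hc hd
  by_contra hb0
  wlog hdpos : 0 ≤ d generalizing d
  · exact this (d := -d) (by rw [neg_sq, hd]) (by linarith)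
  wlog hcpos : 0 ≤ c generalizing c
  · exact this (c := -c) (by rw [neg_sq, hc]) (by linarith)
  have hb2 : 0 < b ^ 2 := by positivity
  have hpar : Odd a ∧ Even b := by
    have key : ∀ a b c d : ZMod 16, a ^ 2 + b ^ 2 = c ^ 2 → a ^ 2 + 8 * b ^ 2 = d ^ 2 →
      (a * 8 = 8 ∧ b * 8 = 0) ∨ (a * 8 = 0 ∧ b * 8 = 0) := by decide +kernel
    have hz : ∀ x : ℤ, (x : ZMod 16) * 8 = 0 → Even x := by
      intro x hx
      have : ((x * 8 : ℤ) : ZMod 16) = 0 := by push_cast; exact hx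
      rw [ZMod.intCast_zmod_eq_zero_iff_dvd] at this
      exact even_iff_two_dvd.mpr (by omega)
    have hk := key a b c d (by exact_mod_cast congrArg (Int.cast : ℤ → ZMod 16) hc)
      (by exact_mod_cast congrArg (Int.cast : ℤ → ZMod 16) hd)
    have hbe : Even b := by rcases hk with h | h <;> exact hz _ h.2
    refine ⟨?_, hbe⟩
    by_contra ha
    exact absurd (hab.isUnit_of_dvd' (Int.not_odd_iff_even.mp ha).two_dvd hbe.two_dvd)
      (by norm_num [Int.isUnit_iff])
  obtain ⟨hao, hbe⟩ := hpar
  have hcp : 0 < c := by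
    rcases hcpos.lt_or_eq with h | h
    · exact h
    · subst h; nlinarith [sq_nonneg a]
  obtain ⟨m, n, ha, hb, -, hmn, -, -⟩ := PythagoreanTriple.coprime_classification'
    (x := a) (y := b) (z := c) (by unfold PythagoreanTriple; linarith)
    (Int.isCoprime_iff_gcd_eq_one.mp hab) (Int.odd_iff.mp hao) hcp
  rw [← Int.isCoprime_iff_gcd_eq_one] at hmn
  have hdo : Odd d := by
    have : Odd (d ^ 2) := by
      rw [← hd]; exact hao.pow.add_even ((by decide : Even (8 : ℤ)).mul_right _)
    exact (Int.odd_pow' two_ne_zero).mp this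
  obtain ⟨A, hA⟩ := (hdo.sub_odd hao).two_dvd
  have hAB : A * (A + a) = 2 * b ^ 2 := by nlinarith
  have hBpos : 0 < A + a := by nlinarith
  have hApos : 0 < A := by
    by_contra hcon
    nlinarith
  have hcop : IsCoprime A (A + a) := by
    refine isCoprime_of_prime_dvd (fun h0 => hApos.ne' h0.1) fun p hp d1 d2 => ?_
    have da : p ∣ a := (dvd_add_right d1).mp d2
    have h4 : p ∣ 2 * b ^ 2 := hAB ▸ d1.mul_right _
    rcases hp.dvd_or_dvd h4 with h5 | h5
    · exact hp.not_isUnit (((Int.isCoprime_two_left).mpr hao).isUnit_of_dvd' h5 da)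
    · exact hp.not_isUnit (hab.isUnit_of_dvd' da (hp.dvd_of_dvd_pow h5))
  have hsq : ∀ {f g : ℤ}, IsCoprime f g → 0 < f → 0 < g → f * g = b ^ 2 →
      ∃ r s, f = r ^ 2 ∧ g = s ^ 2 ∧ b = r * s := by
    intro f g hfg hf hg h
    obtain ⟨r, s, rfl, rfl⟩ := Int.exists_pow_and_pow_of_mul_eq_pow hfg hf hg even_two h
    rcases sq_eq_sq_iff_eq_or_eq_neg.mp (show b ^ 2 = (r * s) ^ 2 by rw [← h]; ring) with h1 | h1
    · exact ⟨r, s, rfl, rfl, h1⟩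
    · exact ⟨-r, s, by ring, rfl, by rw [h1]; ring⟩
  have hrs : ∃ r s, b = r * s ∧ IsCoprime (2 * r ^ 2) (s ^ 2) ∧
      (a = s ^ 2 - 2 * r ^ 2 ∨ a = -(s ^ 2 - 2 * r ^ 2)) := by
    rcases Int.split_prime Int.prime_two hcop hAB with ⟨f, hf, h1, h2⟩ | ⟨g, hg, h1, h2⟩
    · obtain ⟨r, s, rfl, h4, h5⟩ := hsq h2 (by linarith) hBpos h1
      refine ⟨r, s, h5, ?_, Or.inl (by linarith)⟩
      rw [← h4, ← hf]; exact hcop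
    · obtain ⟨s, r, rfl, rfl, h5⟩ := hsq h2 hApos (by linarith) h1
      refine ⟨r, s, by rw [h5]; ring, ?_, Or.inr (by linarith)⟩
      rw [← hg]; exact hcop.symm
  obtain ⟨r, s, hbrs, hrs2, hars⟩ := hrs
  have hso : Odd s := by
    have := hrs2.of_mul_left_left
    rw [Int.isCoprime_two_left] at this
    exact (Int.odd_pow' two_ne_zero).mp this
  have hre : Even r := by
    rcases Int.even_mul.mp (hbrs ▸ hbe) with h | h
    · exact h
    · exact absurd hso (Int.not_odd_iff_even.mpr h)
  obtain ⟨r', rfl⟩ := hre.two_dvd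
  have hmn0 : m * n = r' * s := by linarith
  have hm0 : m ≠ 0 := by rintro rfl; simp at hb; exact hb0 hb
  have hr0 : r' ≠ 0 := by rintro rfl; simp at hbrs; exact hb0 hbrs
  obtain ⟨α, β, γ, δ, rfl, rfl, rfl, rfl⟩ := Int.exists_eq_mul_of_mul_eq_mul hmn0 hm0 hr0
  have hαδ : IsCoprime δ α := hmn.of_mul_left_left.of_mul_right_right.symm
  have hrs3 : IsCoprime ((α * γ)) (β * δ) :=
    (IsCoprime.pow_left_iff (m := 2) two_pos).mp ((IsCoprime.pow_right_iff two_pos).mp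
      (by
        have := hrs2.of_mul_left_right
        rw [mul_pow] at this
        exact this.of_mul_left_right))
  have hβγ : IsCoprime β γ := hrs3.of_mul_left_right.of_mul_right_left.symm
  have hα0 : α ≠ 0 := left_ne_zero_of_mul hm0
  have hβ0 : β ≠ 0 := right_ne_zero_of_mul hm0
  have hγ0 : γ ≠ 0 := right_ne_zero_of_mul hr0
  have hδ0 : δ ≠ 0 := by rintro rfl; simp at hb; exact hb0 hb
  have hβγ2 : IsCoprime (β ^ 2) (γ ^ 2) := hβγ.pow
  have hα2 : 0 < α ^ 2 := by positivity
  have hβ2 : 0 < β ^ 2 := by positivity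
  have hγ2 : 0 < γ ^ 2 := by positivity
  have hδ2 : 0 < δ ^ 2 := by positivity
  rcases hars with h | h
  · have e : β ^ 2 * (α ^ 2 - δ ^ 2) = γ ^ 2 * (δ ^ 2 - 8 * α ^ 2) := by
      linear_combination h - ha
    obtain ⟨k, hk⟩ : γ ^ 2 ∣ α ^ 2 - δ ^ 2 := hβγ2.symm.dvd_of_dvd_mul_left ⟨_, e⟩
    have hk2 : δ ^ 2 - 8 * α ^ 2 = β ^ 2 * k := by
      apply mul_left_cancel₀ hγ2.ne'
      rw [← e, hk]; ring
    have e1 : 7 * α ^ 2 = -k * (β ^ 2 + γ ^ 2) := by linear_combination -hk - hk2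
    have e2 : 7 * δ ^ 2 = -k * (β ^ 2 + 8 * γ ^ 2) := by linear_combination -8 * hk - hk2
    have hkpos : 0 < -k := by
      by_contra hcon
      nlinarith
    rcases Int.eq_one_or_seven hαδ.symm e1 e2 hkpos with h1 | h1
    · rw [h1] at e1
      exact Int.not_seven_dvd_of_isCoprime hβγ ⟨α ^ 2, by linear_combination -e1⟩
    · rw [h1] at e1 e2
      refine hγ0 (ih γ.natAbs ?_ β γ α δ rfl hβγ (by linarith) (by linarith))
      exact hN ▸ Int.natAbs_lt_of_eq_two_mul (x := α * β * δ) (by rw [hb]; ring)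
        (mul_ne_zero hm0 hδ0) hγ0
  · have e : β ^ 2 * (α ^ 2 + δ ^ 2) = γ ^ 2 * (δ ^ 2 + 8 * α ^ 2) := by
      linear_combination h - ha
    obtain ⟨k, hk⟩ : γ ^ 2 ∣ α ^ 2 + δ ^ 2 := hβγ2.symm.dvd_of_dvd_mul_left ⟨_, e⟩
    have hk2 : δ ^ 2 + 8 * α ^ 2 = β ^ 2 * k := by
      apply mul_left_cancel₀ hγ2.ne'
      rw [← e, hk]; ring
    have e1 : 7 * α ^ 2 = k * (β ^ 2 - γ ^ 2) := by linear_combination -hk + hk2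
    have e2 : 7 * δ ^ 2 = k * (8 * γ ^ 2 - β ^ 2) := by linear_combination 8 * hk - hk2
    have hkpos : 0 < k := by
      by_contra hcon
      nlinarith
    rcases Int.eq_one_or_seven hαδ.symm e1 e2 hkpos with h1 | h1
    · rw [h1] at hk hk2
      refine hα0 (ih α.natAbs ?_ δ α γ β rfl hαδ (by linarith) (by linarith))
      exact hN ▸ Int.natAbs_lt_of_eq_two_mul (x := γ * β * δ) (by rw [hb]; ring)
        (mul_ne_zero (mul_ne_zero hγ0 hβ0) hδ0) hα0
    · rw [h1] at hk
      exact Int.not_seven_dvd_of_isCoprime hαδ ⟨γ ^ 2, by linear_combination hk⟩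

lemma eq_zero_or_sq_eq_of_isSquare {X Y W : ℤ} (hXY : IsCoprime X Y)
    (h : (X ^ 2 - Y ^ 2) * (X ^ 2 + 7 * Y ^ 2) = W ^ 2) : Y = 0 ∨ X ^ 2 = Y ^ 2 := by
  by_cases hY : Y = 0
  · exact Or.inl hY
  right
  by_contra hne
  have hY2 : 0 < Y ^ 2 := by positivity
  have hBpos : 0 < X ^ 2 + 7 * Y ^ 2 := by positivity
  have hApos : 0 < X ^ 2 - Y ^ 2 := by
    by_contra hcon
    have : X ^ 2 - Y ^ 2 < 0 := lt_of_le_of_ne (not_lt.mp hcon) (sub_ne_zero.mpr hne)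
    nlinarith [sq_nonneg W]
  have odd_case : Odd (X ^ 2 - Y ^ 2) → False := by
    intro ho
    have hcop : IsCoprime (X ^ 2 - Y ^ 2) (X ^ 2 + 7 * Y ^ 2) := by
      refine isCoprime_of_prime_dvd (fun h0 => hApos.ne' h0.1) fun p hp d1 d2 => ?_
      have d3 : p ∣ 2 ^ 3 * Y ^ 2 := by
        have := d2.sub d1
        rwa [show X ^ 2 + 7 * Y ^ 2 - (X ^ 2 - Y ^ 2) = 2 ^ 3 * Y ^ 2 by ring] at this
      have dY : p ∣ Y := by
        rcases hp.dvd_or_dvd d3 with h5 | h5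
        · exact (hp.not_isUnit (((Int.isCoprime_two_left).mpr ho).isUnit_of_dvd'
            (hp.dvd_of_dvd_pow h5) d1)).elim
        · exact hp.dvd_of_dvd_pow h5
      have dX : p ∣ X := hp.dvd_of_dvd_pow ((dvd_sub_left (dvd_pow dY two_ne_zero)).mp d1)
      exact hp.not_isUnit (hXY.isUnit_of_dvd' dX dY)
    obtain ⟨u, v, hu, hv⟩ := Int.exists_pow_and_pow_of_mul_eq_pow hcop hApos hBpos even_two h
    refine hY (eq_zero_of_concordant _ u Y X v rfl ?_ (by linarith) (by linarith))
    refine (IsCoprime.pow_iff (m := 2) (n := 2) two_pos two_pos).mp ?_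
    rw [← hu]
    have := (IsCoprime.pow (m := 2) (n := 2) hXY)
    rw [show X ^ 2 - Y ^ 2 = X ^ 2 + Y ^ 2 * (-1) by ring]
    exact (IsCoprime.add_mul_left_left_iff).mpr this
  rcases Int.even_or_odd X with hX | hX <;> rcases Int.even_or_odd Y with hYp | hYp
  · exact absurd (hXY.isUnit_of_dvd' hX.two_dvd hYp.two_dvd) (by norm_num [Int.isUnit_iff])
  · exact odd_case ((hX.pow_of_ne_zero two_ne_zero).sub_odd hYp.pow)
  · exact odd_case (hX.pow.sub_even (hYp.pow_of_ne_zero two_ne_zero))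
  obtain ⟨x, hx⟩ := Int.exists_sq_eq_eight_mul_add_one hX
  obtain ⟨y, hy⟩ := Int.exists_sq_eq_eight_mul_add_one hYp
  obtain ⟨A, hA⟩ : ∃ A, A = x - y := ⟨_, rfl⟩
  have h8 : X ^ 2 = 8 * A + Y ^ 2 := by linarith
  have hm : 8 ^ 2 * (A * (A + Y ^ 2)) = W ^ 2 := by rw [← h, h8]; ring
  obtain ⟨V, rfl⟩ : (8 : ℤ) ∣ W := (Int.pow_dvd_pow_iff two_ne_zero).mp ⟨_, hm.symm⟩
  have hm' : A * (A + Y ^ 2) = V ^ 2 := by linarith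
  have hcop : IsCoprime A (A + Y ^ 2) := by
    refine isCoprime_of_prime_dvd (fun h0 => by linarith [h0.1]) fun p hp d1 d2 => ?_
    have dY : p ∣ Y := hp.dvd_of_dvd_pow ((dvd_add_right d1).mp d2)
    have dX : p ∣ X := by
      apply hp.dvd_of_dvd_pow (n := 2)
      rw [h8]; exact (d1.mul_left 8).add (dvd_pow dY two_ne_zero)
    exact hp.not_isUnit (hXY.isUnit_of_dvd' dX dY)
  obtain ⟨u, v, hu, hv⟩ := Int.exists_pow_and_pow_of_mul_eq_pow hcop (by linarith) (by linarith)
    even_two hm'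
  have hu0 := eq_zero_of_concordant _ Y u v X rfl (by
    refine (IsCoprime.pow_iff (m := 2) (n := 2) two_pos two_pos).mp ?_
    rw [← hu]
    exact ((IsCoprime.mul_add_left_right_iff (z := 1)).mp (by simpa using hcop)).symm)
    (by linarith) (by linarith)
  subst hu0
  linarith

lemma rational_points_of_dynamical_curve (t w : ℚ) :
    w ^ 2 = (t ^ 3 - 3 * t - 1) * (t ^ 3 + 2 * t ^ 2 - t - 1) *
          (t ^ 6 + 2 * t ^ 5 + 4 * t ^ 4 + 8 * t ^ 3 + 9 * t ^ 2 + 4 * t + 1) ↔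
        ((t, w) = (0, 1) ∨ (t, w) = (0, -1) ∨ (t, w) = (-1, 1) ∨ (t, w) = (-1, -1)) := by
  constructor
  swap
  · simp only [Prod.mk.injEq]
    rintro (⟨rfl, rfl⟩ | ⟨rfl, rfl⟩ | ⟨rfl, rfl⟩ | ⟨rfl, rfl⟩) <;> norm_num
  intro h
  have hq0 : (t.den : ℚ) ≠ 0 := by exact_mod_cast t.den_nz
  have ht : t = t.num / (t.den : ℤ) := by simpa using (Rat.num_div_den t).symm
  have hcop : IsCoprime t.num (t.den : ℤ) := by
    rw [Int.isCoprime_iff_nat_coprime]; simpa using t.reduced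
  have hqz : (t.den : ℤ) ≠ 0 := by exact_mod_cast t.den_nz
  generalize t.num = p at *
  generalize hqd : (t.den : ℤ) = q at *
  have hq : (q : ℚ) ≠ 0 := by exact_mod_cast hqz
  have hsq : IsSquare ((((p ^ 3 + p ^ 2 * q - 2 * p * q ^ 2 - q ^ 3) ^ 2 - (p * q * (p + q)) ^ 2) *
      ((p ^ 3 + p ^ 2 * q - 2 * p * q ^ 2 - q ^ 3) ^ 2 + 7 * (p * q * (p + q)) ^ 2) : ℤ) : ℚ) := by
    refine ⟨w * q ^ 6, ?_⟩
    rw [show w * (q : ℚ) ^ 6 * (w * q ^ 6) = w ^ 2 * q ^ 12 by ring, h, ht]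
    push_cast
    field_simp
    ring
  rw [Rat.isSquare_intCast_iff] at hsq
  obtain ⟨W, hW⟩ := hsq
  have hXY : IsCoprime (p ^ 3 + p ^ 2 * q - 2 * p * q ^ 2 - q ^ 3) (p * q * (p + q)) := by
    have h1 : IsCoprime q (p ^ 3) := hcop.symm.pow_right
    have h2 : IsCoprime p (q ^ 3) := hcop.pow_right
    have h3 : IsCoprime (p + q) (q ^ 3) := by
      have := IsCoprime.add_mul_right_left hcop 1
      rw [one_mul] at this
      exact this.pow_right
    refine (IsCoprime.mul_right (IsCoprime.mul_right ?_ ?_) ?_)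
    · have := (h2.neg_right.add_mul_left_right (p ^ 2 + p * q - 2 * q ^ 2)).symm
      refine cast (congrArg₂ IsCoprime ?_ rfl) this; ring
    · have := (h1.add_mul_left_right (p ^ 2 - 2 * p * q - q ^ 2)).symm
      refine cast (congrArg₂ IsCoprime ?_ rfl) this; ring
    · have := (h3.add_mul_left_right (p ^ 2 - 2 * q ^ 2)).symm
      refine cast (congrArg₂ IsCoprime ?_ rfl) this; ring
  have hodd : ∀ x y : ZMod 2, ¬ (x = 0 ∧ y = 0) → x ^ 3 - 3 * x * y ^ 2 - y ^ 3 ≠ 0 ∧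
      x ^ 3 + 2 * x ^ 2 * y - x * y ^ 2 - y ^ 3 ≠ 0 := by decide
  have hpq : ¬ ((p : ZMod 2) = 0 ∧ (q : ZMod 2) = 0) := by
    rintro ⟨h1, h2⟩
    rw [ZMod.intCast_zmod_eq_zero_iff_dvd] at h1 h2
    exact absurd (hcop.isUnit_of_dvd' h1 h2) (by norm_num [Int.isUnit_iff])
  obtain ⟨o1, o2⟩ := hodd p q hpq
  have htv : t = 0 ∨ t = -1 := by
    rcases eq_zero_or_sq_eq_of_isSquare hXY (by rw [hW]; ring) with h0 | h0
    · rcases mul_eq_zero.mp h0 with h1 | h1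
      · rcases mul_eq_zero.mp h1 with h2 | h2
        · left; rw [ht, h2]; simp
        · exact absurd h2 hqz
      · right
        rw [ht, eq_neg_of_add_eq_zero_left h1]; push_cast; field_simp
    · exfalso
      have : (p ^ 3 - 3 * p * q ^ 2 - q ^ 3) * (p ^ 3 + 2 * p ^ 2 * q - p * q ^ 2 - q ^ 3) = 0 := by
        linear_combination h0
      rcases mul_eq_zero.mp this with h1 | h1
      · exact o1 (by exact_mod_cast congrArg (Int.cast : ℤ → ZMod 2) h1)
      · exact o2 (by exact_mod_cast congrArg (Int.cast : ℤ → ZMod 2) h1)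
  have hw : w = 1 ∨ w = -1 := by
    rw [← sq_eq_one_iff]
    rcases htv with h0 | h0 <;> rw [h, h0] <;> norm_num
  rcases htv with h0 | h0 <;> rcases hw with h1 | h1 <;> simp [h0, h1]

/-- The ring of rational numbers with odd denominator. -/
noncomputable def OddDen : Subring ℚ := (PadicInt.subring 2).comap (Rat.castHom ℚ_[2])

namespace OddDen

lemma mem_iff {r : ℚ} : r ∈ OddDen ↔ ‖(r : ℚ_[2])‖ ≤ 1 := Iff.rfl

/-- The inclusion of `OddDen` into the `2`-adic integers. -/
noncomputable def toPadic : OddDen →+* ℤ_[2] where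
  toFun r := ⟨(r : ℚ), r.2⟩
  map_one' := Subtype.ext (by simp)
  map_mul' _ _ := Subtype.ext (by push_cast; rfl)
  map_zero' := Subtype.ext (by simp)
  map_add' _ _ := Subtype.ext (by push_cast; rfl)

/-- Reduction modulo `2`. -/
noncomputable def red : OddDen →+* ZMod 2 := PadicInt.toZMod.comp toPadic

lemma norm_two : ‖(2 : ℚ_[2])‖ = 2⁻¹ := by
  simpa using Padic.norm_p (p := 2)

@[simp, norm_cast]
lemma coe_ofNat (n : ℕ) [n.AtLeastTwo] : ((ofNat(n) : OddDen) : ℚ) = ofNat(n) :=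
  map_ofNat OddDen.subtype n

lemma exists_two_mul_of_norm_lt_one {r : ℚ} (h : ‖(r : ℚ_[2])‖ < 1) : ∃ s : OddDen, r = 2 * s := by
  have h1 : ‖(r : ℚ_[2])‖ ≤ 2⁻¹ := by
    have := (PadicInt.norm_le_pow_iff_norm_lt_pow_add_one (p := 2) ⟨(r : ℚ_[2]), h.le⟩ (-1)).mpr
      (by simpa using h)
    simpa using this
  refine ⟨⟨r / 2, ?_⟩, by push_cast; ring⟩
  rw [mem_iff]
  push_cast
  rw [norm_div, norm_two]
  calc _ ≤ (2⁻¹ : ℝ) / 2⁻¹ := by gcongr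
    _ = 1 := by norm_num

lemma red_eq_zero_iff {r : OddDen} : red r = 0 ↔ ‖((r : ℚ) : ℚ_[2])‖ < 1 := by
  have h : red r = 0 ↔ toPadic r ∈ RingHom.ker (PadicInt.toZMod (p := 2)) := Iff.rfl
  rw [h, PadicInt.ker_toZMod, IsLocalRing.mem_maximalIdeal, PadicInt.mem_nonunits]
  rfl

lemma exists_eq_two_mul {r : OddDen} (h : red r = 0) : ∃ s : OddDen, r = 2 * s := by
  obtain ⟨s, hs⟩ := exists_two_mul_of_norm_lt_one (red_eq_zero_iff.mp h)
  exact ⟨s, Subtype.ext (by push_cast; exact hs)⟩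

lemma exists_inv {r : OddDen} (h : red r ≠ 0) : ∃ s : OddDen, r * s = 1 := by
  have h1 : ‖((r : ℚ) : ℚ_[2])‖ = 1 :=
    le_antisymm r.2 (not_lt.mp fun h2 => h (red_eq_zero_iff.mpr h2))
  have h0 : (r : ℚ) ≠ 0 := fun h2 => by simp [h2] at h1
  refine ⟨⟨(r : ℚ)⁻¹, ?_⟩, ?_⟩
  · rw [mem_iff]; push_cast; rw [norm_inv, h1]; norm_num
  · ext; push_cast; field_simp

lemma exists_inv_eq_two_mul {c : ℚ} (h : c ∉ OddDen) : ∃ d : OddDen, c⁻¹ = 2 * d := by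
  rw [mem_iff, not_le] at h
  apply exists_two_mul_of_norm_lt_one
  push_cast
  rw [norm_inv]
  exact inv_lt_one_of_one_lt₀ h

lemma mem_of_sq_mem {c : ℚ} (h : c ^ 2 ∈ OddDen) : c ∈ OddDen := by
  rw [mem_iff] at h ⊢
  push_cast at h
  rw [norm_pow] at h
  exact (sq_le_one_iff₀ (norm_nonneg _)).mp h

lemma eq_zero_of_forall_dvd {r : OddDen} (h : ∀ m : ℕ, ∃ s : OddDen, r = 2 ^ m * s) : r = 0 := by
  by_contra hr
  have hr' : ((r : ℚ) : ℚ_[2]) ≠ 0 := by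
    simpa using hr
  obtain ⟨m, hm⟩ := exists_pow_lt_of_lt_one (norm_pos_iff.mpr hr') (by norm_num : (2⁻¹ : ℝ) < 1)
  obtain ⟨s, hs⟩ := h m
  have : ‖((r : ℚ) : ℚ_[2])‖ ≤ 2⁻¹ ^ m := by
    rw [hs]; push_cast
    rw [norm_mul, norm_pow, norm_two]
    exact mul_le_of_le_one_right (by positivity) s.2
  linarith

lemma exists_primitive {n : ℕ} {v : Fin n → ℚ} (hv : v ≠ 0) :
    ∃ (c : ℚ) (w : Fin n → OddDen), c ≠ 0 ∧ (∀ i, v i = c * w i) ∧ ∃ i, red (w i) ≠ 0 := by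
  obtain ⟨j, hj⟩ := Function.ne_iff.mp hv
  obtain ⟨i, -, hi⟩ := Finset.exists_max_image Finset.univ (fun i => ‖((v i : ℚ) : ℚ_[2])‖)
      ⟨j, Finset.mem_univ j⟩
  have hi0 : v i ≠ 0 := by
    intro h0
    have := hi j (Finset.mem_univ j)
    rw [h0, Rat.cast_zero, norm_zero, norm_le_zero_iff, Rat.cast_eq_zero] at this
    exact hj this
  have hi0' : 0 < ‖((v i : ℚ) : ℚ_[2])‖ := norm_pos_iff.mpr (Rat.cast_ne_zero.mpr hi0)
  refine ⟨v i, fun k => ⟨v k / v i, ?_⟩, hi0, fun k => ?_, i, ?_⟩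
  · rw [mem_iff]; push_cast; rw [norm_div]
    exact (div_le_one hi0').mpr (hi k (Finset.mem_univ k))
  · push_cast; field_simp
  · have : (⟨v i / v i, by rw [div_self hi0]; exact one_mem _⟩ : OddDen) = 1 := by
      ext; simp [div_self hi0]
    change red (⟨v i / v i, _⟩ : OddDen) ≠ 0
    rw [this, map_one]; exact one_ne_zero

end OddDen

section Forms

variable {A B : Type*} [CommRing A] [CommRing B]

/-- Coefficients of the product of a polynomial of degree at most `2` and one of degree at
most `4`. -/
def quadMul (q : Fin 3 → A) (h : Fin 5 → A) : Fin 7 → A :=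
  ![q 0 * h 0, q 0 * h 1 + q 1 * h 0, q 0 * h 2 + q 1 * h 1 + q 2 * h 0,
    q 0 * h 3 + q 1 * h 2 + q 2 * h 1, q 0 * h 4 + q 1 * h 3 + q 2 * h 2,
    q 1 * h 4 + q 2 * h 3, q 2 * h 4]

/-- Coefficients of the square of a polynomial of degree at most `2`. -/
def quadSq (g : Fin 3 → A) : Fin 5 → A :=
  ![g 0 ^ 2, 2 * g 0 * g 1, 2 * g 0 * g 2 + g 1 ^ 2, 2 * g 1 * g 2, g 2 ^ 2]

/-- Coefficients of the product of polynomials of degree at most `2` and at most `1`. -/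
def quadLin (q : Fin 3 → A) (s : Fin 2 → A) : Fin 4 → A :=
  ![q 0 * s 0, q 0 * s 1 + q 1 * s 0, q 1 * s 1 + q 2 * s 0, q 2 * s 1]

/-- `M ^ 2 - F = q * h` where `F = X⁶ + 2X⁵ + X⁴ + 2X³ + 6X² + 4X + 1`, on coefficients. -/
def IsState (q : Fin 3 → A) (M : Fin 4 → A) (h : Fin 5 → A) : Prop :=
  ![M 0 ^ 2 - 1, 2 * M 0 * M 1 - 4, 2 * M 0 * M 2 + M 1 ^ 2 - 6,
    2 * M 0 * M 3 + 2 * M 1 * M 2 - 2, 2 * M 1 * M 3 + M 2 ^ 2 - 1, 2 * M 2 * M 3 - 2,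
    M 3 ^ 2 - 1] = quadMul q h

/-- Coefficients of `N ^ 2 + (X³ + X² + 1) * N - (X² + X)`. -/
def halfForm (N : Fin 4 → A) : Fin 7 → A :=
  ![N 0 ^ 2 + N 0, 2 * N 0 * N 1 + N 1 - 1, 2 * N 0 * N 2 + N 1 ^ 2 + N 2 + N 0 - 1,
    2 * N 0 * N 3 + 2 * N 1 * N 2 + N 3 + N 1 + N 0, 2 * N 1 * N 3 + N 2 ^ 2 + N 2 + N 1,
    2 * N 2 * N 3 + N 3 + N 2, N 3 ^ 2 + N 3]

lemma vec_eq_iff {α : Type*} {a0 a1 a2 a3 a4 a5 a6 b0 b1 b2 b3 b4 b5 b6 : α} :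
    (![a0, a1, a2, a3, a4, a5, a6] = ![b0, b1, b2, b3, b4, b5, b6]) ↔
    a0 = b0 ∧ a1 = b1 ∧ a2 = b2 ∧ a3 = b3 ∧ a4 = b4 ∧ a5 = b5 ∧ a6 = b6 := by
  simp [funext_iff, Fin.forall_fin_succ]

lemma quadMul_map (f : A →+* B) (q : Fin 3 → A) (h : Fin 5 → A) :
    quadMul (f ∘ q) (f ∘ h) = f ∘ quadMul q h := by
  funext i; fin_cases i <;> simp [quadMul]

lemma quadSq_map (f : A →+* B) (g : Fin 3 → A) : quadSq (f ∘ g) = f ∘ quadSq g := by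
  funext i; fin_cases i <;> simp [quadSq, map_ofNat]

lemma halfForm_map (f : A →+* B) (N : Fin 4 → A) : halfForm (f ∘ N) = f ∘ halfForm N := by
  funext i; fin_cases i <;> simp [halfForm, map_ofNat]

lemma isState_iff {q : Fin 3 → A} {M : Fin 4 → A} {h : Fin 5 → A} : IsState q M h ↔
    M 0 ^ 2 - 1 = q 0 * h 0 ∧ 2 * M 0 * M 1 - 4 = q 0 * h 1 + q 1 * h 0 ∧
    2 * M 0 * M 2 + M 1 ^ 2 - 6 = q 0 * h 2 + q 1 * h 1 + q 2 * h 0 ∧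
    2 * M 0 * M 3 + 2 * M 1 * M 2 - 2 = q 0 * h 3 + q 1 * h 2 + q 2 * h 1 ∧
    2 * M 1 * M 3 + M 2 ^ 2 - 1 = q 0 * h 4 + q 1 * h 3 + q 2 * h 2 ∧
    2 * M 2 * M 3 - 2 = q 1 * h 4 + q 2 * h 3 ∧ M 3 ^ 2 - 1 = q 2 * h 4 := vec_eq_iff

lemma halfForm_eq_iff {q : Fin 3 → A} {N : Fin 4 → A} {h : Fin 5 → A} :
    halfForm N = quadMul q h ↔
    N 0 ^ 2 + N 0 = q 0 * h 0 ∧ 2 * N 0 * N 1 + N 1 - 1 = q 0 * h 1 + q 1 * h 0 ∧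
    2 * N 0 * N 2 + N 1 ^ 2 + N 2 + N 0 - 1 = q 0 * h 2 + q 1 * h 1 + q 2 * h 0 ∧
    2 * N 0 * N 3 + 2 * N 1 * N 2 + N 3 + N 1 + N 0 = q 0 * h 3 + q 1 * h 2 + q 2 * h 1 ∧
    2 * N 1 * N 3 + N 2 ^ 2 + N 2 + N 1 = q 0 * h 4 + q 1 * h 3 + q 2 * h 2 ∧
    2 * N 2 * N 3 + N 3 + N 2 = q 1 * h 4 + q 2 * h 3 ∧ N 3 ^ 2 + N 3 = q 2 * h 4 := vec_eq_iff

/-- The cubic `H + 2 N` with `H = X³ + X² + 1`. -/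
def liftHalf (N : Fin 4 → A) : Fin 4 → A := ![1 + 2 * N 0, 2 * N 1, 1 + 2 * N 2, 1 + 2 * N 3]

end Forms

section ModTwo

lemma zmod_quadMul_eq_zero : ∀ (q : Fin 3 → ZMod 2) (h : Fin 5 → ZMod 2),
    quadMul q h = 0 → q = 0 ∨ h = 0 := by
  decide +kernel

lemma zmod_rigid : ∀ (d : Fin 4 → ZMod 2) (x g : Fin 3 → ZMod 2),
    ![d 0, d 1, d 2 + d 0, d 3 + d 1 + d 0, d 2 + d 1, d 3 + d 2, d 3] =
      quadMul x (quadSq g) → g = 0 ∨ (d = 0 ∧ x = 0) := by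
  decide +kernel

lemma zmod_quadSq_eq_zero : ∀ (g : Fin 3 → ZMod 2), quadSq g = 0 → g = 0 := by
  decide +kernel

lemma zmod_halfForm_ne_zero : ∀ (N : Fin 4 → ZMod 2), halfForm N ≠ 0 := by
  decide +kernel

/-- The known solutions `(N, x, g)` of `N ^ 2 + (X³ + X² + 1) N - (X² + X) = x g ^ 2`. -/
def knownTriples : List ((Fin 4 → ℤ) × (Fin 3 → ℤ) × (Fin 3 → ℤ)) :=
  [(![-1, -2, -2, -1], ![0, 1, 0], ![1, 2, 1]),
    (![-1, -1, -2, -1], ![1, 1, 0], ![0, 1, 1]),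
    (![-1, -1, -1, -1], ![0, 1, 1], ![0, 1, 0]),
    (![-1, -1, -1, 0], ![-1, -1, 0], ![0, 0, 1]),
    (![-1, -1, 0, 0], ![-1, 0, 0], ![0, 1, 1]),
    (![-1, -1, 0, 0], ![0, 0, -1], ![1, 1, 0]),
    (![-1, -1, 0, 0], ![-1, -2, -1], ![0, 1, 0]),
    (![-1, 0, -1, -1], ![0, -1, -1], ![1, 0, 0]),
    (![-1, 0, 0, 0], ![0, -1, 0], ![1, 1, 0]),
    (![0, 0, -1, -1], ![0, -1, 0], ![1, 1, 0]),
    (![0, 0, 0, 0], ![0, -1, -1], ![1, 0, 0]),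
    (![0, 1, -1, -1], ![-1, 0, 0], ![0, 1, 1]),
    (![0, 1, -1, -1], ![0, 0, -1], ![1, 1, 0]),
    (![0, 1, -1, -1], ![-1, -2, -1], ![0, 1, 0]),
    (![0, 1, 0, -1], ![-1, -1, 0], ![0, 0, 1]),
    (![0, 1, 0, 0], ![0, 1, 1], ![0, 1, 0]),
    (![0, 1, 1, 0], ![1, 1, 0], ![0, 1, 1]),
    (![0, 2, 1, 0], ![0, 1, 0], ![1, 2, 1])]

/-- The quadratic polynomials, up to sign, occurring in `knownTriples`. -/
def knownQuads : List (Fin 3 → ℤ) :=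
  [![1, 0, 0], ![0, 1, 0], ![1, 1, 0], ![0, 0, 1], ![0, 1, 1], ![1, 2, 1]]

lemma knownTriples_spec : ∀ c ∈ knownTriples, halfForm c.1 = quadMul c.2.1 (quadSq c.2.2) := by
  decide +kernel

lemma knownTriples_quad : ∀ c ∈ knownTriples, c.2.1 ∈ knownQuads ∨ -c.2.1 ∈ knownQuads := by
  decide +kernel

lemma knownTriples_next : ∀ c ∈ knownTriples, ∀ c' ∈ knownTriples,
    (∀ i, (c'.2.1 i : ZMod 2) = c.2.2 i) → c'.2.1 = c.2.2 ∨ c'.2.1 = -c.2.2 := by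
  decide +kernel

lemma zmod_exists_knownTriple : ∀ (N : Fin 4 → ZMod 2) (x g : Fin 3 → ZMod 2),
    halfForm N = quadMul x (quadSq g) → ∃ c ∈ knownTriples,
      (∀ i, N i = c.1 i) ∧ (∀ i, x i = c.2.1 i) ∧ ∀ i, g i = c.2.2 i := by
  decide +kernel

end ModTwo

section TwoAdic

open OddDen

lemma OddDen.exists_coe_of_quadMul {q : Fin 3 → OddDen} (hq : ∃ i, red (q i) ≠ 0)
    {h : Fin 5 → ℚ} {v : Fin 7 → OddDen}
    (hv : quadMul (OddDen.subtype ∘ q) h = OddDen.subtype ∘ v) :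
    ∃ h' : Fin 5 → OddDen, h = OddDen.subtype ∘ h' := by
  by_cases h0 : h = 0
  · exact ⟨0, by rw [h0]; ext; simp⟩
  obtain ⟨c, w, hc0, hw, hprim⟩ := OddDen.exists_primitive h0
  by_cases hc : c ∈ OddDen
  · exact ⟨fun i => ⟨c, hc⟩ * w i, by funext i; rw [hw]; rfl⟩
  obtain ⟨d, hd⟩ := OddDen.exists_inv_eq_two_mul hc
  exfalso
  have key : quadMul q w = fun i => 2 * d * v i := by
    have e : quadMul (OddDen.subtype ∘ q) (OddDen.subtype ∘ w) =
        OddDen.subtype ∘ (fun i => 2 * d * v i) := by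
      funext i
      have hi := congrFun hv i
      have hw' : ∀ i, h i = c * OddDen.subtype (w i) := hw
      simp only [Function.comp_apply, map_mul, map_ofNat] at hi ⊢
      change _ = 2 * (d : ℚ) * _
      rw [← hd, ← hi]
      fin_cases i <;> simp [quadMul, hw'] <;> field_simp
    rw [quadMul_map] at e
    funext i
    exact Subtype.ext (congrFun e i)
  have k2 : quadMul (red ∘ q) (red ∘ w) = 0 := by
    rw [quadMul_map, key]
    funext i
    have : red 2 = 0 := by rw [map_ofNat]; rfl
    simp [this]
  rcases zmod_quadMul_eq_zero _ _ k2 with h1 | h1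
  · obtain ⟨i, hi⟩ := hq
    exact hi (congrFun h1 i)
  · obtain ⟨i, hi⟩ := hprim
    exact hi (congrFun h1 i)

set_option maxHeartbeats 1000000 in
/-- A solution congruent to another one to some `2`-adic precision, with the square factor known
to at least the same precision, is congruent to one digit more. -/
lemma halfForm_rigid {A : Type*} [CommRing A] [IsDomain A] (red : A →+* ZMod 2) (h20 : (2 : A) ≠ 0)
    {N Nc d : Fin 4 → A} {x xc y g gc e : Fin 3 → A} {u v : A}
    (hu : u ≠ 0) (h : halfForm N = quadMul x (quadSq g)) (hc : halfForm Nc = quadMul xc (quadSq gc))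
    (hN : ∀ i, N i = Nc i + 2 * u * d i) (hx : ∀ i, x i = xc i + 2 * u * y i)
    (hg : ∀ i, g i = gc i + 2 * u * v * e i) (hprim : ∃ i, red (g i) ≠ 0) :
    (∀ i, red (d i) = 0) ∧ ∀ i, red (y i) = 0 := by
  rw [halfForm_eq_iff] at h hc
  simp only [quadSq, Matrix.cons_val] at h hc
  obtain ⟨h0, h1, h2, h3, h4, h5, h6⟩ := h
  obtain ⟨c0, c1, c2, c3, c4, c5, c6⟩ := hc
  have hu2 : 2 * u ≠ 0 := mul_ne_zero h20 hu
  have r2 : red 2 = 0 := by rw [map_ofNat]; rfl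
  have step : ∀ {a b E : A}, 2 * u * (a - b) = 2 * u * (2 * E) → red a = red b := by
    intro a b E hE
    have := congrArg red (mul_left_cancel₀ hu2 hE)
    rw [map_sub, map_mul, r2, zero_mul] at this
    exact sub_eq_zero.mp this
  have e0 := step (a := d 0)
    (b := y 0 * g 0 ^ 2)
    (E := v * (xc 0 * gc 0 * e 0) + u * v ^ 2 * (xc 0 * e 0 * e 0) - (d 0 * Nc 0) - u * (d 0 * d 0))
    (by simp only [hN, hx, hg] at h0 ⊢; linear_combination h0 - c0)
  have e1 := step (a := d 1)
    (b := y 0 * (2 * g 0 * g 1) + y 1 * g 0 ^ 2)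
    (E := v * (xc 0 * gc 0 * e 1 + xc 0 * gc 1 * e 0 + xc 1 * gc 0 * e 0) +
      u * v ^ 2 * (xc 0 * e 0 * e
      1 + xc 0 * e 1 * e 0 + xc 1 * e 0 * e 0) - (d 0 * Nc 1 + d 1 * Nc 0) - u * (d 0 * d 1 + d 1 *
      d 0))
    (by simp only [hN, hx, hg] at h1 ⊢; linear_combination h1 - c1)
  have e2 := step (a := d 2 + d 0)
    (b := y 0 * (2 * g 0 * g 2 + g 1 ^ 2) + y 1 * (2 * g 0 * g 1) + y 2 * g 0 ^ 2)
    (E := v * (xc 0 * gc 0 * e 2 + xc 0 * gc 1 * e 1 + xc 1 * gc 0 * e 1 + xc 0 * gc 2 * e 0 +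
      xc 1 * gc
      1 * e 0 + xc 2 * gc 0 * e 0) + u * v ^ 2 * (xc 0 * e 0 * e 2 + xc 0 * e 1 * e 1 + xc 1 * e 0 *
      e 1 + xc 0 * e 2 * e 0 + xc 1 * e 1 * e 0 + xc 2 * e 0 * e 0) - (d 0 * Nc 2 + d 1 * Nc 1 + d 2
      * Nc 0) - u * (d 0 * d 2 + d 1 * d 1 + d 2 * d 0))
    (by simp only [hN, hx, hg] at h2 ⊢; linear_combination h2 - c2)
  have e3 := step (a := d 3 + d 1 + d 0)
    (b := y 0 * (2 * g 1 * g 2) + y 1 * (2 * g 0 * g 2 + g 1 ^ 2) + y 2 * (2 * g 0 * g 1))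
    (E := v * (xc 0 * gc 1 * e 2 + xc 1 * gc 0 * e 2 + xc 0 * gc 2 * e 1 + xc 1 * gc 1 * e 1 +
      xc 2 * gc
      0 * e 1 + xc 1 * gc 2 * e 0 + xc 2 * gc 1 * e 0) + u * v ^ 2 * (xc 0 * e 1 * e 2 + xc 1 * e 0
      * e 2 + xc 0 * e 2 * e 1 + xc 1 * e 1 * e 1 + xc 2 * e 0 * e 1 + xc 1 * e 2 * e 0 + xc 2 * e 1
      * e 0) - (d 0 * Nc 3 + d 1 * Nc 2 + d 2 * Nc 1 + d 3 * Nc 0) - u * (d 0 * d 3 + d 1 * d 2 + d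
      2 * d 1 + d 3 * d 0))
    (by simp only [hN, hx, hg] at h3 ⊢; linear_combination h3 - c3)
  have e4 := step (a := d 2 + d 1)
    (b := y 0 * g 2 ^ 2 + y 1 * (2 * g 1 * g 2) + y 2 * (2 * g 0 * g 2 + g 1 ^ 2))
    (E := v * (xc 0 * gc 2 * e 2 + xc 1 * gc 1 * e 2 + xc 2 * gc 0 * e 2 + xc 1 * gc 2 * e 1 +
      xc 2 * gc
      1 * e 1 + xc 2 * gc 2 * e 0) + u * v ^ 2 * (xc 0 * e 2 * e 2 + xc 1 * e 1 * e 2 + xc 2 * e 0 *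
      e 2 + xc 1 * e 2 * e 1 + xc 2 * e 1 * e 1 + xc 2 * e 2 * e 0) - (d 1 * Nc 3 + d 2 * Nc 2 + d 3
      * Nc 1) - u * (d 1 * d 3 + d 2 * d 2 + d 3 * d 1))
    (by simp only [hN, hx, hg] at h4 ⊢; linear_combination h4 - c4)
  have e5 := step (a := d 3 + d 2)
    (b := y 1 * g 2 ^ 2 + y 2 * (2 * g 1 * g 2))
    (E := v * (xc 1 * gc 2 * e 2 + xc 2 * gc 1 * e 2 + xc 2 * gc 2 * e 1) +
      u * v ^ 2 * (xc 1 * e 2 * e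
      2 + xc 2 * e 1 * e 2 + xc 2 * e 2 * e 1) - (d 2 * Nc 3 + d 3 * Nc 2) - u * (d 2 * d 3 + d 3 *
      d 2))
    (by simp only [hN, hx, hg] at h5 ⊢; linear_combination h5 - c5)
  have e6 := step (a := d 3)
    (b := y 2 * g 2 ^ 2)
    (E := v * (xc 2 * gc 2 * e 2) + u * v ^ 2 * (xc 2 * e 2 * e 2) - (d 3 * Nc 3) - u * (d 3 * d 3))
    (by simp only [hN, hx, hg] at h6 ⊢; linear_combination h6 - c6)
  have key := zmod_rigid (red ∘ d) (red ∘ y) (red ∘ g) (by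
    rw [quadSq_map, quadMul_map]
    simp only [map_add, Function.comp_apply] at e0 e1 e2 e3 e4 e5 e6 ⊢
    funext i
    fin_cases i <;> simp only [quadMul, quadSq, Matrix.cons_val] <;> simp_all)
  rcases key with h | ⟨h, h'⟩
  · obtain ⟨i, hi⟩ := hprim
    exact (hi (congrFun h i)).elim
  · exact ⟨congrFun h, congrFun h'⟩

section Generic

variable {A : Type*} [CommRing A]

lemma liftHalf_isState_iff {q : Fin 3 → A} {N : Fin 4 → A} {h : Fin 5 → A} :
    IsState q (liftHalf N) h ↔ (fun i => 4 * halfForm N i) = quadMul q h := by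
  rw [IsState]
  refine Eq.congr ?_ rfl
  funext i
  fin_cases i <;> simp [liftHalf, halfForm] <;> ring

/-- The cofactor `h + s * (2 N + H) + q * s ^ 2` of `N + q s`. -/
def shiftCofactor (q : Fin 3 → A) (N : Fin 4 → A) (h : Fin 5 → A) (s : Fin 2 → A) : Fin 5 → A :=
  ![h 0 + s 0 * (1 + 2 * N 0) + q 0 * s 0 ^ 2,
    h 1 + (s 0 * (2 * N 1) + s 1 * (1 + 2 * N 0)) + (q 0 * (2 * s 0 * s 1) + q 1 * s 0 ^ 2),
    h 2 + (s 0 * (1 + 2 * N 2) + s 1 * (2 * N 1)) +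
      (q 0 * s 1 ^ 2 + q 1 * (2 * s 0 * s 1) + q 2 * s 0 ^ 2),
    h 3 + (s 0 * (1 + 2 * N 3) + s 1 * (1 + 2 * N 2)) +
      (q 1 * s 1 ^ 2 + q 2 * (2 * s 0 * s 1)),
    h 4 + s 1 * (1 + 2 * N 3) + q 2 * s 1 ^ 2]

lemma halfForm_shift {q : Fin 3 → A} {N : Fin 4 → A} {h : Fin 5 → A} (s : Fin 2 → A)
    (hN : halfForm N = quadMul q h) :
    halfForm (fun i => N i + quadLin q s i) = quadMul q (shiftCofactor q N h s) := by
  rw [halfForm_eq_iff] at hN ⊢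
  obtain ⟨h0, h1, h2, h3, h4, h5, h6⟩ := hN
  simp only [quadLin, shiftCofactor, Matrix.cons_val]
  refine ⟨?_, ?_, ?_, ?_, ?_, ?_, ?_⟩
  · linear_combination h0
  · linear_combination h1
  · linear_combination h2
  · linear_combination h3
  · linear_combination h4
  · linear_combination h5
  · linear_combination h6

lemma quadMul_left_cancel [IsDomain A] {q : Fin 3 → A} (hq : q ≠ 0) {a b : Fin 5 → A}
    (h : quadMul q a = quadMul q b) : a = b := by
  obtain ⟨h0, h1, h2, h3, h4, h5, h6⟩ := vec_eq_iff.mp h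
  have hz : ∀ {x y : A}, x ≠ 0 → x * y = 0 → y = 0 := fun hx hxy =>
    (mul_eq_zero.mp hxy).resolve_left hx
  suffices ∀ i, a i - b i = 0 from funext fun i => sub_eq_zero.mp (this i)
  by_cases q0 : q 0 = 0
  · by_cases q1 : q 1 = 0
    · have q2 : q 2 ≠ 0 := by
        intro q2; apply hq; funext i; fin_cases i <;> assumption
      have z0 := hz q2 (y := a 0 - b 0) (by
        linear_combination h2 - (a 2 - b 2) * q0 - (a 1 - b 1) * q1)
      have z1 := hz q2 (y := a 1 - b 1) (by
        linear_combination h3 - (a 3 - b 3) * q0 - (a 2 - b 2) * q1)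
      have z2 := hz q2 (y := a 2 - b 2) (by
        linear_combination h4 - (a 4 - b 4) * q0 - (a 3 - b 3) * q1)
      have z3 := hz q2 (y := a 3 - b 3) (by linear_combination h5 - (a 4 - b 4) * q1)
      have z4 := hz q2 (y := a 4 - b 4) (by linear_combination h6)
      intro i; fin_cases i <;> assumption
    · have z0 := hz q1 (y := a 0 - b 0) (by linear_combination h1 - (a 1 - b 1) * q0)
      have z1 := hz q1 (y := a 1 - b 1) (by
        linear_combination h2 - q 2 * z0 - (a 2 - b 2) * q0)
      have z2 := hz q1 (y := a 2 - b 2) (by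
        linear_combination h3 - q 2 * z1 - (a 3 - b 3) * q0)
      have z3 := hz q1 (y := a 3 - b 3) (by
        linear_combination h4 - q 2 * z2 - (a 4 - b 4) * q0)
      have z4 := hz q1 (y := a 4 - b 4) (by linear_combination h5 - q 2 * z3)
      intro i; fin_cases i <;> assumption
  · have z0 := hz q0 (y := a 0 - b 0) (by linear_combination h0)
    have z1 := hz q0 (y := a 1 - b 1) (by linear_combination h1 - q 1 * z0)
    have z2 := hz q0 (y := a 2 - b 2) (by linear_combination h2 - q 1 * z1 - q 2 * z0)
    have z3 := hz q0 (y := a 3 - b 3) (by linear_combination h3 - q 1 * z2 - q 2 * z1)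
    have z4 := hz q0 (y := a 4 - b 4) (by linear_combination h4 - q 1 * z3 - q 2 * z2)
    intro i; fin_cases i <;> assumption

/-- Evaluation at a root of a linear form `r`. -/
lemma shiftCofactor_eval {q : Fin 3 → A} {N : Fin 4 → A} {h : Fin 5 → A} {r : Fin 2 → A}
    {g : Fin 3 → A} {ε μ X Z : A} (hX : X = -r 0) (hZ : Z = r 1)
    (hs : ∀ i, ε ^ 2 * h i + ε * (shiftCofactor 0 N 0 r i) + shiftCofactor q 0 0 r i -
      shiftCofactor 0 0 0 r i = μ * quadSq g i) :
    ε ^ 2 * (h 0 * Z ^ 4 + h 1 * Z ^ 3 * X + h 2 * Z ^ 2 * X ^ 2 + h 3 * Z * X ^ 3 + h 4 * X ^ 4) =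
      μ * (g 0 * Z ^ 2 + g 1 * Z * X + g 2 * X ^ 2) ^ 2 := by
  have h0 := hs 0
  have h1 := hs 1
  have h2 := hs 2
  have h3 := hs 3
  have h4 := hs 4
  simp only [shiftCofactor, quadSq, Matrix.cons_val, Pi.zero_apply] at h0 h1 h2 h3 h4
  subst hX hZ
  linear_combination (r 1) ^ 4 * h0 + (r 1) ^ 3 * (-r 0) * h1 + (r 1) ^ 2 * (r 0) ^ 2 * h2 +
    (r 1) * (-r 0) ^ 3 * h3 + (r 0) ^ 4 * h4

/-- Directional derivative at a root of a linear form `r`. -/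
lemma shiftCofactor_deriv {q : Fin 3 → A} {N : Fin 4 → A} {h : Fin 5 → A} {r : Fin 2 → A}
    {g : Fin 3 → A} {ε μ X Z vX vZ : A} (hX : X = -r 0) (hZ : Z = r 1)
    (hv : r 0 * vZ + r 1 * vX = 1)
    (hs : ∀ i, ε ^ 2 * h i + ε * (shiftCofactor 0 N 0 r i) + shiftCofactor q 0 0 r i -
      shiftCofactor 0 0 0 r i = μ * quadSq g i) :
    ∃ a b : A, ε ^ 2 * a + ε * ((1 + 2 * N 0) * Z ^ 3 + 2 * N 1 * Z ^ 2 * X +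
        (1 + 2 * N 2) * Z * X ^ 2 + (1 + 2 * N 3) * X ^ 3) =
      2 * μ * (g 0 * Z ^ 2 + g 1 * Z * X + g 2 * X ^ 2) * b := by
  have h0 := hs 0
  have h1 := hs 1
  have h2 := hs 2
  have h3 := hs 3
  have h4 := hs 4
  simp only [shiftCofactor, quadSq, Matrix.cons_val, Pi.zero_apply] at h0 h1 h2 h3 h4
  subst hX hZ
  refine ⟨h 0 * (4 * r 1 ^ 3 * vZ) + h 1 * (3 * r 1 ^ 2 * vZ * (-r 0) + r 1 ^ 3 * vX) +
    h 2 * (2 * r 1 * vZ * r 0 ^ 2 + r 1 ^ 2 * (2 * (-r 0) * vX)) +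
    h 3 * (vZ * (-r 0) ^ 3 + r 1 * (3 * r 0 ^ 2 * vX)) + h 4 * (4 * (-r 0) ^ 3 * vX),
    g 0 * (2 * r 1 * vZ) + g 1 * (vZ * (-r 0) + r 1 * vX) + g 2 * (2 * (-r 0) * vX), ?_⟩
  linear_combination (4 * r 1 ^ 3 * vZ) * h0 + (3 * r 1 ^ 2 * vZ * (-r 0) + r 1 ^ 3 * vX) * h1 +
    (2 * r 1 * vZ * r 0 ^ 2 + r 1 ^ 2 * (2 * (-r 0) * vX)) * h2 +
    (vZ * (-r 0) ^ 3 + r 1 * (3 * r 0 ^ 2 * vX)) * h3 + (4 * (-r 0) ^ 3 * vX) * h4 -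
    ε * ((1 + 2 * N 0) * r 1 ^ 3 + 2 * N 1 * r 1 ^ 2 * (-r 0) +
        (1 + 2 * N 2) * r 1 * (-r 0) ^ 2 + (1 + 2 * N 3) * (-r 0) ^ 3) * hv

end Generic

/-- Existence of a twisted square cofactor for every state. -/
def HalfStep : Prop :=
  ∀ (q : Fin 3 → ℚ) (M : Fin 4 → ℚ) (h : Fin 5 → ℚ), q ≠ 0 → IsState q M h →
    ∃ (l : ℚ) (M' : Fin 4 → ℚ) (g : Fin 3 → ℚ) (s : Fin 2 → ℚ), l ≠ 0 ∧
      IsState (fun i => l * q i) M' (quadSq g) ∧ ∀ i, M' i = M i + quadLin q s i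

lemma zmod_quad_mul_linSq : ∀ (q : Fin 3 → ZMod 2) (r : Fin 2 → ZMod 2),
    (∀ i, shiftCofactor q 0 0 r i - shiftCofactor 0 0 0 r i = 0) → q = 0 ∨ r = 0 := by
  decide +kernel

lemma zmod_cubic_ne_zero : ∀ X Z : ZMod 2, Z ^ 3 + Z * X ^ 2 + X ^ 3 = 0 → X = 0 ∧ Z = 0 := by
  decide

lemma shiftCofactor_map {A B : Type*} [CommRing A] [CommRing B] (f : A →+* B) (q : Fin 3 → A)
    (N : Fin 4 → A) (h : Fin 5 → A) (s : Fin 2 → A) (i : Fin 5) :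
    shiftCofactor (f ∘ q) (f ∘ N) (f ∘ h) (f ∘ s) i = f (shiftCofactor q N h s i) := by
  fin_cases i <;> simp [shiftCofactor, map_ofNat]

lemma rat_halfForm_ne_zero (N : Fin 4 → ℚ) : halfForm N ≠ 0 := by
  intro h
  have h0 := congr_fun h 0
  have h1 := congr_fun h 1
  have h2 := congr_fun h 2
  have h5 := congr_fun h 5
  have h6 := congr_fun h 6
  simp only [halfForm, Matrix.cons_val, Pi.zero_apply] at h0 h1 h2 h5 h6
  have a0 : N 0 = 0 ∨ N 0 = -1 := by
    rcases mul_eq_zero.mp (show N 0 * (N 0 + 1) = 0 by linear_combination h0) with h | h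
    · exact Or.inl h
    · exact Or.inr (by linear_combination h)
  have a3 : N 3 = 0 ∨ N 3 = -1 := by
    rcases mul_eq_zero.mp (show N 3 * (N 3 + 1) = 0 by linear_combination h6) with h | h
    · exact Or.inl h
    · exact Or.inr (by linear_combination h)
  have h3 := congr_fun h 3
  simp only [halfForm, Matrix.cons_val, Pi.zero_apply] at h3
  rcases a0 with a0 | a0 <;> rcases a3 with a3 | a3 <;> rw [a0] at h1 h2 h3 <;> rw [a3] at h3 h5
  · have b1 : N 1 = 1 := by linarith
    have b2 : N 2 = 0 := by linarith
    rw [b1, b2] at h3; norm_num at h3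
  · have b1 : N 1 = 1 := by linarith
    have b2 : N 2 = -1 := by linarith
    rw [b1, b2] at h2; norm_num at h2
  · have b1 : N 1 = -1 := by linarith
    have b2 : N 2 = 0 := by linarith
    rw [b1, b2] at h2; norm_num at h2
  · have b1 : N 1 = -1 := by linarith
    have b2 : N 2 = -1 := by linarith
    rw [b1, b2] at h3; norm_num at h3

lemma quadMul_smul_right {A : Type*} [CommRing A] (c : A) (q : Fin 3 → A) (h : Fin 5 → A) :
    quadMul q (fun i => c * h i) = fun i => c * quadMul q h i := by
  funext i
  fin_cases i <;> simp only [quadMul, Fin.zero_eta, Fin.mk_one, Fin.reduceFinMk,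
    Matrix.cons_val] <;> ring

lemma quadMul_smul_left {A : Type*} [CommRing A] (c : A) (q : Fin 3 → A) (h : Fin 5 → A) :
    quadMul (fun i => c * q i) h = fun i => c * quadMul q h i := by
  funext i
  fin_cases i <;> simp only [quadMul, Fin.zero_eta, Fin.mk_one, Fin.reduceFinMk,
    Matrix.cons_val] <;> ring

lemma quadMul_zero {A : Type*} [CommRing A] (q : Fin 3 → A) : quadMul q 0 = 0 := by
  funext i; fin_cases i <;> simp [quadMul]

lemma red_comp_ne_zero {n : ℕ} {v : Fin n → OddDen} (hv : ∃ i, red (v i) ≠ 0) : red ∘ v ≠ 0 :=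
  fun h => hv.elim fun i hi => hi (congr_fun h i)

lemma exists_coe_of_mul_quadSq {g : Fin 3 → OddDen} (hg : ∃ i, red (g i) ≠ 0) {μ : ℚ}
    {v : Fin 5 → OddDen} (h : ∀ i, (v i : ℚ) = μ * quadSq g i) : ∃ ν : OddDen, μ = ν := by
  have h1 : quadSq (red ∘ g) ≠ 0 := fun h0 => red_comp_ne_zero hg (zmod_quadSq_eq_zero _ h0)
  obtain ⟨i, hi⟩ := Function.ne_iff.mp h1
  rw [quadSq_map] at hi
  obtain ⟨s, hs⟩ := exists_inv (r := quadSq g i) hi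
  refine ⟨v i * s, ?_⟩
  have hs' : ((quadSq g i : OddDen) : ℚ) * s = 1 := by exact_mod_cast congr_arg Subtype.val hs
  push_cast
  rw [h i]
  linear_combination -μ * hs'

lemma exists_integral_shift {q : Fin 3 → OddDen} (hq : ∃ i, red (q i) ≠ 0) {N : Fin 4 → OddDen}
    {h : Fin 5 → OddDen} {S : Fin 2 → ℚ} {g : Fin 3 → OddDen} (hg : ∃ i, red (g i) ≠ 0) {μ : ℚ}
    (hS : ∀ i, shiftCofactor (OddDen.subtype ∘ q) (OddDen.subtype ∘ N) (OddDen.subtype ∘ h) S i =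
      μ * quadSq g i) : ∃ S' : Fin 2 → OddDen, S = OddDen.subtype ∘ S' := by
  by_cases hS0 : S = 0
  · exact ⟨0, by rw [hS0]; funext i; simp⟩
  obtain ⟨c, r, hc, hr, hr1⟩ := exists_primitive hS0
  by_cases hcR : c ∈ OddDen
  · exact ⟨fun i => ⟨c, hcR⟩ * r i, funext fun i => by simp [hr i]⟩
  exfalso
  obtain ⟨d, hd⟩ := exists_inv_eq_two_mul hcR
  have hcd : c * (2 * d) = 1 := by rw [← hd]; exact mul_inv_cancel₀ hc
  have key : ∀ i, (((2 * d) ^ 2 * h i + (2 * d) * (shiftCofactor 0 N 0 r i) +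
      shiftCofactor q 0 0 r i - shiftCofactor 0 0 0 r i : OddDen) : ℚ) =
      (μ * (2 * d) ^ 2) * quadSq g i := by
    intro i
    have h1 := hS i
    have e : (2 * (d : ℚ)) ^ 2 * shiftCofactor (OddDen.subtype ∘ q) (OddDen.subtype ∘ N)
        (OddDen.subtype ∘ h) S i = (((2 * d) ^ 2 * h i + (2 * d) * (shiftCofactor 0 N 0 r i) +
      shiftCofactor q 0 0 r i - shiftCofactor 0 0 0 r i : OddDen) : ℚ) := by
      fin_cases i
      · simp [shiftCofactor, hr]
        linear_combination (2 * d * r 0 * (1 + 2 * N 0) + q 0 * r 0 ^ 2 * (c * (2 * d) + 1)) * hcd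
      · simp [shiftCofactor, hr]
        linear_combination (2 * d * (r 0 * (2 * N 1) + r 1 * (1 + 2 * N 0)) +
          (q 0 * (2 * r 0 * r 1) + q 1 * r 0 ^ 2) * (c * (2 * d) + 1)) * hcd
      · simp [shiftCofactor, hr]
        linear_combination (2 * d * (r 0 * (1 + 2 * N 2) + r 1 * (2 * N 1)) + (q 0 * r 1 ^ 2 +
          q 1 * (2 * r 0 * r 1) + q 2 * r 0 ^ 2) * (c * (2 * d) + 1)) * hcd
      · simp [shiftCofactor, hr]
        linear_combination (2 * d * (r 0 * (1 + 2 * N 3) + r 1 * (1 + 2 * N 2)) +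
          (q 1 * r 1 ^ 2 + q 2 * (2 * r 0 * r 1)) * (c * (2 * d) + 1)) * hcd
      · simp [shiftCofactor, hr]
        linear_combination (2 * d * (r 1 * (1 + 2 * N 3)) + q 2 * r 1 ^ 2 * (c * (2 * d) + 1)) * hcd
    rw [← e, h1]; ring
  obtain ⟨ν, hν⟩ := exists_coe_of_mul_quadSq hg key
  rw [hν] at key
  have key' : ∀ i, (2 * d) ^ 2 * h i + (2 * d) * (shiftCofactor 0 N 0 r i) +
      shiftCofactor q 0 0 r i - shiftCofactor 0 0 0 r i = ν * quadSq g i := fun i =>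
    Subtype.ext (by simpa using key i)
  have red2 : red 2 = 0 := by rw [map_ofNat]; decide
  have hν1 : red ν ≠ 0 := by
    intro h0
    have : ∀ i, shiftCofactor (red ∘ q) 0 0 (red ∘ r) i - shiftCofactor 0 0 0 (red ∘ r) i = 0 := by
      intro i
      have e1 := shiftCofactor_map red q 0 0 r i
      have e2 := shiftCofactor_map red 0 0 0 r i
      have e3 := congr_arg red (key' i)
      have z3 : red ∘ (0 : Fin 3 → OddDen) = 0 := by funext j; simp
      have z4 : red ∘ (0 : Fin 4 → OddDen) = 0 := by funext j; simp
      have z5 : red ∘ (0 : Fin 5 → OddDen) = 0 := by funext j; simp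
      rw [z4, z5] at e1 e2
      rw [z3] at e2
      rw [e1, e2, ← map_sub]
      simp only [map_add, map_sub, map_mul, map_pow, h0, red2] at e3 ⊢
      linear_combination e3
    rcases zmod_quad_mul_linSq _ _ this with h1 | h1
    · exact red_comp_ne_zero hq h1
    · exact red_comp_ne_zero hr1 h1
  have hd0 : (2 * d : OddDen) ≠ 0 := by
    intro h0
    have : (2 * (d : ℚ)) = 0 := by exact_mod_cast congr_arg Subtype.val h0
    rw [this] at hcd; simp at hcd
  obtain ⟨κ, hκ⟩ := exists_inv hν1
  have ev := shiftCofactor_eval rfl rfl key'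
  set G := g 0 * r 1 ^ 2 + g 1 * r 1 * -r 0 + g 2 * (-r 0) ^ 2 with hG
  obtain ⟨γ, hγ⟩ : ∃ γ : OddDen, G = 2 * d * γ := by
    have hm : (c * (G : ℚ)) ∈ OddDen := by
      apply mem_of_sq_mem
      have : (c * (G : ℚ)) ^ 2 = ((h 0 * r 1 ^ 4 + h 1 * r 1 ^ 3 * -r 0 +
          h 2 * r 1 ^ 2 * (-r 0) ^ 2 +
          h 3 * r 1 * (-r 0) ^ 3 + h 4 * (-r 0) ^ 4) * κ : OddDen) := by
        have ev' := congr_arg (fun x : OddDen => (x : ℚ)) ev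
        have hκ' := congr_arg (fun x : OddDen => (x : ℚ)) hκ
        push_cast at ev' hκ' ⊢
        generalize (h 0 * r 1 ^ 4 + h 1 * r 1 ^ 3 * -r 0 + h 2 * r 1 ^ 2 * (-r 0) ^ 2 +
          h 3 * r 1 * (-r 0) ^ 3 + h 4 * (-r 0) ^ 4 : ℚ) = W at ev' ⊢
        linear_combination -c ^ 2 * G ^ 2 * hκ' - c ^ 2 * κ * ev' +
          W * κ * (c * (2 * d) + 1) * hcd
      rw [this]
      exact Subtype.property _
    refine ⟨⟨_, hm⟩, Subtype.ext ?_⟩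
    push_cast
    linear_combination -(G : ℚ) * hcd
  obtain ⟨vX, vZ, hv⟩ : ∃ vX vZ : OddDen, r 0 * vZ + r 1 * vX = 1 := by
    obtain ⟨i, hi⟩ := hr1
    obtain ⟨s, hs⟩ := exists_inv hi
    fin_cases i
    · exact ⟨0, s, by simpa using hs⟩
    · exact ⟨s, 0, by simpa using hs⟩
  obtain ⟨a, b, hab⟩ := shiftCofactor_deriv rfl rfl hv key'
  rw [← hG, hγ] at hab
  have hab' : (2 * d) * a + ((1 + 2 * N 0) * r 1 ^ 3 + 2 * N 1 * r 1 ^ 2 * (-r 0) +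
        (1 + 2 * N 2) * r 1 * (-r 0) ^ 2 + (1 + 2 * N 3) * (-r 0) ^ 3) = 2 * ν * γ * b :=
    mul_left_cancel₀ hd0 (by linear_combination hab)
  have e := congr_arg red hab'
  simp only [map_add, map_mul, map_pow, map_neg, map_one, red2] at e
  obtain ⟨h1, h2⟩ := zmod_cubic_ne_zero (-red (r 0)) (red (r 1)) (by linear_combination e)
  apply red_comp_ne_zero hr1
  funext i
  fin_cases i
  · simpa using h1
  · exact h2

lemma HalfStep.good_step (HS : HalfStep) {q : Fin 3 → OddDen} (hq : ∃ i, red (q i) ≠ 0)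
    {N : Fin 4 → OddDen} {h : Fin 5 → OddDen} (hN : halfForm N = quadMul q h) :
    ∃ (N' : Fin 4 → OddDen) (μ : OddDen) (g : Fin 3 → OddDen), red μ ≠ 0 ∧
      (∃ i, red (g i) ≠ 0) ∧ halfForm N' = quadMul (fun i => μ * q i) (quadSq g) := by
  have hNQ : halfForm (OddDen.subtype ∘ N) =
      quadMul (OddDen.subtype ∘ q) (OddDen.subtype ∘ h) := by
    rw [halfForm_map, quadMul_map, hN]
  have hq0 : OddDen.subtype ∘ q ≠ 0 := by
    intro h0
    obtain ⟨i, hi⟩ := hq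
    have : q i = 0 := Subtype.ext (congr_fun h0 i)
    exact hi (by rw [this, map_zero])
  have hstate : IsState (OddDen.subtype ∘ q) (liftHalf (OddDen.subtype ∘ N))
      (fun i => 4 * OddDen.subtype (h i)) := by
    rw [liftHalf_isState_iff, hNQ]
    exact (quadMul_smul_right 4 _ _).symm
  obtain ⟨l, M', g, s, hl, hM, hs⟩ := HS _ _ _ hq0 hstate
  have hM' : M' = liftHalf (fun i => (OddDen.subtype ∘ N) i +
      quadLin (OddDen.subtype ∘ q) (fun i => s i / 2) i) := by
    funext i
    rw [hs]
    fin_cases i <;> simp [liftHalf, quadLin] <;> ring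
  have hshift := halfForm_shift (fun i => s i / 2) hNQ
  rw [hM', liftHalf_isState_iff, hshift] at hM
  have hcof : (fun i => 4 * shiftCofactor (OddDen.subtype ∘ q) (OddDen.subtype ∘ N)
      (OddDen.subtype ∘ h) (fun i => s i / 2) i) = fun i => l * quadSq g i := by
    apply quadMul_left_cancel hq0
    rw [quadMul_smul_right, quadMul_smul_right, hM, quadMul_smul_left]
  have hg0 : g ≠ 0 := by
    rintro rfl
    apply rat_halfForm_ne_zero _ (hshift.trans ?_)
    have : shiftCofactor (OddDen.subtype ∘ q) (OddDen.subtype ∘ N)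
      (OddDen.subtype ∘ h) (fun i => s i / 2) = 0 := by
      funext i
      have := congr_fun hcof i
      fin_cases i <;> simpa [quadSq] using this
    rw [this, quadMul_zero]
  obtain ⟨c, g', hc, hg', hgp⟩ := exists_primitive hg0
  have hcof' : ∀ i, shiftCofactor (OddDen.subtype ∘ q) (OddDen.subtype ∘ N)
      (OddDen.subtype ∘ h) (fun i => s i / 2) i = (l * c ^ 2 / 4) * quadSq g' i := by
    intro i
    have h1 := congr_fun hcof i
    have h2 : quadSq g i = c ^ 2 * quadSq g' i := by
      fin_cases i <;> simp [quadSq, hg'] <;> ring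
    simp only [h2] at h1
    linear_combination h1 / 4
  obtain ⟨S, hS⟩ := exists_integral_shift hq hgp hcof'
  rw [hS] at hcof'
  simp only [shiftCofactor_map] at hcof'
  obtain ⟨μ, hμ⟩ := exists_coe_of_mul_quadSq hgp hcof'
  rw [hμ] at hcof'
  have e := halfForm_shift S hN
  have e2 : quadMul q (shiftCofactor q N h S) = quadMul (fun i => μ * q i) (quadSq g') := by
    have : shiftCofactor q N h S = fun i => μ * quadSq g' i :=
      funext fun i => Subtype.ext (by simpa using hcof' i)
    rw [this, quadMul_smul_left, quadMul_smul_right]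
  rw [e2] at e
  refine ⟨_, μ, g', fun h0 => ?_, hgp, e⟩
  apply zmod_halfForm_ne_zero (red ∘ _)
  rw [halfForm_map, e, quadMul_smul_left]
  funext i
  simp [h0]

/-- Coefficients of the product of two polynomials of degree at most `2`. -/
def quadProd {A : Type*} [CommRing A] (x g : Fin 3 → A) : Fin 5 → A :=
  ![x 0 * g 0, x 0 * g 1 + x 1 * g 0, x 0 * g 2 + x 1 * g 1 + x 2 * g 0, x 1 * g 2 + x 2 * g 1,
    x 2 * g 2]

lemma quadMul_quadSq {A : Type*} [CommRing A] (x g : Fin 3 → A) :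
    quadMul x (quadSq g) = quadMul g (quadProd x g) := by
  funext i
  fin_cases i <;> simp only [quadMul, quadSq, quadProd, Fin.zero_eta, Fin.mk_one, Fin.reduceFinMk,
    Matrix.cons_val] <;> ring

lemma quadMul_rescale {A : Type*} [CommRing A] {w v : A} (hwv : w * v = 1) (x g : Fin 3 → A) :
    quadMul (fun i => w ^ 2 * x i) (quadSq fun i => v * g i) = quadMul x (quadSq g) := by
  have : (quadSq fun i => v * g i) = fun i => v ^ 2 * quadSq g i := by
    funext i
    fin_cases i <;> simp only [quadSq, Fin.zero_eta, Fin.mk_one, Fin.reduceFinMk,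
      Matrix.cons_val] <;> ring
  rw [this, quadMul_smul_left, quadMul_smul_right]
  funext i
  linear_combination (w * v + 1) * quadMul x (quadSq g) i * hwv

namespace OddDen

lemma red_eq_one {r : OddDen} (h : red r ≠ 0) : red r = 1 := by
  generalize red r = x at h
  revert h; revert x; decide

lemma exists_eq_add_two_mul {r : OddDen} {n : ℤ} (h : red r = n) : ∃ e, r = n + 2 * e := by
  obtain ⟨e, he⟩ := exists_eq_two_mul (r := r - n) (by rw [map_sub, h, map_intCast, sub_self])
  exact ⟨e, by linear_combination he⟩

lemma red_two : red 2 = 0 := by rw [map_ofNat]; decide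

lemma coe_two_ne_zero : (2 : OddDen) ≠ 0 := fun h => by
  have : (2 : ℚ) = 0 := by exact_mod_cast congr_arg Subtype.val h
  norm_num at this

end OddDen

lemma exists_knownTriple_mod_two {N : Fin 4 → OddDen} {x g : Fin 3 → OddDen}
    (h : halfForm N = quadMul x (quadSq g)) : ∃ c ∈ knownTriples,
      (∀ i, red (N i) = c.1 i) ∧ (∀ i, red (x i) = c.2.1 i) ∧ ∀ i, red (g i) = c.2.2 i :=
  zmod_exists_knownTriple (red ∘ N) (red ∘ x) (red ∘ g) (by
    rw [halfForm_map, quadSq_map, quadMul_map, h])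

lemma exists_knownTriple_mod_two_pow (HS : HalfStep) (m : ℕ) :
    ∀ (N : Fin 4 → OddDen) (x g : Fin 3 → OddDen), halfForm N = quadMul x (quadSq g) →
      (∃ i, red (g i) ≠ 0) → ∃ c ∈ knownTriples, ∃ u v : OddDen, u * v = 1 ∧
        ∀ i, ∃ e, x i = u * c.2.1 i + 2 ^ (m + 1) * e := by
  induction m with
  | zero =>
    intro N x g h _
    obtain ⟨c, hc, -, hx, -⟩ := exists_knownTriple_mod_two h
    refine ⟨c, hc, 1, 1, one_mul 1, fun i => ?_⟩
    obtain ⟨e, he⟩ := exists_eq_add_two_mul (hx i)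
    exact ⟨e, by rw [he]; ring⟩
  | succ m ih =>
    intro N x g h hg
    obtain ⟨c, hc, cN, cx, cg⟩ := exists_knownTriple_mod_two h
    obtain ⟨N', μ, g', hμ, hg', h'⟩ := HS.good_step hg (h.trans (quadMul_quadSq x g))
    obtain ⟨c', hc', u, v, huv, hx'⟩ := ih _ _ _ h' hg'
    choose e he using hx'
    obtain ⟨κ, hκ⟩ := exists_inv hμ
    have hu : red u = 1 := red_eq_one fun h0 => by
      have := congr_arg red huv
      rw [map_mul, h0, zero_mul, map_one] at this
      exact zero_ne_one this
    have hnext := knownTriples_next c hc c' hc' (fun i => by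
      have := congr_arg red (he i)
      simp only [map_mul, map_add, map_pow, red_two, red_eq_one hμ, hu, cg, map_intCast,
        ne_eq, Nat.add_eq_zero_iff, one_ne_zero, and_false, not_false_eq_true, zero_pow] at this
      linear_combination -this)
    obtain ⟨w, v', hwv, hgw⟩ : ∃ w v' : OddDen, w * v' = 1 ∧
        ∀ i, ∃ e, g i = w * c.2.2 i + 2 ^ (m + 1) * e := by
      rcases hnext with h1 | h1
      · refine ⟨κ * u, μ * v, by linear_combination μ * κ * huv + hκ, fun i => ⟨κ * e i, ?_⟩⟩
        have := he i
        rw [h1] at this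
        linear_combination κ * this - g i * hκ
      · refine ⟨-(κ * u), -(μ * v), by linear_combination μ * κ * huv + hκ,
          fun i => ⟨κ * e i, ?_⟩⟩
        have := he i
        rw [h1, Pi.neg_apply, Int.cast_neg] at this
        linear_combination κ * this - g i * hκ
    choose f hf using hgw
    have hw : red w = 1 := red_eq_one fun h0 => by
      have := congr_arg red hwv
      rw [map_mul, h0, zero_mul, map_one] at this
      exact zero_ne_one this
    have hv' : red v' = 1 := by
      have := congr_arg red hwv
      rwa [map_mul, hw, one_mul, map_one] at this
    have hres := h.trans (quadMul_rescale hwv x g).symm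
    have hc0 : halfForm (fun i => (c.1 i : OddDen)) = quadMul (fun i => (c.2.1 i : OddDen))
        (quadSq fun i => (c.2.2 i : OddDen)) := by
      have h1 := halfForm_map (Int.castRingHom OddDen) c.1
      rw [knownTriples_spec c hc, ← quadMul_map, ← quadSq_map] at h1
      exact h1
    have key : ∀ j ≤ m + 1, (∀ i, ∃ d, N i = c.1 i + 2 ^ (j + 1) * d) ∧
        ∀ i, ∃ y, w ^ 2 * x i = c.2.1 i + 2 ^ (j + 1) * y := by
      intro j
      induction j with
      | zero =>
        refine fun _ => ⟨fun i => ?_, fun i => ?_⟩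
        · simpa using exists_eq_add_two_mul (cN i)
        · simpa using exists_eq_add_two_mul (r := w ^ 2 * x i) (n := c.2.1 i)
            (by rw [map_mul, map_pow, hw, cx]; ring)
      | succ j ihj =>
        intro hj
        obtain ⟨hN, hx⟩ := ihj (by omega)
        choose d hd using hN
        choose y hy using hx
        obtain ⟨k, rfl⟩ := Nat.exists_eq_add_of_le (show j ≤ m by omega)
        obtain ⟨r1, r2⟩ := halfForm_rigid red coe_two_ne_zero (u := 2 ^ j) (v := 2 ^ k)
          (pow_ne_zero _ coe_two_ne_zero) (d := d) (y := y) (e := fun i => v' * f i) hres hc0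
          (fun i => by rw [hd i]; ring) (fun i => by rw [hy i]; ring)
          (fun i => by
            rw [hf i]
            linear_combination (c.2.2 i : OddDen) * hwv)
          (by
            obtain ⟨i, hi⟩ := hg
            exact ⟨i, by rw [map_mul, hv', one_mul]; exact hi⟩)
        refine ⟨fun i => ?_, fun i => ?_⟩
        · obtain ⟨s, hs⟩ := exists_eq_two_mul (r1 i)
          exact ⟨s, by rw [hd i, hs]; ring⟩
        · obtain ⟨s, hs⟩ := exists_eq_two_mul (r2 i)
          exact ⟨s, by rw [hy i, hs]; ring⟩
    refine ⟨c, hc, v' ^ 2, w ^ 2, by linear_combination (w * v' + 1) * hwv, fun i => ?_⟩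
    obtain ⟨y, hy⟩ := (key (m + 1) le_rfl).2 i
    exact ⟨v' ^ 2 * y, by linear_combination v' ^ 2 * hy - x i * (w * v' + 1) * hwv⟩

lemma proportional_of_triple (HS : HalfStep) {N : Fin 4 → OddDen} {x g : Fin 3 → OddDen}
    (h : halfForm N = quadMul x (quadSq g)) (hg : ∃ i, red (g i) ≠ 0) :
    ∃ c ∈ knownTriples, ∀ i j, x i * c.2.1 j = x j * c.2.1 i := by
  by_contra hcon
  push Not at hcon
  have hev : ∀ᶠ m in Filter.atTop, ∀ c ∈ {c | c ∈ knownTriples},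
      ¬ ∃ u : OddDen, ∀ i, ∃ e, x i = u * c.2.1 i + 2 ^ m * e := by
    rw [Filter.eventually_all_finite (List.finite_toSet knownTriples)]
    intro c hc
    obtain ⟨i, j, hij⟩ := hcon c hc
    have : ¬ ∀ m : ℕ, ∃ s : OddDen, x i * c.2.1 j - x j * c.2.1 i = 2 ^ m * s := fun hall =>
      hij (sub_eq_zero.mp (eq_zero_of_forall_dvd hall))
    push Not at this
    obtain ⟨m0, hm0⟩ := this
    filter_upwards [Filter.eventually_ge_atTop m0] with m hm
    rintro ⟨u, hu⟩
    obtain ⟨a, ha⟩ := hu i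
    obtain ⟨b, hb⟩ := hu j
    obtain ⟨k, rfl⟩ := Nat.exists_eq_add_of_le hm
    apply hm0 (2 ^ k * (a * c.2.1 j - b * c.2.1 i))
    rw [ha, hb]; ring
  obtain ⟨m, hm⟩ := (hev.and (Filter.eventually_ge_atTop 1)).exists
  obtain ⟨m, rfl⟩ := Nat.exists_eq_add_of_le' hm.2
  obtain ⟨c, hc, u, -, -, hu⟩ := exists_knownTriple_mod_two_pow HS m N x g h hg
  exact hm.1 c hc ⟨u, hu⟩

lemma proportional_of_good (HS : HalfStep) {q : Fin 3 → OddDen} (hq : ∃ i, red (q i) ≠ 0)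
    {N : Fin 4 → OddDen} {h : Fin 5 → OddDen} (hN : halfForm N = quadMul q h) :
    ∃ k ∈ knownQuads, ∀ i j, q i * k j = q j * k i := by
  obtain ⟨N', μ, g, hμ, hg, h'⟩ := HS.good_step hq hN
  obtain ⟨c, hc, hcr⟩ := proportional_of_triple HS h' hg
  have hμ0 : μ ≠ 0 := fun h0 => hμ (by rw [h0, map_zero])
  have hcr' : ∀ i j, q i * c.2.1 j = q j * c.2.1 i := fun i j =>
    mul_left_cancel₀ hμ0 (by linear_combination hcr i j)
  rcases knownTriples_quad c hc with h1 | h1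
  · exact ⟨_, h1, hcr'⟩
  · refine ⟨_, h1, fun i j => ?_⟩
    simp only [Pi.neg_apply, Int.cast_neg]
    linear_combination -hcr' i j

/-- `q` is a multiple of an element of `knownQuads`. -/
def IsKnown (q : Fin 3 → ℚ) : Prop := ∃ k ∈ knownQuads, ∀ i j, q i * k j = q j * k i

/-- The action of `X ↦ -1 / (1 + X)` on polynomials of degree at most `2`. -/
def rotQuad (q : Fin 3 → ℚ) : Fin 3 → ℚ := ![q 0 - q 1 + q 2, 2 * q 0 - q 1, q 0]

lemma knownQuads_rot : ∀ k ∈ knownQuads,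
    ![k 2, 2 * k 2 - k 1, k 0 - k 1 + k 2] ∈ knownQuads ∨
      -![k 2, 2 * k 2 - k 1, k 0 - k 1 + k 2] ∈ knownQuads := by
  decide +kernel

lemma IsKnown.of_rotQuad {q : Fin 3 → ℚ} (h : IsKnown (rotQuad q)) : IsKnown q := by
  obtain ⟨k, hk, hc⟩ := h
  have e1 := hc 0 1
  have e2 := hc 0 2
  have e3 := hc 1 2
  simp only [rotQuad, Matrix.cons_val] at e1 e2 e3
  rcases knownQuads_rot k hk with h | h
  · refine ⟨_, h, fun i j => ?_⟩
    fin_cases i <;> fin_cases j <;> simp <;> linarith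
  · refine ⟨_, h, fun i j => ?_⟩
    fin_cases i <;> fin_cases j <;> simp <;> linarith

lemma exists_state_rotQuad {q : Fin 3 → ℚ} {M : Fin 4 → ℚ} {h : Fin 5 → ℚ} (hs : IsState q M h) :
    ∃ M' h', IsState (rotQuad q) M' h' := by
  obtain ⟨h0, h1, h2, h3, h4, h5, h6⟩ := isState_iff.mp hs
  refine ⟨![M 0 - M 1 + M 2 - M 3, 3 * M 0 - 2 * M 1 + M 2, 3 * M 0 - M 1, M 0],
    ![h 0 - h 1 + h 2 - h 3 + h 4, 4 * h 0 - 3 * h 1 + 2 * h 2 - h 3, 6 * h 0 - 3 * h 1 + h 2,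
      4 * h 0 - h 1, h 0], isState_iff.mpr ?_⟩
  simp only [rotQuad, Matrix.cons_val]
  refine ⟨?_, ?_, ?_, ?_, ?_, ?_, ?_⟩
  · linear_combination h0 - h1 + h2 - h3 + h4 - h5 + h6
  · linear_combination 6 * h0 - 5 * h1 + 4 * h2 - 3 * h3 + 2 * h4 - h5
  · linear_combination 15 * h0 - 10 * h1 + 6 * h2 - 3 * h3 + h4
  · linear_combination 20 * h0 - 10 * h1 + 4 * h2 - h3
  · linear_combination 15 * h0 - 5 * h1 + h2
  · linear_combination 6 * h0 - h1
  · linear_combination h0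

lemma isKnown_of_good (HS : HalfStep) {q : Fin 3 → OddDen} (hq : ∃ i, red (q i) ≠ 0)
    {N : Fin 4 → OddDen} {h : Fin 5 → ℚ}
    (hN : halfForm (OddDen.subtype ∘ N) = quadMul (OddDen.subtype ∘ q) h) :
    IsKnown (OddDen.subtype ∘ q) := by
  rw [halfForm_map] at hN
  obtain ⟨h', rfl⟩ := exists_coe_of_quadMul hq hN.symm
  rw [quadMul_map] at hN
  have : halfForm N = quadMul q h' := funext fun i => Subtype.ext (congr_fun hN i)
  obtain ⟨k, hk, hc⟩ := proportional_of_good HS hq this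
  refine ⟨k, hk, fun i j => ?_⟩
  have := congr_arg (fun x : OddDen => (x : ℚ)) (hc i j)
  simpa using this

lemma exists_linear_remainder {q : Fin 3 → ℚ} (hq : q 2 ≠ 0) {M : Fin 4 → ℚ} {h : Fin 5 → ℚ}
    (hs : IsState q M h) : ∃ (b : Fin 2 → ℚ) (w : Fin 5 → ℚ),
      halfForm ![b 0, b 1, 0, 0] = quadMul q w := by
  have hM : M = liftHalf ![(M 0 - 1) / 2, M 1 / 2, (M 2 - 1) / 2, (M 3 - 1) / 2] := by
    funext i; fin_cases i <;> simp [liftHalf] <;> ring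
  rw [hM, liftHalf_isState_iff] at hs
  have hs' : halfForm ![(M 0 - 1) / 2, M 1 / 2, (M 2 - 1) / 2, (M 3 - 1) / 2] =
      quadMul q (fun i => 4⁻¹ * h i) := by
    rw [quadMul_smul_right, ← hs]
    funext i
    ring
  set k1 := (M 3 - 1) / 2 / q 2 with hk1
  set k0 := ((M 2 - 1) / 2 - q 1 * k1) / q 2 with hk0
  have hsh := halfForm_shift ![-k0, -k1] hs'
  refine ⟨![(M 0 - 1) / 2 - q 0 * k0, M 1 / 2 - q 0 * k1 - q 1 * k0], _, Eq.trans ?_ hsh⟩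
  congr 1
  have e1 : q 2 * k1 = (M 3 - 1) / 2 := by rw [hk1]; field_simp
  have e0 : q 2 * k0 = (M 2 - 1) / 2 - q 1 * k1 := by rw [hk0]; field_simp
  funext i
  fin_cases i <;> simp [quadLin] <;> linarith

lemma zmod_linear_sq : ∀ q0 q1 q2 w b0 b1 : ZMod 2, q2 ≠ 0 →
    (b0 ^ 2 = q0 * w ∧ 0 = q1 * w ∧ b1 ^ 2 = q2 * w) ∧ (b0 ≠ 0 ∨ b1 ≠ 0) → w ≠ 0 ∧ b1 ≠ 0 := by
  decide +kernel

lemma IsKnown.eq_of_ne_zero {q : Fin 3 → ℚ} (h : IsKnown q) (h0 : q 0 ≠ 0) (h2 : q 2 ≠ 0) :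
    q 0 = q 2 := by
  obtain ⟨k, hk, hkk⟩ := h
  have e02 := hkk 0 2
  have e01 := hkk 0 1
  simp only [knownQuads, List.mem_cons, List.not_mem_nil, or_false] at hk
  rcases hk with rfl | rfl | rfl | rfl | rfl | rfl <;> simp at e02 e01
  · exact absurd e02.symm h2
  · exact absurd e01 h0
  · exact absurd e02.symm h2
  · exact absurd e02 h0
  · exact absurd e02 h0
  · exact e02

set_option maxHeartbeats 1000000 in
lemma isKnown_of_red_ne_zero (HS : HalfStep) {q : Fin 3 → OddDen} (hq : red (q 2) ≠ 0)
    {M : Fin 4 → ℚ} {h : Fin 5 → ℚ} (hs : IsState (OddDen.subtype ∘ q) M h) :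
    IsKnown (OddDen.subtype ∘ q) := by
  have hq0 : (q 2 : ℚ) ≠ 0 := fun h0 => hq (by
    rw [show q 2 = 0 from Subtype.ext h0, map_zero])
  obtain ⟨b, w, hb⟩ := exists_linear_remainder hq0 hs
  by_cases hbR : ∀ i, b i ∈ OddDen
  · refine isKnown_of_good HS ⟨2, hq⟩ (N := ![⟨b 0, hbR 0⟩, ⟨b 1, hbR 1⟩, 0, 0]) (h := w) ?_
    rw [← hb]
    congr 1
    funext i; fin_cases i <;> simp
  exfalso
  have hb0 : b ≠ 0 := by
    rintro rfl
    exact hbR fun i => OddDen.zero_mem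
  obtain ⟨c, n, hc, hn, hn1⟩ := exists_primitive hb0
  have hcR : c ∉ OddDen := fun hcR => hbR fun i => by
    rw [hn i]; exact OddDen.mul_mem hcR (n i).2
  obtain ⟨d, hd⟩ := exists_inv_eq_two_mul hcR
  have hcd : c * (2 * d) = 1 := by rw [← hd]; exact mul_inv_cancel₀ hc
  obtain ⟨w', hw'⟩ : ∃ w' : Fin 5 → OddDen, (fun i => (2 * (d : ℚ)) ^ 2 * w i) =
      OddDen.subtype ∘ w' := by
    refine exists_coe_of_quadMul (q := q) (v := ![n 0 ^ 2 + 2 * d * n 0,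
      2 * n 0 * n 1 + 2 * d * n 1 - (2 * d) ^ 2, n 1 ^ 2 + 2 * d * n 0 - (2 * d) ^ 2,
      2 * d * (n 0 + n 1), 2 * d * n 1, 0, 0]) ⟨2, hq⟩ ?_
    rw [quadMul_smul_right, ← hb]
    funext i
    fin_cases i
    · simp [halfForm, hn]
      linear_combination (n 0 ^ 2 * (c * (2 * d) + 1) + 2 * d * n 0) * hcd
    · simp [halfForm, hn]
      linear_combination (2 * n 0 * n 1 * (c * (2 * d) + 1) + 2 * d * n 1) * hcd
    · simp [halfForm, hn]
      linear_combination (n 1 ^ 2 * (c * (2 * d) + 1) + 2 * d * n 0) * hcd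
    · simp [halfForm, hn]
      linear_combination (2 * d * (n 0 + n 1)) * hcd
    · simp [halfForm, hn]
      linear_combination (2 * d * n 1) * hcd
    · simp [halfForm]
    · simp [halfForm]
  have hww : ∀ i, w i = c ^ 2 * w' i := fun i => by
    have := congr_fun hw' i
    simp only [Function.comp_apply, Subring.subtype_apply] at this
    linear_combination c ^ 2 * this - (c * (2 * d) + 1) * w i * hcd
  obtain ⟨h0, h1, h2, h3, h4, h5, h6⟩ := halfForm_eq_iff.mp hb
  simp only [Matrix.cons_val, Function.comp_apply, Subring.subtype_apply, hww, hn]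
    at h0 h1 h2 h3 h4 h5 h6
  have toR : ∀ {x y : OddDen}, (x : ℚ) = y → x = y := fun h => Subtype.ext h
  have q20 : q 2 ≠ 0 := fun h => hq0 (by rw [h]; rfl)
  have f6 : w' 4 = 0 := by
    apply mul_left_cancel₀ q20
    apply toR
    push_cast
    linear_combination (-(2 * d) ^ 2) * h6 - (c * (2 * d) + 1) * q 2 * w' 4 * hcd
  rw [f6] at h5 h4
  have f5 : w' 3 = 0 := by
    apply mul_left_cancel₀ q20
    apply toR
    push_cast at h5 ⊢
    linear_combination (-(2 * d) ^ 2) * h5 - (c * (2 * d) + 1) * q 2 * w' 3 * hcd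
  rw [f5] at h4 h3
  have f4 : 2 * d * n 1 = q 2 * w' 2 := by
    apply toR
    push_cast
    push_cast at h4
    linear_combination (2 * d) ^ 2 * h4 - (2 * d * n 1 - (c * (2 * d) + 1) * q 2 * w' 2) * hcd
  have f3 : 2 * d * (n 0 + n 1) = q 1 * w' 2 + q 2 * w' 1 := by
    apply toR
    push_cast
    push_cast at h3
    linear_combination (2 * d) ^ 2 * h3 -
      (2 * d * (n 0 + n 1) - (c * (2 * d) + 1) * (q 1 * w' 2 + q 2 * w' 1)) * hcd
  have f2 : n 1 ^ 2 + 2 * d * n 0 - (2 * d) ^ 2 = q 0 * w' 2 + q 1 * w' 1 + q 2 * w' 0 := by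
    apply toR
    push_cast
    linear_combination (2 * d) ^ 2 * h2 - (2 * d * n 0 + (c * (2 * d) + 1) * (n 1 ^ 2 -
      (q 0 * w' 2 + q 1 * w' 1 + q 2 * w' 0))) * hcd
  have f1 : 2 * n 0 * n 1 + 2 * d * n 1 - (2 * d) ^ 2 = q 0 * w' 1 + q 1 * w' 0 := by
    apply toR
    push_cast
    linear_combination (2 * d) ^ 2 * h1 - (2 * d * n 1 + (c * (2 * d) + 1) * (2 * n 0 * n 1 -
      (q 0 * w' 1 + q 1 * w' 0))) * hcd
  have f0 : n 0 ^ 2 + 2 * d * n 0 = q 0 * w' 0 := by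
    apply toR
    push_cast
    linear_combination (2 * d) ^ 2 * h0 - (2 * d * n 0 + (c * (2 * d) + 1) * (n 0 ^ 2 -
      (q 0 * w' 0))) * hcd
  obtain ⟨κ, hκ⟩ := exists_inv hq
  obtain ⟨v2, hv2⟩ : ∃ v, w' 2 = 2 * d * v := ⟨κ * n 1, by
    linear_combination -κ * f4 - w' 2 * hκ⟩
  obtain ⟨v1, hv1⟩ : ∃ v, w' 1 = 2 * d * v := ⟨κ * (n 0 + n 1 - q 1 * v2), by
    linear_combination -κ * f3 - w' 1 * hκ - κ * q 1 * hv2⟩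
  have g0 := congr_arg red f0
  have g1 := congr_arg red f1
  have g2 := congr_arg red f2
  rw [hv1] at g1 g2
  rw [hv2] at g2
  simp only [map_add, map_mul, map_pow, map_sub, red_two] at g0 g1 g2
  obtain ⟨hw0, hn1'⟩ := zmod_linear_sq (red (q 0)) (red (q 1)) (red (q 2)) (red (w' 0))
    (red (n 0)) (red (n 1)) hq ⟨⟨by linear_combination g0, by linear_combination g1,
      by linear_combination g2⟩, by
      obtain ⟨i, hi⟩ := hn1
      fin_cases i
      · exact Or.inl hi
      · exact Or.inr hi⟩
  obtain ⟨ν, hν⟩ := exists_inv hw0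
  have hνQ : (w' 0 : ℚ) * ν = 1 := by exact_mod_cast congr_arg Subtype.val hν
  have hE : halfForm ![b 0, b 1, 0, 0] = quadMul (OddDen.subtype ∘ ![w' 0, w' 1, w' 2])
      ![c ^ 2 * q 0, c ^ 2 * q 1, c ^ 2 * q 2, 0, 0] := by
    rw [hb]
    funext i
    fin_cases i <;> simp [quadMul, hww, f5, f6] <;> ring
  have hsh := halfForm_shift ![-(ν * n 0 * c), -(ν * n 1 * c)] hE
  have hN : (fun i => (![b 0, b 1, 0, 0] : Fin 4 → ℚ) i + quadLin (OddDen.subtype ∘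
      ![w' 0, w' 1, w' 2]) ![-(ν * n 0 * c), -(ν * n 1 * c)] i) =
      OddDen.subtype ∘ ![0, -(ν * n 0 * v1), -(ν * (n 0 * v2 + n 1 * v1)), -(ν * n 1 * v2)] := by
    have hv1' : (w' 1 : ℚ) = 2 * d * v1 := by exact_mod_cast congr_arg Subtype.val hv1
    have hv2' : (w' 2 : ℚ) = 2 * d * v2 := by exact_mod_cast congr_arg Subtype.val hv2
    funext i
    fin_cases i
    · simp [quadLin, hn]
      linear_combination -c * n 0 * hνQ
    · simp [quadLin, hn, hv1']
      linear_combination -c * n 1 * hνQ - ν * n 0 * v1 * hcd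
    · simp [quadLin, hv1', hv2']
      linear_combination - ν * (n 0 * v2 + n 1 * v1) * hcd
    · simp [quadLin, hv2']
      linear_combination ν * n 1 * v2 * hcd
  rw [hN] at hsh
  have hprim : ∃ i, red (![w' 0, w' 1, w' 2] i) ≠ 0 :=
      ⟨0, by simpa only [Matrix.cons_val] using hw0⟩
  have hkn := isKnown_of_good HS (q := ![w' 0, w' 1, w' 2]) hprim hsh
  have hw00 : (w' 0 : ℚ) ≠ 0 := left_ne_zero_of_mul_eq_one hνQ
  have hn0 : (n 1 : ℚ) ≠ 0 := fun h => hn1' (by rw [show n 1 = 0 from toR h, map_zero])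
  have hw20 : (w' 2 : ℚ) ≠ 0 := fun h => by
    have := congr_arg (fun x : OddDen => (x : ℚ)) f4
    push_cast at this
    rw [h, mul_zero] at this
    have hd0 : (2 * d : ℚ) ≠ 0 := right_ne_zero_of_mul_eq_one hcd
    exact mul_ne_zero hd0 hn0 this
  have hw02 : w' 0 ≠ w' 2 := by
    intro h
    apply hw0
    rw [h, hv2, map_mul, map_mul, red_two]; ring
  have hfin := hkn.eq_of_ne_zero
  simp only [Function.comp_apply, Subring.subtype_apply, Matrix.cons_val] at hfin
  exact hw02 (toR (hfin hw00 hw20))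

theorem isKnown_of_isState (HS : HalfStep) {q : Fin 3 → ℚ} (hq : q ≠ 0)
    {M : Fin 4 → ℚ} {h : Fin 5 → ℚ} (hs : IsState q M h) : IsKnown q := by
  obtain ⟨c, v, hc, hv, hv1⟩ := exists_primitive hq
  have hqv : q = fun i => c * (OddDen.subtype ∘ v) i := funext hv
  have hs1 : IsState (OddDen.subtype ∘ v) M (fun i => c * h i) := by
    rw [IsState] at hs ⊢
    rw [hs, hqv, quadMul_smul_left, quadMul_smul_right]
  suffices IsKnown (OddDen.subtype ∘ v) by
    obtain ⟨k, hk, hkk⟩ := this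
    refine ⟨k, hk, fun i j => ?_⟩
    rw [hqv]
    linear_combination c * hkk i j
  have hrot : ∀ u : Fin 3 → OddDen, rotQuad (OddDen.subtype ∘ u) =
      OddDen.subtype ∘ ![u 0 - u 1 + u 2, 2 * u 0 - u 1, u 0] := fun u => by
    funext i; fin_cases i <;> simp [rotQuad]
  by_cases h2 : red (v 2) = 0
  · obtain ⟨M1, h1, hs2⟩ := exists_state_rotQuad hs1
    apply IsKnown.of_rotQuad
    by_cases h0 : red (v 0) = 0
    · obtain ⟨M2, h2', hs3⟩ := exists_state_rotQuad hs2
      apply IsKnown.of_rotQuad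
      rw [hrot, hrot] at hs3 ⊢
      refine isKnown_of_red_ne_zero HS ?_ hs3
      simp only [Matrix.cons_val, map_add, map_sub, h0, h2]
      obtain ⟨i, hi⟩ := hv1
      fin_cases i
      · exact absurd h0 hi
      · simpa using hi
      · exact absurd h2 hi
    · rw [hrot] at hs2 ⊢
      exact isKnown_of_red_ne_zero HS h0 hs2
  · exact isKnown_of_red_ne_zero HS h2 hs1

end TwoAdic

section Twist

variable {A : Type*} [CommRing A]

/-- Coefficients of the square of a polynomial of degree at most `3`. -/
def cubSq (M : Fin 4 → A) : Fin 7 → A :=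
  ![M 0 ^ 2, 2 * M 0 * M 1, 2 * M 0 * M 2 + M 1 ^ 2, 2 * M 0 * M 3 + 2 * M 1 * M 2,
    2 * M 1 * M 3 + M 2 ^ 2, 2 * M 2 * M 3, M 3 ^ 2]

/-- Coefficients of `F = X⁶ + 2X⁵ + X⁴ + 2X³ + 6X² + 4X + 1`. -/
def sextic : Fin 7 → A := ![1, 4, 6, 2, 1, 2, 1]

/-- `M ^ 2 - s q g ^ 2 = κ F` on coefficients. -/
def IsTwist (s κ : A) (q : Fin 3 → A) (M : Fin 4 → A) (g : Fin 3 → A) : Prop :=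
  ∀ i, cubSq M i - s * quadMul q (quadSq g) i = κ * sextic i

lemma isState_iff_cubSq {q : Fin 3 → A} {M : Fin 4 → A} {h : Fin 5 → A} :
    IsState q M h ↔ ∀ i, cubSq M i - sextic i = quadMul q h i := by
  rw [IsState, funext_iff]
  refine forall_congr' fun i => Eq.congr ?_ rfl
  fin_cases i <;> simp [cubSq, sextic]

/-- Constant coefficient of `M (τ + x)` modulo `x ^ 2 - D`. -/
def cubRem₀ (τ D : A) (M : Fin 4 → A) : A :=
  M 0 + M 1 * τ + M 2 * (τ ^ 2 + D) + M 3 * (τ ^ 3 + 3 * τ * D)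

/-- Linear coefficient of `M (τ + x)` modulo `x ^ 2 - D`. -/
def cubRem₁ (τ D : A) (M : Fin 4 → A) : A :=
  M 1 + M 2 * (2 * τ) + M 3 * (3 * τ ^ 2 + D)

/-- Constant coefficient of `p (τ + x)` modulo `x ^ 2 - D`. -/
def sexRem₀ (τ D : A) (p : Fin 7 → A) : A :=
  p 0 + p 1 * τ + p 2 * (τ ^ 2 + D) + p 3 * (τ ^ 3 + 3 * τ * D) +
    p 4 * (τ ^ 4 + 6 * τ ^ 2 * D + D ^ 2) + p 5 * (τ ^ 5 + 10 * τ ^ 3 * D + 5 * τ * D ^ 2) +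
    p 6 * (τ ^ 6 + 15 * τ ^ 4 * D + 15 * τ ^ 2 * D ^ 2 + D ^ 3)

/-- Linear coefficient of `p (τ + x)` modulo `x ^ 2 - D`. -/
def sexRem₁ (τ D : A) (p : Fin 7 → A) : A :=
  p 1 + p 2 * (2 * τ) + p 3 * (3 * τ ^ 2 + D) + p 4 * (4 * τ ^ 3 + 4 * τ * D) +
    p 5 * (5 * τ ^ 4 + 10 * τ ^ 2 * D + D ^ 2) + p 6 * (6 * τ ^ 5 + 20 * τ ^ 3 * D + 6 * τ * D ^ 2)

lemma sexRem₀_cubSq (τ D : A) (M : Fin 4 → A) :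
    sexRem₀ τ D (cubSq M) = cubRem₀ τ D M ^ 2 + D * cubRem₁ τ D M ^ 2 := by
  simp only [sexRem₀, cubSq, cubRem₀, cubRem₁, Matrix.cons_val]
  ring

lemma sexRem₁_cubSq (τ D : A) (M : Fin 4 → A) :
    sexRem₁ τ D (cubSq M) = 2 * cubRem₀ τ D M * cubRem₁ τ D M := by
  simp only [sexRem₁, cubSq, cubRem₀, cubRem₁, Matrix.cons_val]
  ring

lemma sexRem₀_quadMul {τ D : A} {q : Fin 3 → A} (h0 : q 0 = q 2 * (τ ^ 2 - D))
    (h1 : q 1 = -2 * q 2 * τ) (w : Fin 5 → A) : sexRem₀ τ D (quadMul q w) = 0 := by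
  simp only [sexRem₀, quadMul, Matrix.cons_val, h0, h1]
  ring

lemma sexRem₁_quadMul {τ D : A} {q : Fin 3 → A} (h0 : q 0 = q 2 * (τ ^ 2 - D))
    (h1 : q 1 = -2 * q 2 * τ) (w : Fin 5 → A) : sexRem₁ τ D (quadMul q w) = 0 := by
  simp only [sexRem₁, quadMul, Matrix.cons_val, h0, h1]
  ring

lemma sexRem₀_of_isState {τ D : A} {q : Fin 3 → A} (h0 : q 0 = q 2 * (τ ^ 2 - D))
    (h1 : q 1 = -2 * q 2 * τ) {M : Fin 4 → A} {h : Fin 5 → A} (hs : IsState q M h) :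
    cubRem₀ τ D M ^ 2 + D * cubRem₁ τ D M ^ 2 = sexRem₀ τ D sextic ∧
      2 * cubRem₀ τ D M * cubRem₁ τ D M = sexRem₁ τ D sextic := by
  rw [isState_iff_cubSq] at hs
  have e : cubSq M = fun i => quadMul q h i + sextic i := funext fun i => by
    linear_combination hs i
  have r0 := sexRem₀_quadMul h0 h1 h
  have r1 := sexRem₁_quadMul h0 h1 h
  rw [← sexRem₀_cubSq, ← sexRem₁_cubSq, e]
  simp only [sexRem₀, sexRem₁] at r0 r1 ⊢
  exact ⟨by linear_combination r0, by linear_combination r1⟩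

lemma sexRem₀_of_isTwist {τ D : A} {q : Fin 3 → A} (h0 : q 0 = q 2 * (τ ^ 2 - D))
    (h1 : q 1 = -2 * q 2 * τ) {s κ : A} {M : Fin 4 → A} {g : Fin 3 → A}
    (hs : IsTwist s κ q M g) :
    cubRem₀ τ D M ^ 2 + D * cubRem₁ τ D M ^ 2 = κ * sexRem₀ τ D sextic ∧
      2 * cubRem₀ τ D M * cubRem₁ τ D M = κ * sexRem₁ τ D sextic := by
  have e : cubSq M = fun i => s * quadMul q (quadSq g) i + κ * sextic i := funext fun i => by
    linear_combination hs i
  have r0 := sexRem₀_quadMul h0 h1 (quadSq g)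
  have r1 := sexRem₁_quadMul h0 h1 (quadSq g)
  rw [← sexRem₀_cubSq, ← sexRem₁_cubSq, e]
  simp only [sexRem₀, sexRem₁] at r0 r1 ⊢
  exact ⟨by linear_combination s * r0, by linear_combination s * r1⟩

end Twist

/-- The conclusion of `HalfStep` for a single state. -/
def HasHalfStep (q : Fin 3 → ℚ) (M : Fin 4 → ℚ) : Prop :=
  ∃ (l : ℚ) (M' : Fin 4 → ℚ) (g : Fin 3 → ℚ) (s : Fin 2 → ℚ), l ≠ 0 ∧
    IsState (fun i => l * q i) M' (quadSq g) ∧ ∀ i, M' i = M i + quadLin q s i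

lemma hasHalfStep_of_isTwist {τ D : ℚ} {q : Fin 3 → ℚ} (hq : q 2 ≠ 0)
    (h0 : q 0 = q 2 * (τ ^ 2 - D)) (h1 : q 1 = -2 * q 2 * τ) {M : Fin 4 → ℚ} {h : Fin 5 → ℚ}
    (hs : IsState q M h) {s κ : ℚ} {N : Fin 4 → ℚ} {g : Fin 3 → ℚ} (hs0 : s ≠ 0)
    (ht : IsTwist s κ q N g) (hn : cubRem₀ τ D M ^ 2 - D * cubRem₁ τ D M ^ 2 ≠ 0)
    (hU : cubRem₀ τ D N * cubRem₀ τ D M - D * (cubRem₁ τ D N * cubRem₁ τ D M) ≠ 0) :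
    HasHalfStep q M := by
  obtain ⟨a1, a2⟩ := sexRem₀_of_isState h0 h1 hs
  obtain ⟨b1, b2⟩ := sexRem₀_of_isTwist h0 h1 ht
  rw [← a1] at b1
  rw [← a2] at b2
  set a := cubRem₀ τ D M with ha
  set b := cubRem₁ τ D M with hb
  set a' := cubRem₀ τ D N with ha'
  set b' := cubRem₁ τ D N with hb'
  set n := a ^ 2 - D * b ^ 2 with hn'
  set U := a' * a - D * (b' * b) with hU'
  have hV : b' * a - a' * b = 0 := by
    refine (mul_eq_zero.mp (show U * (b' * a - a' * b) = 0 from ?_)).resolve_left hU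
    rw [hU']
    linear_combination (a ^ 2 + D * b ^ 2) * b2 / 2 - a * b * b1
  set k := U / n with hk
  have hkn : k * n = U := by rw [hk]; field_simp
  have hk0 : k ≠ 0 := div_ne_zero hU hn
  have e1 : a' = k * a := by
    apply mul_right_cancel₀ hn
    linear_combination -a * hkn + b * D * hV
  have e2 : b' = k * b := by
    apply mul_right_cancel₀ hn
    linear_combination -b * hkn + a * hV
  have hκ : κ = k ^ 2 := by
    have hpos : a ^ 2 + D * b ^ 2 ≠ 0 ∨ 2 * a * b ≠ 0 := by
      by_contra hcon
      push Not at hcon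
      apply hn
      have : n ^ 2 = 0 := by
        rw [hn']
        linear_combination (a ^ 2 + D * b ^ 2) * hcon.1 - 2 * a * b * D * hcon.2
      exact pow_eq_zero_iff two_ne_zero |>.mp this
    rcases hpos with h | h
    · apply mul_right_cancel₀ h
      rw [← b1, e1, e2]; ring
    · apply mul_right_cancel₀ h
      rw [← b2, e1, e2]; ring
  refine ⟨s, fun i => N i / k, fun i => g i / k,
    ![(N 2 / k - M 2 + 2 * τ * (N 3 / k - M 3)) / q 2, (N 3 / k - M 3) / q 2], hs0, ?_, ?_⟩
  · rw [isState_iff_cubSq]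
    intro i
    have := ht i
    rw [hκ] at this
    have c1 : cubSq (fun i => N i / k) i = cubSq N i / k ^ 2 := by
      fin_cases i <;> simp [cubSq] <;> field_simp
    have c2 : quadMul (fun i => s * q i) (quadSq fun i => g i / k) i =
        s * quadMul q (quadSq g) i / k ^ 2 := by
      rw [quadMul_smul_left]
      have : (quadSq fun i => g i / k) = fun i => (k ^ 2)⁻¹ * quadSq g i := by
        funext i
        fin_cases i <;> simp [quadSq] <;> field_simp
      rw [this, quadMul_smul_right]
      ring
    rw [c1, c2]
    field_simp
    linear_combination this
  · have f1 : cubRem₀ τ D (fun i => N i / k - M i) = 0 := by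
      have : cubRem₀ τ D (fun i => N i / k - M i) = a' / k - a := by
        simp only [cubRem₀, ha, ha']; ring
      rw [this, e1]; field_simp; ring
    have f2 : cubRem₁ τ D (fun i => N i / k - M i) = 0 := by
      have : cubRem₁ τ D (fun i => N i / k - M i) = b' / k - b := by
        simp only [cubRem₁, hb, hb']; ring
      rw [this, e2]; field_simp; ring
    simp only [cubRem₀, cubRem₁] at f1 f2
    intro i
    fin_cases i
    · simp [quadLin, h0]
      field_simp
      field_simp at f1 f2
      linear_combination f1 - τ * f2
    · simp [quadLin, h0, h1]
      field_simp
      field_simp at f2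
      linear_combination f2
    · simp [quadLin, h1]
      field_simp
      ring
    · simp [quadLin]
      field_simp
      ring

section RealForms

/-- The binary cubic form with coefficients `M`. -/
def cubForm (M : Fin 4 → ℚ) (X Z : ℝ) : ℝ :=
  M 0 * Z ^ 3 + M 1 * X * Z ^ 2 + M 2 * X ^ 2 * Z + M 3 * X ^ 3

/-- The binary quadratic form with coefficients `q`. -/
def quadForm (q : Fin 3 → ℚ) (X Z : ℝ) : ℝ := q 0 * Z ^ 2 + q 1 * X * Z + q 2 * X ^ 2

/-- The binary sextic form `F`. -/
def sexticForm (X Z : ℝ) : ℝ :=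
  Z ^ 6 + 4 * X * Z ^ 5 + 6 * X ^ 2 * Z ^ 4 + 2 * X ^ 3 * Z ^ 3 + X ^ 4 * Z ^ 2 + 2 * X ^ 5 * Z +
    X ^ 6

lemma sexticForm_pos {X Z : ℝ} (h : X ≠ 0 ∨ Z ≠ 0) : 0 < sexticForm X Z := by
  have e : sexticForm X Z = (X ^ 3 + X ^ 2 * Z - 2 * X * Z ^ 2 - Z ^ 3) ^ 2 +
      (2 * X * Z * (X + Z)) ^ 2 := by
    rw [sexticForm]; ring
  rw [e]
  by_contra hcon
  have h1 : (X ^ 3 + X ^ 2 * Z - 2 * X * Z ^ 2 - Z ^ 3) ^ 2 = 0 := by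
    nlinarith [sq_nonneg (X ^ 3 + X ^ 2 * Z - 2 * X * Z ^ 2 - Z ^ 3),
      sq_nonneg (2 * X * Z * (X + Z))]
  have h2 : (2 * X * Z * (X + Z)) ^ 2 = 0 := by
    nlinarith [sq_nonneg (X ^ 3 + X ^ 2 * Z - 2 * X * Z ^ 2 - Z ^ 3),
      sq_nonneg (2 * X * Z * (X + Z))]
  have h1' := pow_eq_zero_iff two_ne_zero |>.mp h1
  have h2' := pow_eq_zero_iff two_ne_zero |>.mp h2
  have hX : X = 0 ∨ Z = 0 ∨ X = -Z := by
    rcases mul_eq_zero.mp h2' with h3 | h3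
    · rcases mul_eq_zero.mp h3 with h4 | h4
      · exact Or.inl (by linarith)
      · exact Or.inr (Or.inl h4)
    · exact Or.inr (Or.inr (by linarith))
  have hz : X = 0 ∧ Z = 0 := by
    rcases hX with rfl | rfl | rfl
    · have : Z ^ 3 = 0 := by linear_combination -h1'
      exact ⟨rfl, pow_eq_zero_iff three_ne_zero |>.mp this⟩
    · have : X ^ 3 = 0 := by linear_combination h1'
      exact ⟨pow_eq_zero_iff three_ne_zero |>.mp this, rfl⟩
    · have : Z ^ 3 = 0 := by linear_combination h1'
      have := pow_eq_zero_iff three_ne_zero |>.mp this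
      simp [this]
  rcases h with h | h
  · exact h hz.1
  · exact h hz.2

lemma IsTwist.form_eq {s κ : ℚ} {q : Fin 3 → ℚ} {M : Fin 4 → ℚ} {g : Fin 3 → ℚ}
    (ht : IsTwist s κ q M g) (X Z : ℝ) :
    cubForm M X Z ^ 2 = s * quadForm q X Z * quadForm g X Z ^ 2 + κ * sexticForm X Z := by
  have h : ∀ i, (cubSq M i - s * quadMul q (quadSq g) i : ℝ) = κ * ((sextic i : ℚ) : ℝ) :=
    fun i => by exact_mod_cast ht i
  have h0 := h 0
  have h1 := h 1
  have h2 := h 2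
  have h3 := h 3
  have h4 := h 4
  have h5 := h 5
  have h6 := h 6
  simp only [cubSq, quadMul, quadSq, sextic, Matrix.cons_val] at h0 h1 h2 h3 h4 h5 h6
  push_cast at h0 h1 h2 h3 h4 h5 h6
  simp only [cubForm, quadForm, sexticForm]
  linear_combination Z ^ 6 * h0 + X * Z ^ 5 * h1 + X ^ 2 * Z ^ 4 * h2 + X ^ 3 * Z ^ 3 * h3 +
    X ^ 4 * Z ^ 2 * h4 + X ^ 5 * Z * h5 + X ^ 6 * h6

lemma quadForm_eq_zero {q : Fin 3 → ℚ} {a b : ℝ} (hab : a < b)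
    (h : ∀ t ∈ Set.Ioo a b, quadForm q t 1 = 0) : q = 0 := by
  open Polynomial in
  have hp : (C (q 0 : ℝ) + C (q 1 : ℝ) * X + C (q 2 : ℝ) * X ^ 2 : ℝ[X]) = 0 := by
    apply Polynomial.eq_zero_of_infinite_isRoot
    refine (Set.Ioo_infinite hab).mono fun t ht => ?_
    have := h t ht
    simp only [quadForm, one_pow, mul_one] at this
    simpa [IsRoot] using this
  have c0 := congr_arg (fun p => Polynomial.coeff p 0) hp
  have c1 := congr_arg (fun p => Polynomial.coeff p 1) hp
  have c2 := congr_arg (fun p => Polynomial.coeff p 2) hp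
  simp [Polynomial.coeff_X, Polynomial.coeff_C, Polynomial.coeff_X_pow] at c0 c1 c2
  funext i
  fin_cases i <;> assumption

lemma cubForm_eq_zero {M : Fin 4 → ℚ} {a b : ℝ} (hab : a < b)
    (h : ∀ t ∈ Set.Ioo a b, cubForm M t 1 = 0) : M = 0 := by
  open Polynomial in
  have hp : (C (M 0 : ℝ) + C (M 1 : ℝ) * X + C (M 2 : ℝ) * X ^ 2 +
      C (M 3 : ℝ) * X ^ 3 : ℝ[X]) = 0 := by
    apply Polynomial.eq_zero_of_infinite_isRoot
    refine (Set.Ioo_infinite hab).mono fun t ht => ?_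
    have := h t ht
    simp only [cubForm, one_pow, mul_one] at this
    simpa [IsRoot] using this
  have c0 := congr_arg (fun p => Polynomial.coeff p 0) hp
  have c1 := congr_arg (fun p => Polynomial.coeff p 1) hp
  have c2 := congr_arg (fun p => Polynomial.coeff p 2) hp
  have c3 := congr_arg (fun p => Polynomial.coeff p 3) hp
  simp [Polynomial.coeff_X, Polynomial.coeff_C, Polynomial.coeff_X_pow] at c0 c1 c2 c3
  funext i
  fin_cases i <;> assumption

lemma IsTwist.ne_zero {s κ : ℚ} {q : Fin 3 → ℚ} {M : Fin 4 → ℚ} {g : Fin 3 → ℚ}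
    (ht : IsTwist s κ q M g) (hMg : M ≠ 0 ∨ g ≠ 0) {a b : ℝ} (hab : a < b)
    (hneg : ∀ t ∈ Set.Ioo a b, s * quadForm q t 1 < 0) : κ ≠ 0 := by
  rintro rfl
  have key : ∀ t ∈ Set.Ioo a b, quadForm g t 1 = 0 ∧ cubForm M t 1 = 0 := by
    intro t htt
    have h1 := ht.form_eq t 1
    have h2 := hneg t htt
    rw [Rat.cast_zero, zero_mul, add_zero] at h1
    have hg : quadForm g t 1 = 0 := by
      by_contra hg
      have h3 : 0 < quadForm g t 1 ^ 2 := by positivity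
      nlinarith [sq_nonneg (cubForm M t 1)]
    rw [hg] at h1
    exact ⟨hg, by simpa using h1⟩
  rcases hMg with h | h
  · exact h (cubForm_eq_zero hab fun t ht => (key t ht).2)
  · exact h (quadForm_eq_zero hab fun t ht => (key t ht).1)

end RealForms

lemma quadForm_eq {τ D : ℚ} {q : Fin 3 → ℚ}
    (h0 : q 0 = q 2 * (τ ^ 2 - D)) (h1 : q 1 = -2 * q 2 * τ) (X Z : ℝ) :
    quadForm q X Z = q 2 * ((X - τ * Z) ^ 2 - D * Z ^ 2) := by
  rw [quadForm, h0, h1]; push_cast; ring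

/-- If the two real roots of `q` are joined by a path on which `s q ≥ 0`, then the cubic of a twist
does not vanish on it. -/
lemma IsTwist.sign_eq {τ D : ℚ} (hD : 0 < D) {q : Fin 3 → ℚ}
    (h0 : q 0 = q 2 * (τ ^ 2 - D)) (h1 : q 1 = -2 * q 2 * τ) {s κ : ℚ} {N : Fin 4 → ℚ}
    {g : Fin 3 → ℚ} (ht : IsTwist s κ q N g) (hNg : N ≠ 0 ∨ g ≠ 0) {ε : ℚ} (hε : ε = 1 ∨ ε = -1)
    (hs : s * ε * q 2 < 0) : 0 < ε * (cubRem₀ τ D N ^ 2 - D * cubRem₁ τ D N ^ 2) := by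
  have hDR : (0 : ℝ) < D := by exact_mod_cast hD
  have hsR : (s : ℝ) * ε * q 2 < 0 := by exact_mod_cast hs
  set δ := √(D : ℝ) with hδ
  have hδ2 : δ ^ 2 = D := Real.sq_sqrt hDR.le
  have hδ0 : 0 < δ := Real.sqrt_pos.mpr hDR
  have hκ0 : κ ≠ 0 := by
    rcases hε with rfl | rfl
    · refine ht.ne_zero hNg (a := τ + δ) (b := τ + δ + 1) (by linarith) fun t htt => ?_
      rw [quadForm_eq h0 h1]
      have : (0 : ℝ) < (t - τ * 1) ^ 2 - D * 1 ^ 2 := by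
        rw [← hδ2]; nlinarith [htt.1]
      push_cast at hsR
      nlinarith
    · refine ht.ne_zero hNg (a := τ - δ) (b := τ + δ) (by linarith) fun t htt => ?_
      rw [quadForm_eq h0 h1]
      have : (0 : ℝ) < D * 1 ^ 2 - (t - τ * 1) ^ 2 := by
        rw [← hδ2]; nlinarith [htt.1, htt.2]
      push_cast at hsR
      nlinarith
  have hκ : (0 : ℝ) < κ := by
    have h2 := ht.form_eq (τ + δ) 1
    rw [quadForm_eq h0 h1, show (τ + δ - τ * 1 : ℝ) ^ 2 - D * 1 ^ 2 = 0 by rw [← hδ2]; ring] at h2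
    have h3 : 0 < sexticForm (τ + δ) 1 := sexticForm_pos (Or.inr one_ne_zero)
    have h4 : (κ : ℝ) ≠ 0 := by exact_mod_cast hκ0
    by_contra h5
    have h6 : (κ : ℝ) < 0 := lt_of_le_of_ne (not_lt.mp h5) h4
    nlinarith [sq_nonneg (cubForm N (τ + δ) 1)]
  have hεR : (ε : ℝ) ^ 2 = 1 := by rcases hε with rfl | rfl <;> norm_num
  let φ : ℝ → ℝ := fun x => cubForm N ((1 - x) * (τ + δ) + ε * x * (τ - δ)) ((1 - x) + ε * x)
  have hφc : ContinuousOn φ (Set.Icc 0 1) := by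
    apply Continuous.continuousOn
    simp only [φ, cubForm]
    fun_prop
  have hφ0 : ∀ x ∈ Set.Icc (0 : ℝ) 1, φ x ≠ 0 := by
    intro x hx h2
    have h3 := ht.form_eq ((1 - x) * (τ + δ) + ε * x * (τ - δ)) ((1 - x) + ε * x)
    have h4 : quadForm q ((1 - x) * (τ + δ) + ε * x * (τ - δ)) ((1 - x) + ε * x) =
        -(4 * ε * q 2 * D * (x * (1 - x))) := by
      rw [quadForm_eq h0 h1, ← hδ2]; ring
    have h5 : cubForm N ((1 - x) * (τ + δ) + ε * x * (τ - δ)) ((1 - x) + ε * x) = 0 := h2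
    have h6 : 0 < sexticForm ((1 - x) * (τ + δ) + ε * x * (τ - δ)) ((1 - x) + ε * x) := by
      apply sexticForm_pos
      by_contra hcon
      push Not at hcon
      have e1 : ε * x * δ = 0 := by linear_combination (τ + δ) / 2 * hcon.2 - hcon.1 / 2
      have hx0 : x = 0 := by
        have hε0 : (ε : ℝ) ≠ 0 := fun h => by rw [h] at hεR; norm_num at hεR
        rcases mul_eq_zero.mp e1 with h | h
        · exact (mul_eq_zero.mp h).resolve_left hε0
        · exact absurd h hδ0.ne'
      rw [hx0] at hcon
      norm_num at hcon
    have h7 : 0 ≤ x * (1 - x) := mul_nonneg hx.1 (by linarith [hx.2])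
    have h8 : 0 ≤ s * -(4 * ε * q 2 * D * (x * (1 - x))) := by
      have : s * -(4 * ε * q 2 * D * (x * (1 - x))) = 4 * (-(s * ε * q 2)) * D * (x * (1 - x)) := by
        ring
      rw [this]
      have : 0 ≤ -(s * ε * q 2 : ℝ) := by linarith
      positivity
    rw [h5, h4] at h3
    have h9 := mul_nonneg h8 (sq_nonneg
      (quadForm g ((1 - x) * (τ + δ) + ε * x * (τ - δ)) ((1 - x) + ε * x)))
    have h10 := mul_pos hκ h6
    nlinarith
  have hprod : 0 < φ 0 * φ 1 := by
    by_contra hcon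
    have hmem : (0 : ℝ) ∈ φ '' Set.uIcc 0 1 := by
      apply intermediate_value_uIcc (by rwa [Set.uIcc_of_le zero_le_one])
      rw [Set.mem_uIcc]
      rcases le_total (φ 0) 0 with h | h <;> rcases le_total (φ 1) 0 with h' | h'
      · have := mul_nonneg_of_nonpos_of_nonpos h h'
        rcases mul_eq_zero.mp (le_antisymm (not_lt.mp hcon) this) with h2 | h2
        · exact absurd h2 (hφ0 0 (by simp))
        · exact absurd h2 (hφ0 1 (by simp))
      · exact Or.inl ⟨h, h'⟩
      · exact Or.inr ⟨h', h⟩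
      · have := mul_nonneg h h'
        rcases mul_eq_zero.mp (le_antisymm (not_lt.mp hcon) this) with h2 | h2
        · exact absurd h2 (hφ0 0 (by simp))
        · exact absurd h2 (hφ0 1 (by simp))
    rw [Set.uIcc_of_le zero_le_one] at hmem
    obtain ⟨x, hx, hx0⟩ := hmem
    exact hφ0 x hx hx0
  have e0 : φ 0 = cubRem₀ τ D N + cubRem₁ τ D N * δ := by
    simp only [φ, cubForm, cubRem₀, cubRem₁]
    push_cast
    rw [← hδ2]; ring
  have e1 : φ 1 = ε * (cubRem₀ τ D N - cubRem₁ τ D N * δ) := by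
    simp only [φ, cubForm, cubRem₀, cubRem₁]
    push_cast
    rw [← hδ2]
    linear_combination ε * (N 0 + N 1 * (τ - δ) + N 2 * (τ - δ) ^ 2 + N 3 * (τ - δ) ^ 3) * hεR
  have : (0 : ℝ) < (ε * (cubRem₀ τ D N ^ 2 - D * cubRem₁ τ D N ^ 2) : ℚ) := by
    push_cast
    rw [← hδ2]
    rw [e0, e1] at hprod
    linarith [hprod]
  exact_mod_cast this

lemma exists_quadMul_eq_sextic {τ D : ℚ} {q : Fin 3 → ℚ} (hq : q 2 ≠ 0)
    (h0 : q 0 = q 2 * (τ ^ 2 - D)) (h1 : q 1 = -2 * q 2 * τ) (r0 : sexRem₀ τ D sextic = 0)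
    (r1 : sexRem₁ τ D sextic = 0) : ∃ w, quadMul q w = sextic := by
  simp only [sexRem₀, sexRem₁, sextic, Matrix.cons_val] at r0 r1
  obtain ⟨w4, h4⟩ : ∃ x, q 2 * x = 1 := ⟨1 / q 2, by field_simp⟩
  obtain ⟨w3, h3⟩ : ∃ x, q 2 * x = 2 + 2 * τ := ⟨_ / q 2, mul_div_cancel₀ _ hq⟩
  obtain ⟨w2, h2⟩ : ∃ x, q 2 * x = 1 + 2 * τ * (2 + 2 * τ) - (τ ^ 2 - D) :=
    ⟨_ / q 2, mul_div_cancel₀ _ hq⟩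
  obtain ⟨w1, h1'⟩ : ∃ x, q 2 * x = 2 + 2 * τ * (q 2 * w2) - (τ ^ 2 - D) * (q 2 * w3) :=
    ⟨_ / q 2, mul_div_cancel₀ _ hq⟩
  obtain ⟨w0, h0'⟩ : ∃ x, q 2 * x = 6 + 2 * τ * (q 2 * w1) - (τ ^ 2 - D) * (q 2 * w2) :=
    ⟨_ / q 2, mul_div_cancel₀ _ hq⟩
  refine ⟨![w0, w1, w2, w3, w4], ?_⟩
  rw [h2, h3] at h1'
  rw [h1', h2] at h0'
  have e : ∀ a b : ℚ, q 2 * (a * b) = a * (q 2 * b) := fun a b => by ring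
  have e0 : ∀ b, q 0 * b = (τ ^ 2 - D) * (q 2 * b) := fun b => by rw [h0]; ring
  have e1 : ∀ b, q 1 * b = -2 * τ * (q 2 * b) := fun b => by rw [h1]; ring
  funext i
  fin_cases i <;> simp only [quadMul, sextic, Fin.zero_eta, Fin.mk_one, Fin.reduceFinMk,
    Matrix.cons_val, e0, e1, h0', h1', h2, h3, h4]
  · linear_combination -r0 + τ * r1
  · linear_combination -r1
  all_goals ring

lemma hasHalfStep_of_twists {q : Fin 3 → ℚ} (hq : q 2 ≠ 0) {M : Fin 4 → ℚ} {h : Fin 5 → ℚ}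
    (hs : IsState q M h) (hF : ∀ w : Fin 5 → ℚ, quadMul q w ≠ sextic)
    (ht : ∀ s : ℚ, s = 1 ∨ s = -1 → ∃ N g κ, (N ≠ 0 ∨ g ≠ 0) ∧ IsTwist s κ q N g) :
    HasHalfStep q M := by
  obtain ⟨τ, hτ⟩ : ∃ τ : ℚ, q 1 = -2 * q 2 * τ := ⟨-q 1 / (2 * q 2), by field_simp⟩
  obtain ⟨D, hD⟩ : ∃ D : ℚ, q 0 = q 2 * (τ ^ 2 - D) := ⟨τ ^ 2 - q 0 / q 2, by field_simp; ring⟩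
  obtain ⟨a1, a2⟩ := sexRem₀_of_isState hD hτ hs
  rcases lt_trichotomy 0 D with hpos | hzero | hneg
  · have hpR : (0 : ℝ) < D := by exact_mod_cast hpos
    set δ := √(D : ℝ) with hδ
    have hδ2 : δ ^ 2 = D := Real.sq_sqrt hpR.le
    have hn : cubRem₀ τ D M ^ 2 - D * cubRem₁ τ D M ^ 2 ≠ 0 := by
      intro h0
      have e1 : sexticForm (τ + δ) 1 * sexticForm (τ - δ) 1 =
          ((sexRem₀ τ D sextic ^ 2 - D * sexRem₁ τ D sextic ^ 2 : ℚ) : ℝ) := by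
        simp only [sexticForm, sexRem₀, sexRem₁, sextic, Matrix.cons_val]
        push_cast
        rw [← hδ2]
        ring
      rw [← a1, ← a2, show (cubRem₀ τ D M ^ 2 + D * cubRem₁ τ D M ^ 2) ^ 2 -
        D * (2 * cubRem₀ τ D M * cubRem₁ τ D M) ^ 2 = 0 by
          linear_combination (cubRem₀ τ D M ^ 2 - D * cubRem₁ τ D M ^ 2) * h0] at e1
      have := mul_pos (sexticForm_pos (X := τ + δ) (Z := 1) (Or.inr one_ne_zero))
        (sexticForm_pos (X := τ - δ) (Z := 1) (Or.inr one_ne_zero))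
      rw [e1] at this
      simp at this
    obtain ⟨ε, hε, hεn⟩ : ∃ ε : ℚ, (ε = 1 ∨ ε = -1) ∧
        0 < ε * (cubRem₀ τ D M ^ 2 - D * cubRem₁ τ D M ^ 2) := by
      rcases lt_or_gt_of_ne hn with h | h
      · exact ⟨-1, Or.inr rfl, by linarith⟩
      · exact ⟨1, Or.inl rfl, by linarith⟩
    obtain ⟨s, hs1, hsq⟩ : ∃ s : ℚ, (s = 1 ∨ s = -1) ∧ s * ε * q 2 < 0 := by
      have : ε * q 2 ≠ 0 := mul_ne_zero (by rcases hε with rfl | rfl <;> norm_num) hq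
      rcases lt_or_gt_of_ne this with h | h
      · exact ⟨1, Or.inl rfl, by linarith⟩
      · exact ⟨-1, Or.inr rfl, by linarith⟩
    obtain ⟨N, g, κ, hNg, htw⟩ := ht s hs1
    have hsign := htw.sign_eq hpos hD hτ hNg hε hsq
    refine hasHalfStep_of_isTwist hq hD hτ hs (by rcases hs1 with rfl | rfl <;> norm_num) htw hn ?_
    intro h0
    have hε2 : ε * ε = 1 := by rcases hε with rfl | rfl <;> norm_num
    have h1 := mul_pos hεn hsign
    have h2 : ε * (cubRem₀ τ D M ^ 2 - D * cubRem₁ τ D M ^ 2) *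
        (ε * (cubRem₀ τ D N ^ 2 - D * cubRem₁ τ D N ^ 2)) =
        -(D * (cubRem₁ τ D N * cubRem₀ τ D M - cubRem₀ τ D N * cubRem₁ τ D M) ^ 2) := by
      linear_combination (cubRem₀ τ D M ^ 2 - D * cubRem₁ τ D M ^ 2) *
        (cubRem₀ τ D N ^ 2 - D * cubRem₁ τ D N ^ 2) * hε2 +
        (cubRem₀ τ D N * cubRem₀ τ D M - D * (cubRem₁ τ D N * cubRem₁ τ D M)) * h0
    rw [h2] at h1
    have : 0 ≤ D * (cubRem₁ τ D N * cubRem₀ τ D M - cubRem₀ τ D N * cubRem₁ τ D M) ^ 2 := by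
      positivity
    linarith
  all_goals
    obtain ⟨s, hs1, hsq⟩ : ∃ s : ℚ, (s = 1 ∨ s = -1) ∧ s * q 2 < 0 := by
      rcases lt_or_gt_of_ne hq with h | h
      · exact ⟨1, Or.inl rfl, by linarith⟩
      · exact ⟨-1, Or.inr rfl, by linarith⟩
    obtain ⟨N, g, κ, hNg, htw⟩ := ht s hs1
    have hs0 : s ≠ 0 := by rcases hs1 with rfl | rfl <;> norm_num
    have hsqR : (s : ℝ) * q 2 < 0 := by exact_mod_cast hsq
    have hDR : (D : ℝ) ≤ 0 := by exact_mod_cast (by linarith : D ≤ 0)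
    have hκ0 : κ ≠ 0 := by
      refine htw.ne_zero hNg (a := τ) (b := τ + 1) (by linarith) fun t htt => ?_
      rw [quadForm_eq hD hτ]
      have : (0 : ℝ) < (t - τ * 1) ^ 2 - D * 1 ^ 2 := by nlinarith [htt.1]
      nlinarith
    have hκ : 0 < κ := by
      have h2 := htw.form_eq τ 1
      rw [quadForm_eq hD hτ, show (τ - τ * 1 : ℝ) ^ 2 - D * 1 ^ 2 = -D by ring] at h2
      have h3 : 0 < sexticForm τ 1 := sexticForm_pos (Or.inr one_ne_zero)
      have h7 : (0 : ℝ) ≤ -(s * (q 2 * -D) * quadForm g τ 1 ^ 2) := by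
        have : -(s * (q 2 * -D) * quadForm g τ 1 ^ 2) =
          (-(s * q 2)) * (-D) * quadForm g τ 1 ^ 2 := by ring
        rw [this]
        have h8 : (0 : ℝ) ≤ -(s * q 2) := by linarith
        have h9 : (0 : ℝ) ≤ -D := by linarith
        positivity
      by_contra h5
      have h6 : (κ : ℝ) < 0 := by exact_mod_cast lt_of_le_of_ne (not_lt.mp h5) hκ0
      nlinarith [sq_nonneg (cubForm N τ 1)]
    obtain ⟨b1, b2⟩ := sexRem₀_of_isTwist hD hτ htw
    rw [← a1] at b1
    rw [← a2] at b2
  · subst hzero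
    have hn : cubRem₀ τ 0 M ^ 2 - 0 * cubRem₁ τ 0 M ^ 2 ≠ 0 := by
      intro h0
      have e1 : ((sexRem₀ τ 0 sextic : ℚ) : ℝ) = sexticForm τ 1 := by
        simp only [sexticForm, sexRem₀, sextic, Matrix.cons_val]
        push_cast
        ring
      rw [← a1, show cubRem₀ τ 0 M ^ 2 + 0 * cubRem₁ τ 0 M ^ 2 = 0 by linear_combination h0] at e1
      have := sexticForm_pos (X := τ) (Z := 1) (Or.inr one_ne_zero)
      rw [← e1] at this
      simp at this
    refine hasHalfStep_of_isTwist hq hD hτ hs hs0 htw hn ?_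
    intro h0
    rw [zero_mul, sub_zero] at h0 hn
    have : κ * (cubRem₀ τ 0 M ^ 2) ^ 2 = 0 := by
      linear_combination cubRem₀ τ 0 N * cubRem₀ τ 0 M * h0 - cubRem₀ τ 0 M ^ 2 * b1
    exact mul_ne_zero hκ0 (pow_ne_zero 2 hn) this
  · have hpos : 0 ≤ cubRem₀ τ D M ^ 2 - D * cubRem₁ τ D M ^ 2 := by
      have : 0 ≤ -D * cubRem₁ τ D M ^ 2 := mul_nonneg (by linarith) (sq_nonneg _)
      nlinarith [sq_nonneg (cubRem₀ τ D M)]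
    have hn : cubRem₀ τ D M ^ 2 - D * cubRem₁ τ D M ^ 2 ≠ 0 := by
      intro h0
      have h1 : cubRem₁ τ D M = 0 := by
        by_contra h1
        have : 0 < -D * cubRem₁ τ D M ^ 2 := mul_pos (by linarith) (by positivity)
        nlinarith [sq_nonneg (cubRem₀ τ D M)]
      have h2 : cubRem₀ τ D M = 0 := by
        rw [h1] at h0
        have : cubRem₀ τ D M ^ 2 = 0 := by linear_combination h0
        exact pow_eq_zero_iff two_ne_zero |>.mp this
      rw [h1, h2] at a1 a2
      obtain ⟨w, hw⟩ := exists_quadMul_eq_sextic hq hD hτ (by rw [← a1]; ring) (by rw [← a2]; ring)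
      exact hF w hw
    refine hasHalfStep_of_isTwist hq hD hτ hs hs0 htw hn ?_
    intro h0
    have e : κ * (cubRem₀ τ D M ^ 2 - D * cubRem₁ τ D M ^ 2) ^ 2 =
        D * (cubRem₁ τ D N * cubRem₀ τ D M - cubRem₀ τ D N * cubRem₁ τ D M) ^ 2 := by
      linear_combination
        (cubRem₀ τ D N * cubRem₀ τ D M - D * (cubRem₁ τ D N * cubRem₁ τ D M)) * h0 -
        (cubRem₀ τ D M ^ 2 + D * cubRem₁ τ D M ^ 2) * b1 +
        D * 2 * cubRem₀ τ D M * cubRem₁ τ D M * b2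
    have h1 : 0 < κ * (cubRem₀ τ D M ^ 2 - D * cubRem₁ τ D M ^ 2) ^ 2 := by positivity
    have h2 : D * (cubRem₁ τ D N * cubRem₀ τ D M - cubRem₀ τ D N * cubRem₁ τ D M) ^ 2 ≤ 0 :=
      mul_nonpos_of_nonpos_of_nonneg hneg.le (sq_nonneg _)
    linarith

/-- The action of `t ↦ -(t + 1) / t` on cubics. -/
def rotCub (M : Fin 4 → ℚ) : Fin 4 → ℚ :=
  ![M 0 - M 1 + M 2 - M 3, 3 * M 0 - 2 * M 1 + M 2, 3 * M 0 - M 1, M 0]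

/-- The action of `t ↦ -(t + 1) / t` on quartics. -/
def rotQuart (h : Fin 5 → ℚ) : Fin 5 → ℚ :=
  ![h 0 - h 1 + h 2 - h 3 + h 4, 4 * h 0 - 3 * h 1 + 2 * h 2 - h 3, 6 * h 0 - 3 * h 1 + h 2,
      4 * h 0 - h 1, h 0]

lemma IsState.rot {q : Fin 3 → ℚ} {M : Fin 4 → ℚ} {h : Fin 5 → ℚ} (hs : IsState q M h) :
    IsState (rotQuad q) (rotCub M) (rotQuart h) := by
  obtain ⟨h0, h1, h2, h3, h4, h5, h6⟩ := isState_iff.mp hs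
  rw [isState_iff]
  simp only [rotQuad, rotCub, rotQuart, Matrix.cons_val]
  refine ⟨?_, ?_, ?_, ?_, ?_, ?_, ?_⟩
  · linear_combination h0 - h1 + h2 - h3 + h4 - h5 + h6
  · linear_combination 6 * h0 - 5 * h1 + 4 * h2 - 3 * h3 + 2 * h4 - h5
  · linear_combination 15 * h0 - 10 * h1 + 6 * h2 - 3 * h3 + h4
  · linear_combination 20 * h0 - 10 * h1 + 4 * h2 - h3
  · linear_combination 15 * h0 - 5 * h1 + h2
  · linear_combination 6 * h0 - h1
  · linear_combination h0

lemma rotQuart_quadSq (g : Fin 3 → ℚ) : rotQuart (quadSq g) = quadSq (rotQuad g) := by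
  funext i
  fin_cases i <;> simp [rotQuart, quadSq, rotQuad] <;> ring

lemma rotQuad_rotQuad_rotQuad (q : Fin 3 → ℚ) : rotQuad (rotQuad (rotQuad q)) = q := by
  funext i
  fin_cases i <;> simp [rotQuad] <;> ring

lemma rotCub_rotCub_rotCub (M : Fin 4 → ℚ) : rotCub (rotCub (rotCub M)) = -M := by
  funext i
  fin_cases i <;> simp [rotCub] <;> ring

lemma HasHalfStep.rot {q : Fin 3 → ℚ} {M : Fin 4 → ℚ} (H : HasHalfStep q M) :
    HasHalfStep (rotQuad q) (rotCub M) := by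
  obtain ⟨l, M', g, s, hl, hs, hM⟩ := H
  refine ⟨l, rotCub M', rotQuad g, ![s 0 - s 1, s 0], hl, ?_, fun i => ?_⟩
  · have := hs.rot
    rw [rotQuart_quadSq] at this
    convert this using 1
    funext i
    fin_cases i <;> simp [rotQuad] <;> ring
  · fin_cases i <;> simp [rotCub, rotQuad, quadLin, hM] <;> ring

lemma HasHalfStep.neg {q : Fin 3 → ℚ} {M : Fin 4 → ℚ} (H : HasHalfStep q M) :
    HasHalfStep q (-M) := by
  obtain ⟨l, M', g, s, hl, hs, hM⟩ := H
  refine ⟨l, -M', g, -s, hl, ?_, fun i => ?_⟩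
  · rw [isState_iff] at hs ⊢
    simpa using hs
  · rw [Pi.neg_apply, hM]
    fin_cases i <;> simp [quadLin] <;> ring

lemma HasHalfStep.of_smul {q : Fin 3 → ℚ} {M : Fin 4 → ℚ} {c : ℚ} (hc : c ≠ 0)
    (H : HasHalfStep (fun i => c * q i) M) : HasHalfStep q M := by
  obtain ⟨l, M', g, s, hl, hs, hM⟩ := H
  refine ⟨l * c, M', g, fun i => c * s i, mul_ne_zero hl hc, ?_, fun i => ?_⟩
  · convert hs using 1
    funext i
    ring
  · rw [hM]
    fin_cases i <;> simp [quadLin] <;> ring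

lemma IsState.smul {q : Fin 3 → ℚ} {M : Fin 4 → ℚ} {h : Fin 5 → ℚ} (hs : IsState q M h) {c : ℚ}
    (hc : c ≠ 0) : IsState (fun i => c * q i) M (fun i => c⁻¹ * h i) := by
  rw [IsState, quadMul_smul_left, quadMul_smul_right]
  rw [IsState] at hs
  rw [hs]
  funext i
  field_simp

lemma halfStep_of_forall (H : ∀ (q : Fin 3 → ℚ) M h, q 2 ≠ 0 → IsState q M h → HasHalfStep q M) :
    HalfStep := by
  intro q M h hq hs
  change HasHalfStep q M
  have back (H' : HasHalfStep (rotQuad (rotQuad (rotQuad q))) (rotCub (rotCub (rotCub M)))) :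
      HasHalfStep q M := by
    rw [rotQuad_rotQuad_rotQuad, rotCub_rotCub_rotCub] at H'
    simpa using H'.neg
  by_cases h2 : q 2 = 0
  · by_cases h0 : q 0 = 0
    · refine back (H _ _ _ ?_ hs.rot.rot).rot
      simp only [rotQuad, Matrix.cons_val, h0, h2]
      intro h1
      refine hq (funext fun i => ?_)
      fin_cases i
      · exact h0
      · simpa using h1
      · exact h2
    · exact back (H _ _ _ (by simpa [rotQuad] using h0) hs.rot).rot.rot
  · exact H q M h h2 hs

section SexticPoly

open Polynomial

/-- The monic polynomial `X⁶ + 2X⁵ + X⁴ + 2X³ + 6X² + 4X + 1`. -/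
noncomputable def sexticPoly (A : Type*) [CommRing A] : A[X] :=
  X ^ 6 + C 2 * X ^ 5 + X ^ 4 + C 2 * X ^ 3 + C 6 * X ^ 2 + C 4 * X + 1

lemma natDegree_sexticPoly (A : Type*) [CommRing A] [Nontrivial A] :
    (sexticPoly A).natDegree = 6 := by
  unfold sexticPoly
  compute_degree!

lemma monic_sexticPoly (A : Type*) [CommRing A] : (sexticPoly A).Monic := by
  unfold sexticPoly
  monicity!

lemma map_sexticPoly {A B : Type*} [CommRing A] [CommRing B] (f : A →+* B) :
    (sexticPoly A).map f = sexticPoly B := by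
  simp [sexticPoly, map_ofNat]

lemma eval₂_sexticPoly {A B : Type*} [CommRing A] [CommRing B] (f : A →+* B) (x : B) :
    (sexticPoly A).eval₂ f x = x ^ 6 + 2 * x ^ 5 + x ^ 4 + 2 * x ^ 3 + 6 * x ^ 2 + 4 * x + 1 := by
  simp [sexticPoly, eval₂_add, eval₂_mul, map_ofNat]

lemma zmod_three_no_factor_one : ∀ a b0 b1 b2 b3 b4 : ZMod 3, ¬ (b0 * a = 1 ∧ b1 * a + b0 = 1 ∧
    b2 * a + b1 = 0 ∧ b3 * a + b2 = 2 ∧ b4 * a + b3 = 1 ∧ a + b4 = 2) := by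
  decide +kernel

lemma zmod_three_no_factor_two : ∀ a0 a1 b0 b1 b2 b3 : ZMod 3, ¬ (b0 * a0 = 1 ∧
    b1 * a0 + b0 * a1 = 1 ∧ b2 * a0 + b1 * a1 + b0 = 0 ∧ b3 * a0 + b2 * a1 + b1 = 2 ∧
    a0 + b3 * a1 + b2 = 1 ∧ a1 + b3 = 2) := by
  decide +kernel

lemma zmod_three_no_factor_three : ∀ a0 a1 a2 b0 b1 b2 : ZMod 3, ¬ (b0 * a0 = 1 ∧
    b1 * a0 + b0 * a1 = 1 ∧ b2 * a0 + b1 * a1 + b0 * a2 = 0 ∧ a0 + b2 * a1 + b1 * a2 + b0 = 2 ∧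
    a1 + b2 * a2 + b1 = 1 ∧ a2 + b2 = 2) := by
  decide +kernel

lemma irreducible_sexticPoly_zmod : Irreducible (sexticPoly (ZMod 3)) := by
  have e4 : (4 : ZMod 3) = 1 := by decide
  have e6 : (6 : ZMod 3) = 0 := by decide
  have : Fact (Nat.Prime 3) := ⟨Nat.prime_three⟩
  rw [(monic_sexticPoly _).irreducible_iff_natDegree']
  refine ⟨fun h => by simpa [h] using natDegree_sexticPoly (ZMod 3), ?_⟩
  intro f g hf hg hfg hd
  rw [natDegree_sexticPoly, Finset.mem_Ioc] at hd
  have hdeg : f.natDegree + g.natDegree = 6 := by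
    rw [← hf.natDegree_mul hg, hfg, natDegree_sexticPoly]
  have hc (i : ℕ) := congrArg (fun p => p.coeff i) hfg
  have h0 := hc 0
  have h1 := hc 1
  have h2 := hc 2
  have h3 := hc 3
  have h4 := hc 4
  have h5 := hc 5
  have fz (i : ℕ) (hi : f.natDegree < i) : f.coeff i = 0 := coeff_eq_zero_of_natDegree_lt hi
  have gz (i : ℕ) (hi : g.natDegree < i) : g.coeff i = 0 := coeff_eq_zero_of_natDegree_lt hi
  have f1 : f.coeff f.natDegree = 1 := hf
  have g1 : g.coeff g.natDegree = 1 := hg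
  simp [coeff_mul, Finset.Nat.antidiagonal_succ, sexticPoly, coeff_X, coeff_one, coeff_X_pow,
    coeff_C] at h0 h1 h2 h3 h4 h5
  obtain hd | hd | hd : g.natDegree = 1 ∨ g.natDegree = 2 ∨ g.natDegree = 3 := by omega
  · have hf5 : f.natDegree = 5 := by omega
    rw [hd] at g1 gz
    rw [hf5] at f1
    simp only [g1, f1, gz 2, gz 3, gz 4, gz 5, Nat.reduceLT] at h0 h1 h2 h3 h4 h5
    refine zmod_three_no_factor_one (g.coeff 0) (f.coeff 0) (f.coeff 1) (f.coeff 2) (f.coeff 3)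
      (f.coeff 4) ⟨?_, ?_, ?_, ?_, ?_, ?_⟩
    · linear_combination h0
    · linear_combination h1 + e4
    · linear_combination h2 + e6
    · linear_combination h3
    · linear_combination h4
    · linear_combination h5
  · have hf5 : f.natDegree = 4 := by omega
    rw [hd] at g1 gz
    rw [hf5] at f1 fz
    simp only [g1, f1, gz 3, gz 4, gz 5, fz 5, Nat.reduceLT] at h0 h1 h2 h3 h4 h5
    refine zmod_three_no_factor_two (g.coeff 0) (g.coeff 1) (f.coeff 0) (f.coeff 1) (f.coeff 2)
      (f.coeff 3) ⟨?_, ?_, ?_, ?_, ?_, ?_⟩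
    · linear_combination h0
    · linear_combination h1 + e4
    · linear_combination h2 + e6
    · linear_combination h3
    · linear_combination h4
    · linear_combination h5
  · have hf5 : f.natDegree = 3 := by omega
    rw [hd] at g1 gz
    rw [hf5] at f1 fz
    simp only [g1, f1, gz 4, gz 5, fz 4, fz 5, Nat.reduceLT] at h0 h1 h2 h3 h4 h5
    refine zmod_three_no_factor_three (g.coeff 0) (g.coeff 1) (g.coeff 2) (f.coeff 0) (f.coeff 1)
      (f.coeff 2) ⟨?_, ?_, ?_, ?_, ?_, ?_⟩
    · linear_combination h0
    · linear_combination h1 + e4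
    · linear_combination h2 + e6
    · linear_combination h3
    · linear_combination h4
    · linear_combination h5

lemma irreducible_sexticPoly : Irreducible (sexticPoly ℚ) := by
  have h : Irreducible (sexticPoly ℤ) := by
    refine (monic_sexticPoly ℤ).irreducible_of_irreducible_map (Int.castRingHom (ZMod 3)) _ ?_
    rw [map_sexticPoly]
    exact irreducible_sexticPoly_zmod
  rw [← map_sexticPoly (algebraMap ℤ ℚ)]
  exact ((monic_sexticPoly ℤ).irreducible_iff_irreducible_map_fraction_map).mp h

/-- A field generated over `ℚ` by a root `θ` of the sextic, with the square root `I` of `-1` in it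
for which `X³ + X² - 2X - 1 - 2I(X² + X)` vanishes at `θ`. -/
structure IsSexticField (L : Type*) [Field L] [NumberField L] (θ I : L) : Prop where
  finrank : Module.finrank ℚ L = 6
  sq : I ^ 2 = -1
  cube : θ ^ 3 = (-1 + 2 * I) * θ ^ 2 + (2 + 2 * I) * θ + 1
  indep : LinearIndependent ℚ fun i : Fin 6 => θ ^ (i : ℕ)

lemma exists_isSexticField :
    ∃ (L : Type) (_ : Field L) (_ : NumberField L) (θ I : L), IsSexticField L θ I := by
  have : Fact (Irreducible (sexticPoly ℚ)) := ⟨irreducible_sexticPoly⟩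
  let pb := AdjoinRoot.powerBasis (irreducible_sexticPoly.ne_zero)
  have hdim : pb.dim = 6 := natDegree_sexticPoly ℚ
  have : FiniteDimensional ℚ (AdjoinRoot (sexticPoly ℚ)) := pb.finite
  have hnf : NumberField (AdjoinRoot (sexticPoly ℚ)) := ⟨⟩
  set θ := AdjoinRoot.root (sexticPoly ℚ) with hθ
  have hroot : θ ^ 6 + 2 * θ ^ 5 + θ ^ 4 + 2 * θ ^ 3 + 6 * θ ^ 2 + 4 * θ + 1 = 0 := by
    rw [← eval₂_sexticPoly (AdjoinRoot.of _), AdjoinRoot.eval₂_root]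
  have hind : LinearIndependent ℚ fun i : Fin 6 => θ ^ (i : ℕ) := by
    have h := pb.basis.linearIndependent
    rw [pb.coe_basis] at h
    exact h.comp (Fin.cast hdim.symm) (Fin.cast_injective _)
  have h0 : θ * (θ + 1) ≠ 0 := by
    intro h
    have := Fintype.linearIndependent_iff.mp hind ![0, 1, 1, 0, 0, 0]
      (by simp [Fin.sum_univ_succ]; linear_combination h) 1
    simp at this
  have h2 : 2 * (θ * (θ + 1)) ≠ 0 := mul_ne_zero two_ne_zero h0
  obtain ⟨I, hI⟩ : ∃ I, 2 * (θ * (θ + 1)) * I = θ ^ 3 + θ ^ 2 - 2 * θ - 1 :=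
    ⟨_ / _, mul_div_cancel₀ _ h2⟩
  refine ⟨_, inferInstance, hnf, θ, I, ?_, ?_, ?_, hind⟩
  · rw [pb.finrank, hdim]
  · refine mul_left_cancel₀ (pow_ne_zero 2 h2) ?_
    linear_combination hroot + (2 * (θ * (θ + 1)) * I + θ ^ 3 + θ ^ 2 - 2 * θ - 1) * hI
  · linear_combination -hI

end SexticPoly

namespace IsSexticField

variable {L : Type*} [Field L] [NumberField L] {θ I : L}

lemma root (hL : IsSexticField L θ I) :
    θ ^ 6 + 2 * θ ^ 5 + θ ^ 4 + 2 * θ ^ 3 + 6 * θ ^ 2 + 4 * θ + 1 = 0 := by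
  linear_combination (θ ^ 3 + θ ^ 2 - 2 * θ - 1 + 2 * I * (θ ^ 2 + θ)) * hL.cube +
    4 * (θ ^ 2 + θ) ^ 2 * hL.sq

lemma coeff_eq_zero (hL : IsSexticField L θ I) {a : Fin 6 → ℚ}
    (h : (a 0 : L) + a 1 * θ + a 2 * θ ^ 2 + a 3 * θ ^ 3 + a 4 * θ ^ 4 + a 5 * θ ^ 5 = 0) :
    a = 0 := by
  funext i
  refine Fintype.linearIndependent_iff.mp hL.indep a ?_ i
  simp only [Fin.sum_univ_succ, Algebra.smul_def, eq_ratCast, Finset.univ_eq_empty,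
    Finset.sum_empty]
  simp [Fin.succ]
  linear_combination h

lemma coeff_eq_mul_sextic (hL : IsSexticField L θ I) {a : Fin 7 → ℚ}
    (h : (a 0 : L) + a 1 * θ + a 2 * θ ^ 2 + a 3 * θ ^ 3 + a 4 * θ ^ 4 + a 5 * θ ^ 5 +
      a 6 * θ ^ 6 = 0) (i : Fin 7) : a i = a 6 * sextic i := by
  have := hL.coeff_eq_zero (a := ![a 0 - a 6, a 1 - 4 * a 6, a 2 - 6 * a 6, a 3 - 2 * a 6,
    a 4 - a 6, a 5 - 2 * a 6]) (by simp; linear_combination h - a 6 * hL.root)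
  simp [funext_iff, Fin.forall_fin_succ] at this
  fin_cases i <;> simp [sextic] <;> linarith

lemma quadMul_ne_sextic (hL : IsSexticField L θ I) (q : Fin 3 → ℚ) (w : Fin 5 → ℚ) :
    quadMul q w ≠ sextic := by
  intro h
  have h' := congrFun h
  have e0 := h' 0
  have e1 := h' 1
  have e2 := h' 2
  have e3 := h' 3
  have e4 := h' 4
  have e5 := h' 5
  have e6 := h' 6
  simp only [quadMul, sextic, Matrix.cons_val] at e0 e1 e2 e3 e4 e5 e6
  have key : ((q 0 : L) + q 1 * θ + q 2 * θ ^ 2) *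
      (w 0 + w 1 * θ + w 2 * θ ^ 2 + w 3 * θ ^ 3 + w 4 * θ ^ 4) = 0 := by
    have f0 := congrArg (Rat.cast : ℚ → L) e0
    have f1 := congrArg (Rat.cast : ℚ → L) e1
    have f2 := congrArg (Rat.cast : ℚ → L) e2
    have f3 := congrArg (Rat.cast : ℚ → L) e3
    have f4 := congrArg (Rat.cast : ℚ → L) e4
    have f5 := congrArg (Rat.cast : ℚ → L) e5
    have f6 := congrArg (Rat.cast : ℚ → L) e6
    push_cast at f0 f1 f2 f3 f4 f5 f6
    linear_combination f0 + θ * f1 + θ ^ 2 * f2 + θ ^ 3 * f3 + θ ^ 4 * f4 + θ ^ 5 * f5 +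
      θ ^ 6 * f6 + hL.root
  rcases mul_eq_zero.mp key with h0 | h0
  · have := hL.coeff_eq_zero (a := ![q 0, q 1, q 2, 0, 0, 0]) (by simpa using h0)
    simp [funext_iff, Fin.forall_fin_succ] at this
    simp [this] at e0
  · have := hL.coeff_eq_zero (a := ![w 0, w 1, w 2, w 3, w 4, 0]) (by simpa using h0)
    simp [funext_iff, Fin.forall_fin_succ] at this
    simp [this] at e0

lemma exists_isTwist (hL : IsSexticField L θ I) {q : Fin 3 → ℚ} {s : ℚ} {z : L}
    (hz : (s : L) * (q 0 + q 1 * θ + q 2 * θ ^ 2) = z ^ 2) :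
    ∃ N g κ, (N ≠ 0 ∨ g ≠ 0) ∧ IsTwist s κ q N g := by
  let b : Fin 7 → L := ![1, θ, θ ^ 2, θ ^ 3, -z, -z * θ, -z * θ ^ 2]
  obtain ⟨v, hv, hv0⟩ := (Submodule.ne_bot_iff _).mp <|
    LinearMap.ker_ne_bot_of_finrank_lt (f := Fintype.linearCombination ℚ b) (by
      rw [hL.finrank]; simp)
  rw [LinearMap.mem_ker, Fintype.linearCombination_apply] at hv
  simp [Fin.sum_univ_succ, b, Algebra.smul_def, Fin.succ] at hv
  refine ⟨![v 0, v 1, v 2, v 3], ![v 4, v 5, v 6], _, ?_, hL.coeff_eq_mul_sextic ?_⟩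
  · by_contra hcon
    push Not at hcon
    simp [funext_iff, Fin.forall_fin_succ] at hcon
    refine hv0 (funext fun i => ?_)
    fin_cases i <;> simp [hcon]
  · simp [cubSq, quadMul, quadSq]
    linear_combination (v 0 + v 1 * θ + v 2 * θ ^ 2 + v 3 * θ ^ 3 +
      z * (v 4 + v 5 * θ + v 6 * θ ^ 2) : L) * hv - (v 4 + v 5 * θ + v 6 * θ ^ 2 : L) ^ 2 * hz

lemma halfStep (hL : IsSexticField L θ I)
    (H : ∀ (q : Fin 3 → ℚ) M h, q ≠ 0 → IsState q M h → ∃ (c : ℚ) (z : L), c ≠ 0 ∧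
      (c : L) * (q 0 + q 1 * θ + q 2 * θ ^ 2) = z ^ 2) : HalfStep := by
  refine halfStep_of_forall fun q M h hq hs => ?_
  obtain ⟨c, z, hc, hz⟩ := H q M h (fun h0 => hq (by simp [h0])) hs
  refine HasHalfStep.of_smul hc (hasHalfStep_of_twists (mul_ne_zero hc hq) (hs.smul hc)
    (hL.quadMul_ne_sextic _) ?_)
  rintro s (rfl | rfl)
  · exact hL.exists_isTwist (z := z) (by push_cast; linear_combination hz)
  · exact hL.exists_isTwist (z := I * z) (by
      push_cast
      linear_combination -hz - z ^ 2 * hL.sq)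

end IsSexticField

open Matrix in
/-- Multiplication by `θ` on `1, θ, θ², I, Iθ, Iθ²`. -/
def thetaMatrix : Matrix (Fin 6) (Fin 6) ℤ :=
  !![0, 0, 1, 0, 0, 0; 1, 0, 2, 0, 0, -2; 0, 1, -1, 0, 0, -2;
     0, 0, 0, 0, 0, 1; 0, 0, 2, 1, 0, 2; 0, 0, 2, 0, 1, -1]

open Matrix in
/-- Multiplication by `I` on `1, θ, θ², I, Iθ, Iθ²`. -/
def imMatrix : Matrix (Fin 6) (Fin 6) ℤ :=
  !![0, 0, 0, -1, 0, 0; 0, 0, 0, 0, -1, 0; 0, 0, 0, 0, 0, -1;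
     1, 0, 0, 0, 0, 0; 0, 1, 0, 0, 0, 0; 0, 0, 1, 0, 0, 0]

/-- Exponents of `I` and `θ` in `1, θ, θ², I, Iθ, Iθ²`. -/
def basisExp : Fin 6 → ℕ × ℕ := ![(0, 0), (0, 1), (0, 2), (1, 0), (1, 1), (1, 2)]

/-- The trace form on `1, θ, θ², I, Iθ, Iθ²`. -/
def traceFormMatrix : Matrix (Fin 6) (Fin 6) ℤ :=
  !![6, -2, 2, 0, -4, 0; -2, 2, -8, -4, 0, -8; 2, -8, -6, 0, -8, 16; 0, -4, 0, -6, 2, -2;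
    -4, 0, -8, 2, -2, 8; 0, -8, 16, -2, 8, 6]

lemma trace_imMatrix_mul_thetaMatrix (i j : Fin 6) : Matrix.trace
    (imMatrix ^ ((basisExp i).1 + (basisExp j).1) *
      thetaMatrix ^ ((basisExp i).2 + (basisExp j).2)) = traceFormMatrix i j := by
  fin_cases i <;> fin_cases j <;> decide +kernel

lemma det_traceFormMatrix : traceFormMatrix.det = -10816 := by
  decide +kernel

namespace IsSexticField

open NumberField Module

variable {L : Type*} [Field L] [NumberField L] {θ I : L}

lemma linearIndependent (hL : IsSexticField L θ I) :
    LinearIndependent ℚ fun i => I ^ (basisExp i).1 * θ ^ (basisExp i).2 := by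
  rw [Fintype.linearIndependent_iff]
  intro a h
  simp only [basisExp, Algebra.smul_def, eq_ratCast, Fin.sum_univ_succ, Finset.univ_eq_empty,
    Finset.sum_empty, Matrix.cons_val_zero, Matrix.cons_val_succ, Fin.succ_zero_eq_one,
    Fin.succ_one_eq_two] at h
  simp [Fin.succ] at h
  have := hL.coeff_eq_zero (a := ![-a 3, 2 * a 0 - 2 * a 3 - a 4,
    2 * a 0 + 2 * a 1 + a 3 - 2 * a 4 - a 5, 2 * a 1 + 2 * a 2 + a 3 + a 4 - 2 * a 5,
    2 * a 2 + a 4 + a 5, a 5]) (by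
      simp
      linear_combination 2 * θ * (θ + 1) * h + (a 3 + a 4 * θ + a 5 * θ ^ 2 : L) * hL.cube)
  simp [funext_iff, Fin.forall_fin_succ] at this
  obtain ⟨h3, h1, h2, h4, h5, h6⟩ := this
  intro i
  fin_cases i <;> simp <;> linarith

/-- The basis `1, θ, θ², I, Iθ, Iθ²`. -/
noncomputable def basis (hL : IsSexticField L θ I) : Basis (Fin 6) ℚ L :=
  basisOfLinearIndependentOfCardEqFinrank hL.linearIndependent (by simp [hL.finrank])

lemma basis_apply (hL : IsSexticField L θ I) (i : Fin 6) :
    hL.basis i = I ^ (basisExp i).1 * θ ^ (basisExp i).2 := by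
  simp [basis]

lemma leftMulMatrix_eq (hL : IsSexticField L θ I) {x : L} {A : Matrix (Fin 6) (Fin 6) ℤ}
    (h : ∀ j, x * hL.basis j = ∑ k, (A k j : L) * hL.basis k) :
    Algebra.leftMulMatrix hL.basis x = A.map (Int.castRingHom ℚ) := by
  ext i j
  have h' : x * hL.basis j = ∑ k, (A k j : ℚ) • hL.basis k := by
    rw [h]
    simp [Algebra.smul_def]
  rw [Algebra.leftMulMatrix_eq_repr_mul, h', map_sum, Finset.sum_apply']
  simp [Finsupp.single_apply]

lemma leftMulMatrix_theta (hL : IsSexticField L θ I) :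
    Algebra.leftMulMatrix hL.basis θ = thetaMatrix.map (Int.castRingHom ℚ) := by
  refine hL.leftMulMatrix_eq fun j => ?_
  simp only [Fin.sum_univ_six, basis_apply]
  fin_cases j <;> simp [thetaMatrix, basisExp]
  · ring
  · linear_combination hL.cube
  · ring
  · ring
  · linear_combination I * hL.cube + (2 * θ ^ 2 + 2 * θ) * hL.sq

lemma leftMulMatrix_im (hL : IsSexticField L θ I) :
    Algebra.leftMulMatrix hL.basis I = imMatrix.map (Int.castRingHom ℚ) := by
  refine hL.leftMulMatrix_eq fun j => ?_
  simp only [Fin.sum_univ_six, basis_apply]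
  fin_cases j <;> simp [imMatrix, basisExp]
  · linear_combination hL.sq
  · linear_combination θ * hL.sq
  · linear_combination θ ^ 2 * hL.sq

lemma discr_basis (hL : IsSexticField L θ I) : Algebra.discr ℚ hL.basis = -10816 := by
  have h : Algebra.traceMatrix ℚ hL.basis = traceFormMatrix.map (Int.castRingHom ℚ) := by
    ext i j
    rw [Algebra.traceMatrix_apply, Algebra.traceForm_apply, basis_apply, basis_apply,
      Algebra.trace_eq_matrix_trace hL.basis,
      show I ^ (basisExp i).1 * θ ^ (basisExp i).2 * (I ^ (basisExp j).1 * θ ^ (basisExp j).2) =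
        I ^ ((basisExp i).1 + (basisExp j).1) * θ ^ ((basisExp i).2 + (basisExp j).2) by ring,
      map_mul, map_pow, map_pow, leftMulMatrix_theta, leftMulMatrix_im, Matrix.map_apply,
      ← trace_imMatrix_mul_thetaMatrix, ← RingHom.mapMatrix_apply, ← RingHom.mapMatrix_apply,
      ← map_pow, ← map_pow, ← map_mul]
    exact (AddMonoidHom.map_trace (Int.castRingHom ℚ) _).symm
  rw [Algebra.discr_def, h, ← RingHom.mapMatrix_apply, ← RingHom.map_det, det_traceFormMatrix]
  simp

end IsSexticField

namespace IsSexticField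

open NumberField Module InfinitePlace

variable {L : Type*} [Field L] [NumberField L] {θ I : 𝓞 L}

lemma isIntegral_theta {L : Type*} [Field L] [NumberField L] {θ I : L} (hL : IsSexticField L θ I) :
    IsIntegral ℤ θ :=
  ⟨sexticPoly ℤ, monic_sexticPoly ℤ, by rw [eval₂_sexticPoly, hL.root]⟩

lemma isIntegral_im {L : Type*} [Field L] [NumberField L] {θ I : L} (hL : IsSexticField L θ I) :
    IsIntegral ℤ I := by
  refine IsIntegral.of_pow (n := 2) two_pos ?_
  rw [hL.sq]
  exact isIntegral_one.neg

lemma isTotallyComplex {L : Type*} [Field L] [NumberField L] {θ I : L}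
    (hL : IsSexticField L θ I) : IsTotallyComplex L := by
  rw [isTotallyComplex_iff]
  intro v
  rw [← not_isReal_iff_isComplex]
  intro hv
  have h := congrArg (embedding_of_isReal hv) hL.sq
  rw [map_pow, map_neg, map_one] at h
  nlinarith [sq_nonneg (embedding_of_isReal hv I)]

lemma nrComplexPlaces_eq {L : Type*} [Field L] [NumberField L] {θ I : L}
    (hL : IsSexticField L θ I) : nrComplexPlaces L = 3 := by
  have := hL.isTotallyComplex
  have h := IsTotallyComplex.finrank L
  rw [hL.finrank] at h
  omega

lemma abs_discr_le (hL : IsSexticField L (θ : L) (I : L)) : |discr L| ≤ 10816 := by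
  let e := (integralBasis L).indexEquiv hL.basis
  let B := (integralBasis L).reindex e
  have hB : Algebra.discr ℚ B = discr L := by
    rw [coe_discr, Basis.coe_reindex, Algebra.discr_reindex]
  let c : Fin 6 → 𝓞 L := fun i => I ^ (basisExp i).1 * θ ^ (basisExp i).2
  let P : Matrix (Fin 6) (Fin 6) ℤ :=
    Matrix.of fun i j => (RingOfIntegers.basis L).repr (c j) (e.symm i)
  have hP : B.toMatrix hL.basis = P.map (Int.castRingHom ℚ) := by
    ext i j
    have : hL.basis j = algebraMap (𝓞 L) L (c j) := by
      rw [basis_apply]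
      simp [c]
    rw [Basis.toMatrix_apply, this, Basis.repr_reindex_apply, integralBasis_repr_apply]
    simp [P]
  have h := Algebra.discr_of_matrix_vecMul (A := ℚ) B (B.toMatrix hL.basis)
  rw [Basis.toMatrix_map_vecMul, hL.discr_basis, hB, hP, ← RingHom.mapMatrix_apply,
    ← RingHom.map_det] at h
  have h' : (-10816 : ℤ) = P.det ^ 2 * discr L := by
    have h'' : ((-10816 : ℤ) : ℚ) = (P.det ^ 2 * discr L : ℤ) := by
      rw [Int.cast_mul, Int.cast_pow, ← eq_intCast (Int.castRingHom ℚ) P.det, ← h]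
      norm_num
    exact_mod_cast h''
  have hd : P.det ≠ 0 := by
    intro h0
    rw [h0] at h'
    norm_num at h'
  have h1 : 1 ≤ P.det ^ 2 := Int.add_one_le_iff.mpr (sq_pos_of_ne_zero hd)
  have h2 : P.det ^ 2 * |discr L| = 10816 := by
    rw [← abs_of_nonneg (sq_nonneg P.det), ← abs_mul, ← h']
    norm_num
  nlinarith [abs_nonneg (discr L)]

lemma sextic_ne_zero_zmod_two : ∀ x : ZMod 2,
    x ^ 6 + 2 * x ^ 5 + x ^ 4 + 2 * x ^ 3 + 6 * x ^ 2 + 4 * x + 1 ≠ 0 := by decide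

lemma sextic_ne_zero_zmod_three : ∀ x : ZMod 3,
    x ^ 6 + 2 * x ^ 5 + x ^ 4 + 2 * x ^ 3 + 6 * x ^ 2 + 4 * x + 1 ≠ 0 := by decide

lemma root' (hL : IsSexticField L (θ : L) (I : L)) :
    θ ^ 6 + 2 * θ ^ 5 + θ ^ 4 + 2 * θ ^ 3 + 6 * θ ^ 2 + 4 * θ + 1 = 0 := by
  apply RingOfIntegers.ext
  simpa [map_ofNat] using hL.root

lemma absNorm_ne (hL : IsSexticField L (θ : L) (I : L)) (P : Ideal (𝓞 L)) {p : ℕ} (hp : p.Prime)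
    (h : ∀ x : ZMod p, x ^ 6 + 2 * x ^ 5 + x ^ 4 + 2 * x ^ 3 + 6 * x ^ 2 + 4 * x + 1 ≠ 0) :
    P.absNorm ≠ p := by
  intro hP
  rw [Ideal.absNorm_apply, Submodule.cardQuot_apply] at hP
  have : Finite (𝓞 L ⧸ P) := Nat.finite_of_card_ne_zero (by rw [hP]; exact hp.ne_zero)
  have := Fintype.ofFinite (𝓞 L ⧸ P)
  rw [Nat.card_eq_fintype_card] at hP
  let f : 𝓞 L →+* ZMod p :=
    (ZMod.ringEquivOfPrime (𝓞 L ⧸ P) hp hP).symm.toRingHom.comp (Ideal.Quotient.mk P)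
  have := congrArg f hL.root'
  simp only [map_add, map_mul, map_pow, map_ofNat, map_one, map_zero] at this
  exact h _ this

lemma isPrincipalIdealRing (hL : IsSexticField L (θ : L) (I : L)) :
    IsPrincipalIdealRing (𝓞 L) := by
  refine RingOfIntegers.isPrincipalIdealRing_of_isPrincipal_of_norm_le fun P hP => ?_
  rw [hL.nrComplexPlaces_eq, hL.finrank] at hP
  have hsqrt : √|(discr L : ℝ)| ≤ 104 := by
    rw [Real.sqrt_le_left (by norm_num)]
    have := hL.abs_discr_le
    have h2 : ((|discr L| : ℤ) : ℝ) ≤ (10816 : ℤ) := by exact_mod_cast this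
    push_cast at h2
    linarith
  have hpi : 4 / Real.pi ≤ 4 / 3 := by
    gcongr
    exact Real.pi_gt_three.le
  have h4 : ((P : Ideal (𝓞 L)).absNorm : ℝ) < 4 := by
    calc _ ≤ _ := hP
      _ ≤ (4 / 3) ^ 3 * (720 / 46656 * 104) := by
        have : ((Nat.factorial 6 : ℕ) : ℝ) = 720 := by norm_num [Nat.factorial]
        rw [this]
        refine mul_le_mul (by gcongr) ?_ (by positivity) (by positivity)
        refine mul_le_mul (by norm_num) ?_ (by positivity) (by positivity)
        exact_mod_cast hsqrt
      _ < 4 := by norm_num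
  have h4' : (P : Ideal (𝓞 L)).absNorm < 4 := by exact_mod_cast h4
  have h0 := Ideal.absNorm_pos_of_nonZeroDivisors P
  have h2 := hL.absNorm_ne P Nat.prime_two sextic_ne_zero_zmod_two
  have h3 := hL.absNorm_ne P Nat.prime_three sextic_ne_zero_zmod_three
  have h1 : (P : Ideal (𝓞 L)).absNorm = 1 := by omega
  rw [Ideal.absNorm_eq_one_iff] at h1
  rw [h1]
  exact top_isPrincipal

end IsSexticField

section SexticRing

variable {A B : Type*} [CommRing A] [CommRing B]

/-- Multiplication by `θ` in coordinates with respect to `1, θ, θ², I, Iθ, Iθ²`. -/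
def thetaVec (y : Fin 6 → A) : Fin 6 → A :=
  ![y 2, y 0 + 2 * y 2 - 2 * y 5, y 1 - y 2 - 2 * y 5, y 5, y 3 + 2 * y 2 + 2 * y 5,
    y 4 + 2 * y 2 - y 5]

/-- Multiplication by `I` in coordinates with respect to `1, θ, θ², I, Iθ, Iθ²`. -/
def imVec (y : Fin 6 → A) : Fin 6 → A := ![-y 3, -y 4, -y 5, y 0, y 1, y 2]

/-- Multiplication in coordinates with respect to `1, θ, θ², I, Iθ, Iθ²`. -/
def sexMul (x y : Fin 6 → A) : Fin 6 → A := fun i =>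
  x 0 * y i + x 1 * thetaVec y i + x 2 * thetaVec (thetaVec y) i + x 3 * imVec y i +
    x 4 * imVec (thetaVec y) i + x 5 * imVec (thetaVec (thetaVec y)) i

lemma thetaVec_map (f : A →+* B) (y : Fin 6 → A) : thetaVec (f ∘ y) = f ∘ thetaVec y := by
  funext i; fin_cases i <;> simp [thetaVec, map_ofNat]

lemma imVec_map (f : A →+* B) (y : Fin 6 → A) : imVec (f ∘ y) = f ∘ imVec y := by
  funext i; fin_cases i <;> simp [imVec]

lemma sexMul_map (f : A →+* B) (x y : Fin 6 → A) : sexMul (f ∘ x) (f ∘ y) = f ∘ sexMul x y := by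
  funext i
  simp only [sexMul, thetaVec_map, imVec_map, Function.comp_apply, map_add, map_mul]

/-- The element of the ring with given coordinates with respect to `1, θ, θ², I, Iθ, Iθ²`. -/
def sexEval (θ I : B) (x : Fin 6 → ℤ) : B :=
  x 0 + x 1 * θ + x 2 * θ ^ 2 + x 3 * I + x 4 * (I * θ) + x 5 * (I * θ ^ 2)

lemma sexEval_sexMul {θ I : B} (hI : I ^ 2 = -1)
    (hθ : θ ^ 3 = (-1 + 2 * I) * θ ^ 2 + (2 + 2 * I) * θ + 1) (x y : Fin 6 → ℤ) :
    sexEval θ I (sexMul x y) = sexEval θ I x * sexEval θ I y := by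
  have hth : ∀ y, sexEval θ I (thetaVec y) = θ * sexEval θ I y := fun y => by
    simp [sexEval, thetaVec]
    linear_combination -(y 2 + y 5 * I : B) * hθ - y 5 * (2 * θ ^ 2 + 2 * θ) * hI
  have him : ∀ y, sexEval θ I (imVec y) = I * sexEval θ I y := fun y => by
    simp [sexEval, imVec]
    linear_combination -(y 3 + y 4 * θ + y 5 * θ ^ 2 : B) * hI
  have hlin : sexEval θ I (sexMul x y) = x 0 * sexEval θ I y + x 1 * sexEval θ I (thetaVec y) +
      x 2 * sexEval θ I (thetaVec (thetaVec y)) + x 3 * sexEval θ I (imVec y) +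
      x 4 * sexEval θ I (imVec (thetaVec y)) +
      x 5 * sexEval θ I (imVec (thetaVec (thetaVec y))) := by
    simp only [sexEval, sexMul]
    push_cast
    ring
  simp only [hlin, him, hth]
  generalize sexEval θ I y = z
  simp only [sexEval]
  ring

/-- Coordinates of the units `I, 1 + Iθ - θ², 1 + (1 + I)θ + Iθ²`. -/
def unitVec : Fin 3 → Fin 6 → A :=
  ![![0, 0, 0, 1, 0, 0], ![1, 0, -1, 0, 1, 0], ![1, 1, 0, 0, 1, 1]]

/-- Coordinates of the product of the powers of the units `unitVec` with exponents `e`. -/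
def unitProdVec (e : Fin 3 → Fin 2) : Fin 6 → A :=
  sexMul (if e 0 = 0 then ![1, 0, 0, 0, 0, 0] else unitVec 0)
    (sexMul (if e 1 = 0 then ![1, 0, 0, 0, 0, 0] else unitVec 1)
      (if e 2 = 0 then ![1, 0, 0, 0, 0, 0] else unitVec 2))

lemma zmod_four_unitProdVec : ∀ (e : Fin 3 → Fin 2) (r : Fin 6 → Fin 2),
    (let x : Fin 6 → ZMod 4 := sexMul (unitProdVec e)
      (sexMul (fun i => ((r i : ℕ) : ZMod 4)) (fun i => ((r i : ℕ) : ZMod 4)))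
    x 3 = 0 ∧ x 4 = 0 ∧ x 5 = 0 → e = 0 ∨ (2 * x 0 = 0 ∧ 2 * x 1 = 0 ∧ 2 * x 2 = 0)) := by
  decide +kernel

end SexticRing

lemma coeff_even_of_eq_zero {R : Type*} [CommRing R] [Nontrivial R] {t : R} (h2 : (2 : R) = 0)
    (ht : t ^ 3 = t ^ 2 + 1) {a b c : ℤ} (h : (a : R) + b * t + c * t ^ 2 = 0) :
    2 ∣ a ∧ 2 ∣ b ∧ 2 ∣ c := by
  have hmod : ∀ n : ℤ, 2 ∣ n ∧ (n : R) = 0 ∨ ¬ 2 ∣ n ∧ (n : R) = 1 := fun n => by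
    rcases Int.even_or_odd n with hn | hn
    · obtain ⟨k, rfl⟩ := hn.two_dvd
      exact .inl ⟨⟨k, rfl⟩, by push_cast; linear_combination (k : R) * h2⟩
    · obtain ⟨k, rfl⟩ := hn
      exact .inr ⟨by omega, by push_cast; linear_combination (k : R) * h2⟩
  have ht0 : ∀ n : ℕ, t ^ n ≠ 0 := fun n h0 => one_ne_zero (α := R) (by
    rw [← one_pow n, show (1 : R) = t * (t ^ 2 - t) by linear_combination -ht, mul_pow, h0,
      zero_mul])
  rcases hmod a with ⟨ha, ha'⟩ | ⟨ha, ha'⟩ <;> rcases hmod b with ⟨hb, hb'⟩ | ⟨hb, hb'⟩ <;>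
    rcases hmod c with ⟨hc, hc'⟩ | ⟨hc, hc'⟩ <;> rw [ha', hb', hc'] at h
  · exact ⟨ha, hb, hc⟩
  · exact absurd (by linear_combination h) (ht0 2)
  · exact absurd (by linear_combination h) (ht0 1)
  · exact absurd (by linear_combination h + t * (t ^ 2 + t + 1) * ht + t ^ 3 * h2) (ht0 6)
  · exact absurd (by linear_combination h) (ht0 0)
  · exact absurd (by linear_combination h + ht) (ht0 3)
  · exact absurd (by linear_combination h + (t ^ 2 + t + 1) * ht + t ^ 2 * h2) (ht0 5)
  · exact absurd (by linear_combination h + (t + 1) * ht) (ht0 4)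

namespace IsSexticField

open NumberField Module

variable {L : Type*} [Field L] [NumberField L] {θ I : 𝓞 L}

lemma im_sq (hL : IsSexticField L (θ : L) (I : L)) : I ^ 2 = -1 := by
  apply RingOfIntegers.ext
  simpa using hL.sq

lemma theta_cube (hL : IsSexticField L (θ : L) (I : L)) :
    θ ^ 3 = (-1 + 2 * I) * θ ^ 2 + (2 + 2 * I) * θ + 1 := by
  apply RingOfIntegers.ext
  simpa [map_ofNat] using hL.cube

lemma absNorm_span_two (hL : IsSexticField L (θ : L) (I : L)) :
    (Ideal.span {(2 : 𝓞 L)}).absNorm = 64 := by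
  rw [Ideal.absNorm_span_singleton]
  have := Algebra.norm_algebraMap (S := 𝓞 L) (2 : ℤ)
  rw [RingOfIntegers.rank, hL.finrank, map_ofNat] at this
  rw [this]
  rfl

lemma not_isUnit_one_add_im (hL : IsSexticField L (θ : L) (I : L)) : ¬ IsUnit (1 + I) := by
  intro h
  have h2 : IsUnit (2 : 𝓞 L) := by
    rw [show (2 : 𝓞 L) = (1 + I) * (1 + I) * -I by
      linear_combination (2 + I) * hL.im_sq]
    exact (h.mul h).mul (IsUnit.of_mul_eq_one I (by linear_combination -hL.im_sq))
  have := hL.absNorm_span_two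
  rw [Ideal.span_singleton_eq_top.mpr h2] at this
  simp at this

lemma even_sub_of_dvd (hL : IsSexticField L (θ : L) (I : L)) {x : Fin 6 → ℤ}
    (h : 1 + I ∣ sexEval θ I x) : 2 ∣ x 0 - x 3 ∧ 2 ∣ x 1 - x 4 ∧ 2 ∣ x 2 - x 5 := by
  let J := Ideal.span {1 + I}
  have : Nontrivial (𝓞 L ⧸ J) := Ideal.Quotient.nontrivial_iff.mpr
    (by rw [Ne, Ideal.span_singleton_eq_top]; exact hL.not_isUnit_one_add_im)
  let f := Ideal.Quotient.mk J
  have hI : f I = -1 := by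
    rw [eq_neg_iff_add_eq_zero, ← map_one f, ← map_add, add_comm]
    exact Ideal.Quotient.eq_zero_iff_mem.mpr (Ideal.mem_span_singleton_self _)
  have h2 : (2 : 𝓞 L ⧸ J) = 0 := by
    have := congrArg f hL.im_sq
    rw [map_pow, hI, map_neg, map_one] at this
    linear_combination this
  have ht : f θ ^ 3 = f θ ^ 2 + 1 := by
    have := congrArg f hL.theta_cube
    simp only [map_pow, map_add, map_mul, map_neg, map_one, map_ofNat, hI] at this
    linear_combination this - 2 * f θ ^ 2 * h2
  refine coeff_even_of_eq_zero h2 ht ?_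
  have := Ideal.Quotient.eq_zero_iff_mem.mpr (Ideal.mem_span_singleton.mpr h)
  simp only [sexEval, map_pow, map_add, map_mul, map_intCast, show
    Ideal.Quotient.mk (Ideal.span {1 + I}) = f from rfl, hI] at this
  push_cast
  linear_combination this

lemma two_dvd_of_dvd (hL : IsSexticField L (θ : L) (I : L)) {x : Fin 6 → ℤ}
    (h : 2 ∣ sexEval θ I x) (i : Fin 6) : 2 ∣ x i := by
  have h12 : (1 + I) * (1 - I) = 2 := by linear_combination -hL.im_sq
  obtain ⟨⟨a, ha⟩, ⟨b, hb⟩, ⟨c, hc⟩⟩ := hL.even_sub_of_dvd ((Dvd.intro _ h12).trans h)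
  have hx : sexEval θ I x = (1 + I) * sexEval θ I ![x 3 + a, x 4 + b, x 5 + c, -a, -b, -c] := by
    simp only [sexEval, sub_eq_iff_eq_add.mp ha, sub_eq_iff_eq_add.mp hb, sub_eq_iff_eq_add.mp hc]
    simp
    linear_combination (a + b * θ + c * θ ^ 2 : 𝓞 L) * hL.im_sq
  obtain ⟨w, hw⟩ := h
  have h0 : (1 + I) ≠ 0 := fun h0 => two_ne_zero (α := 𝓞 L) (by rw [← h12, h0, zero_mul])
  have h' := hL.even_sub_of_dvd (Dvd.intro (-I * w) (mul_left_cancel₀ h0 (by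
    rw [← hx, hw]
    linear_combination -(2 + I) * w * hL.im_sq)))
  simp at h'
  obtain ⟨h0, h1, h2⟩ := h'
  fin_cases i <;> simp <;> omega

lemma four_dvd_of_dvd (hL : IsSexticField L (θ : L) (I : L)) {x : Fin 6 → ℤ}
    (h : 4 ∣ sexEval θ I x) (i : Fin 6) : 4 ∣ x i := by
  choose y hy using hL.two_dvd_of_dvd ((Dvd.intro 2 (by norm_num)).trans h)
  have hxy : sexEval θ I x = 2 * sexEval θ I y := by
    simp only [sexEval, hy]
    push_cast
    ring
  obtain ⟨w, hw⟩ := h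
  obtain ⟨k, hk⟩ := hL.two_dvd_of_dvd (x := y) (Dvd.intro w (mul_left_cancel₀ two_ne_zero (by
    rw [← hxy, hw]; ring))) i
  exact ⟨k, by rw [hy, hk]; ring⟩

lemma exists_eq_sexEval_add (hL : IsSexticField L (θ : L) (I : L)) (z : 𝓞 L) :
    ∃ (r : Fin 6 → Fin 2) (w : 𝓞 L), z = sexEval θ I (fun i => ((r i : ℕ) : ℤ)) + 2 * w := by
  let f : (Fin 6 → Fin 2) → 𝓞 L ⧸ Ideal.span {(2 : 𝓞 L)} := fun r =>
    Ideal.Quotient.mk _ (sexEval θ I fun i => ((r i : ℕ) : ℤ))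
  have hf : Function.Injective f := by
    intro r s hrs
    rw [Ideal.Quotient.eq, Ideal.mem_span_singleton] at hrs
    have := hL.two_dvd_of_dvd (x := fun i => ((r i : ℕ) : ℤ) - ((s i : ℕ) : ℤ)) (by
      convert hrs using 1
      simp only [sexEval]
      push_cast
      ring)
    funext i
    have := this i
    omega
  have hcard : Nat.card (𝓞 L ⧸ Ideal.span {(2 : 𝓞 L)}) = 64 := by
    rw [← Submodule.cardQuot_apply, ← Ideal.absNorm_apply, hL.absNorm_span_two]
  have : Finite (𝓞 L ⧸ Ideal.span {(2 : 𝓞 L)}) :=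
    Nat.finite_of_card_ne_zero (by rw [hcard]; norm_num)
  have hsurj := ((Nat.bijective_iff_injective_and_card f).mpr ⟨hf, by rw [hcard]; simp⟩).2
  obtain ⟨r, hr⟩ := hsurj (Ideal.Quotient.mk _ z)
  rw [eq_comm, Ideal.Quotient.eq, Ideal.mem_span_singleton] at hr
  obtain ⟨w, hw⟩ := hr
  exact ⟨r, w, by linear_combination hw⟩

end IsSexticField

lemma zpow_eq_pow_mod_two {G : Type*} [Group G] {a : G} (h : a * a = 1) (k : ℤ) :
    a ^ k = a ^ (k % 2).toNat := by
  conv_lhs => rw [show k = ((k % 2).toNat : ℤ) + 2 * (k / 2) by omega]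
  rw [zpow_add, zpow_mul, zpow_ofNat, sq, h, one_zpow, mul_one, zpow_natCast]

lemma unitProdVec_zmod_four : ∀ (e : Fin 3 → Fin 2) (i : Fin 6),
    (unitProdVec e : Fin 6 → ZMod 4) i = ((unitProdVec e i : ℤ) : ZMod 4) := by
  decide +kernel

namespace IsSexticField

open NumberField Module NumberField.Units

variable {L : Type*} [Field L] [NumberField L] {θ I : 𝓞 L}

lemma _root_.NumberField.Units.exists_generators (L : Type*) [Field L] [NumberField L] :
    ∃ g : Fin (rank L + 1) → (𝓞 L)ˣ, ∀ x, ∃ e : Fin (rank L + 1) → ℤ, x = ∏ i, g i ^ e i := by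
  obtain ⟨ζ, hζ⟩ := IsCyclic.exists_generator (α := torsion L)
  refine ⟨Fin.cons ζ (fundSystem L), fun x => ?_⟩
  obtain ⟨⟨η, e⟩, he, -⟩ := exist_unique_eq_mul_prod L x
  obtain ⟨k, hk⟩ := Subgroup.mem_zpowers_iff.mp (hζ η)
  refine ⟨Fin.cons k e, ?_⟩
  rw [Fin.prod_univ_succ]
  simp only [Fin.cons_zero, Fin.cons_succ]
  rw [he, ← hk]
  simp

lemma isUnit_theta (hL : IsSexticField L (θ : L) (I : L)) : IsUnit θ :=
  IsUnit.of_mul_eq_one (θ ^ 2 - (-1 + 2 * I) * θ - (2 + 2 * I)) (by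
    linear_combination hL.theta_cube)

lemma isUnit_sexEval_unitVec (hL : IsSexticField L (θ : L) (I : L)) (i : Fin 3) :
    IsUnit (sexEval θ I (unitVec i)) := by
  have h1 : IsUnit (θ + 1) := IsUnit.of_mul_eq_one (-(θ ^ 2 - 2 * I * θ - 2)) (by
    linear_combination -hL.theta_cube)
  fin_cases i
  · exact IsUnit.of_mul_eq_one (-I) (by simp [sexEval, unitVec]; linear_combination -hL.im_sq)
  · refine isUnit_of_mul_isUnit_left (y := sexEval θ I (unitVec 1)) ?_
    convert hL.isUnit_theta.neg using 1
    simp [sexEval, unitVec]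
    linear_combination (θ - 1) * hL.theta_cube + θ ^ 2 * hL.im_sq
  · refine isUnit_of_mul_isUnit_left (y := sexEval θ I (unitVec 2)) ?_
    convert (hL.isUnit_theta.mul h1).neg using 1
    simp [sexEval, unitVec]
    linear_combination -(θ + 1) * hL.theta_cube + θ ^ 2 * (θ + 1) ^ 2 * hL.im_sq

lemma even_of_eq_mul_sq (hL : IsSexticField L (θ : L) (I : L)) {q : Fin 3 → ℤ}
    {e : Fin 3 → Fin 2} {z : 𝓞 L}
    (h : (q 0 : 𝓞 L) + q 1 * θ + q 2 * θ ^ 2 = sexEval θ I (unitProdVec e) * z ^ 2) :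
    e = 0 ∨ ∀ i, 2 ∣ q i := by
  obtain ⟨r, w, rfl⟩ := hL.exists_eq_sexEval_add z
  set x : Fin 6 → ℤ := fun i => ((r i : ℕ) : ℤ) with hx
  set y := sexMul (unitProdVec e) (sexMul x x) with hy
  have hev : sexEval θ I y = sexEval θ I (unitProdVec e) * (sexEval θ I x * sexEval θ I x) := by
    rw [hy, sexEval_sexMul hL.im_sq hL.theta_cube, sexEval_sexMul hL.im_sq hL.theta_cube]
  have h4 := hL.four_dvd_of_dvd
    (x := ![q 0 - y 0, q 1 - y 1, q 2 - y 2, -y 3, -y 4, -y 5])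
    (Dvd.intro (sexEval θ I (unitProdVec e) * (w * sexEval θ I x + w ^ 2)) (by
      have : sexEval θ I ![q 0 - y 0, q 1 - y 1, q 2 - y 2, -y 3, -y 4, -y 5] =
        ((q 0 : 𝓞 L) + q 1 * θ + q 2 * θ ^ 2) - sexEval θ I y := by
        simp [sexEval]
        ring
      rw [this, hev, h]
      ring))
  have hcast : ∀ i, (y i : ZMod 4) = (sexMul (unitProdVec e)
      (sexMul (fun i => ((r i : ℕ) : ZMod 4)) (fun i => ((r i : ℕ) : ZMod 4)))) i := by
    intro i
    have hu : (unitProdVec e : Fin 6 → ZMod 4) = Int.castRingHom (ZMod 4) ∘ unitProdVec e :=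
      funext fun i => unitProdVec_zmod_four e i
    have hr : (fun i => ((r i : ℕ) : ZMod 4)) = Int.castRingHom (ZMod 4) ∘ x := by
      funext i
      simp [hx]
    rw [hu, hr, sexMul_map, sexMul_map]
    rfl
  have h40 := h4 0
  have h41 := h4 1
  have h42 := h4 2
  have h43 := h4 3
  have h44 := h4 4
  have h45 := h4 5
  simp only [Matrix.cons_val, dvd_neg] at h40 h41 h42 h43 h44 h45
  have hz := zmod_four_unitProdVec e r
  simp only [← hcast] at hz
  have h2 : ∀ i, 2 * (y i : ZMod 4) = 0 → 2 ∣ y i := by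
    intro i hi
    have : ((2 * y i : ℤ) : ZMod 4) = 0 := by exact_mod_cast hi
    rw [ZMod.intCast_zmod_eq_zero_iff_dvd] at this
    omega
  refine (hz ⟨?_, ?_, ?_⟩).imp id ?_
  · exact (ZMod.intCast_zmod_eq_zero_iff_dvd _ 4).mpr h43
  · exact (ZMod.intCast_zmod_eq_zero_iff_dvd _ 4).mpr h44
  · exact (ZMod.intCast_zmod_eq_zero_iff_dvd _ 4).mpr h45
  · rintro ⟨h0, h1, h2'⟩ i
    have g0 := h2 0 h0
    have g1 := h2 1 h1
    have g2 := h2 2 h2'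
    fin_cases i <;> simp <;> omega

lemma exists_unit_eq_mul_sq (hL : IsSexticField L (θ : L) (I : L)) (ε : (𝓞 L)ˣ) :
    ∃ (e : Fin 3 → Fin 2) (η : (𝓞 L)ˣ), (ε : 𝓞 L) = sexEval θ I (unitProdVec e) * η ^ 2 := by
  let N : Subgroup (𝓞 L)ˣ := (powMonoidHom 2).range
  let π := QuotientGroup.mk' N
  have hsq : ∀ g : (𝓞 L)ˣ ⧸ N, g * g = 1 := fun g => by
    obtain ⟨x, rfl⟩ := QuotientGroup.mk'_surjective N g
    rw [← map_mul, QuotientGroup.mk'_apply, QuotientGroup.eq_one_iff]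
    exact ⟨x, pow_two x⟩
  obtain ⟨g, hg⟩ := NumberField.Units.exists_generators L
  have hrank : rank L = 2 := by
    have := hL.isTotallyComplex
    rw [Units.rank, InfinitePlace.card_eq_nrRealPlaces_add_nrComplexPlaces, hL.nrComplexPlaces_eq,
      IsTotallyComplex.nrRealPlaces_eq_zero]
  let φ : (Fin (rank L + 1) → Fin 2) → (𝓞 L)ˣ ⧸ N := fun e => ∏ i, π (g i) ^ (e i : ℕ)
  have hφ : Function.Surjective φ := fun x => by
    obtain ⟨x, rfl⟩ := QuotientGroup.mk'_surjective N x
    obtain ⟨e, rfl⟩ := hg x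
    refine ⟨fun i => ⟨(e i % 2).toNat, by omega⟩, ?_⟩
    simp only [φ, map_prod, map_zpow]
    refine Finset.prod_congr rfl fun i _ => ?_
    exact (zpow_eq_pow_mod_two (hsq _) _).symm
  choose v hv using hL.isUnit_sexEval_unitVec
  let ψ : (Fin 3 → Fin 2) → (𝓞 L)ˣ ⧸ N := fun e => ∏ i, π (v i) ^ (e i : ℕ)
  have hprod : ∀ e : Fin 3 → Fin 2, ((∏ i, v i ^ (e i : ℕ) : (𝓞 L)ˣ) : 𝓞 L) =
      sexEval θ I (unitProdVec e) := by
    intro e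
    have h1 : sexEval θ I ![1, 0, 0, 0, 0, 0] = 1 := by simp [sexEval]
    have hif : ∀ i, sexEval θ I (if e i = 0 then ![1, 0, 0, 0, 0, 0] else unitVec i) =
        sexEval θ I (unitVec i) ^ (e i : ℕ) := by
      intro i
      generalize e i = k
      fin_cases k <;> simp [h1]
    rw [unitProdVec, sexEval_sexMul hL.im_sq hL.theta_cube, sexEval_sexMul hL.im_sq hL.theta_cube,
      hif, hif, hif, Fin.prod_univ_three]
    push_cast
    simp only [hv, mul_assoc]
  have hψ : Function.Injective ψ := by
    intro e f hef
    have h1 : ψ (e + f) = 1 := by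
      rw [← hsq (ψ e)]
      nth_rw 2 [hef]
      simp only [ψ, ← Finset.prod_mul_distrib]
      refine Finset.prod_congr rfl fun i _ => ?_
      rw [Pi.add_apply]
      generalize e i = a, f i = b
      fin_cases a <;> fin_cases b <;> simp [hsq]
    have h2 : e + f = 0 := by
      simp only [ψ, ← map_pow, ← map_prod] at h1
      rw [QuotientGroup.mk'_apply, QuotientGroup.eq_one_iff] at h1
      obtain ⟨η, hη⟩ := h1
      have hη' := congrArg (Units.val) hη
      rw [hprod] at hη'
      refine (hL.even_of_eq_mul_sq (q := ![1, 0, 0]) (e := e + f)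
        (z := ((η⁻¹ : (𝓞 L)ˣ) : 𝓞 L)) ?_).resolve_right fun h => by simpa using h 0
      rw [← hη']
      simp [← mul_pow]
    funext i
    have := congrFun h2 i
    rw [Pi.add_apply, Pi.zero_apply] at this
    omega
  have hcard : Nat.card ((𝓞 L)ˣ ⧸ N) ≤ 8 := by
    have := Nat.card_le_card_of_surjective φ hφ
    rw [hrank] at this
    simpa using this
  have : Finite ((𝓞 L)ˣ ⧸ N) := Finite.of_surjective φ hφ
  have hψ' := ((Nat.bijective_iff_injective_and_card ψ).mpr ⟨hψ, le_antisymm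
    (Nat.card_le_card_of_injective ψ hψ) (by simpa using hcard)⟩).2
  obtain ⟨e, he⟩ := hψ' (π ε)
  simp only [ψ, ← map_pow, ← map_prod] at he
  obtain ⟨η, hη⟩ := QuotientGroup.eq.mp he
  refine ⟨e, η, ?_⟩
  rw [← hprod]
  have := congrArg Units.val (eq_inv_mul_iff_mul_eq.mp hη)
  simpa using this.symm

lemma isSquare_of_eq_unit_mul_sq (hL : IsSexticField L (θ : L) (I : L)) {q : Fin 3 → ℤ}
    (hq : ¬ ∀ i, 2 ∣ q i) {ε : (𝓞 L)ˣ} {z : 𝓞 L}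
    (h : (q 0 : 𝓞 L) + q 1 * θ + q 2 * θ ^ 2 = ε * z ^ 2) :
    ∃ y : 𝓞 L, (q 0 : 𝓞 L) + q 1 * θ + q 2 * θ ^ 2 = y ^ 2 := by
  obtain ⟨e, η, he⟩ := hL.exists_unit_eq_mul_sq ε
  rw [he] at h
  have h' := (hL.even_of_eq_mul_sq (z := η * z) (h.trans (by ring))).resolve_right hq
  refine ⟨η * z, ?_⟩
  rw [h, h', show unitProdVec (0 : Fin 3 → Fin 2) = ![(1 : ℤ), 0, 0, 0, 0, 0] by decide +kernel]
  simp [sexEval]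
  ring

end IsSexticField

section HalfStep

open Polynomial

lemma Polynomial.exists_map_eq_natCast_mul (M : ℚ[X]) :
    ∃ (d : ℕ) (N : ℤ[X]), 0 < d ∧ N.map (Int.castRingHom ℚ) = C (d : ℚ) * M := by
  obtain ⟨b, hb0, hb⟩ := IsLocalization.integerNormalization_spec (nonZeroDivisors ℤ) M
  have hb' : b ≠ 0 := nonZeroDivisors.ne_zero hb0
  refine ⟨b.natAbs, C b.sign * IsLocalization.integerNormalization (nonZeroDivisors ℤ) M,
    Int.natAbs_pos.mpr hb', ?_⟩
  rw [Polynomial.map_mul, ← algebraMap_int_eq, hb, map_C]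
  have : ((b.natAbs : ℤ) : ℚ) = (b.sign * b : ℤ) := by
    rw [Int.natCast_natAbs, Int.sign_mul_self_eq_abs]
  rw [← Int.cast_natCast, this, Int.cast_mul, C_mul, ← Int.cast_smul_eq_zsmul ℚ,
    smul_eq_C_mul, mul_assoc]
  rfl

lemma Polynomial.dvd_of_sq_eq_mul_of_isRoot {k : Type*} [Field k] {q h M : k[X]} {a : k}
    (hq0 : q ≠ 0) (hdeg : q.natDegree ≤ 2) (hM : M ^ 2 = q * h) (hq : q.IsRoot a)
    (hh : h.IsRoot a) : q ∣ M := by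
  obtain ⟨q, rfl⟩ := dvd_iff_isRoot.mpr hq
  obtain ⟨h, rfl⟩ := dvd_iff_isRoot.mpr hh
  have hM' : M.IsRoot a := by
    have := congrArg (eval a) hM
    simpa using this
  obtain ⟨m, rfl⟩ := dvd_iff_isRoot.mpr hM'
  have hX : (X - C a : k[X]) ≠ 0 := X_sub_C_ne_zero a
  have hm : m ^ 2 = q * h := mul_left_cancel₀ (pow_ne_zero 2 hX) (by linear_combination hM)
  refine mul_dvd_mul_left _ ?_
  have hq' : q ≠ 0 := right_ne_zero_of_mul hq0
  rw [natDegree_mul hX hq', natDegree_X_sub_C] at hdeg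
  rcases Nat.lt_or_ge 0 q.natDegree with h1 | h1
  · have : Irreducible q := irreducible_of_degree_eq_one (by
      rw [degree_eq_natDegree hq']
      exact_mod_cast (by omega : q.natDegree = 1))
    exact this.prime.dvd_of_dvd_pow (Dvd.intro _ hm.symm)
  · rw [eq_C_of_natDegree_le_zero h1] at hq' ⊢
    exact (isUnit_C.mpr (isUnit_iff_ne_zero.mpr (by simpa using hq'))).dvd

lemma Polynomial.IsPrimitive.map_ne_zero_of_prime {q : ℤ[X]} (hq : q.IsPrimitive) {p : ℕ}
    (hp : p.Prime) {k : Type*} [Field k] [CharP k p] : q.map (Int.castRingHom k) ≠ 0 := by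
  intro h0
  have : IsUnit (p : ℤ) := hq p ((C_dvd_iff_dvd_coeff _ _).mpr fun i => by
    have := congrArg (fun f => coeff f i) h0
    simpa [CharP.intCast_eq_zero_iff k p] using this)
  rw [Int.ofNat_isUnit, Nat.isUnit_iff] at this
  exact hp.one_lt.ne' this

lemma Polynomial.IsPrimitive.not_two_dvd_coeff {q : ℤ[X]} (hq : q.IsPrimitive)
    (hdeg : q.natDegree ≤ 2) : ¬ (2 ∣ q.coeff 0 ∧ 2 ∣ q.coeff 1 ∧ 2 ∣ q.coeff 2) := by
  rintro ⟨h0, h1, h2⟩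
  have hu : IsUnit (2 : ℤ) := hq 2 ((C_dvd_iff_dvd_coeff _ _).mpr fun i => by
    by_cases hi : q.natDegree < i
    · rw [coeff_eq_zero_of_natDegree_lt hi]
      exact dvd_zero _
    · have hi' : i ≤ 2 := by omega
      interval_cases i <;> assumption)
  exact absurd hu (by decide)

/-- Modulo a primitive integer polynomial `q`, a rational polynomial can be written in lowest
terms. -/
lemma Polynomial.exists_lowest_terms (q : ℤ[X]) (M : ℚ[X]) :
    ∃ (e : ℕ) (N : ℤ[X]) (k : ℚ[X]), 0 < e ∧
      C (e : ℚ) * M = N.map (Int.castRingHom ℚ) + q.map (Int.castRingHom ℚ) * k ∧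
      ∀ p : ℕ, p.Prime → p ∣ e →
        ¬ q.map (Int.castRingHom (ZMod p)) ∣ N.map (Int.castRingHom (ZMod p)) := by
  classical
  have hex : ∃ e : ℕ, 0 < e ∧ ∃ (N : ℤ[X]) (k : ℚ[X]),
      C (e : ℚ) * M = N.map (Int.castRingHom ℚ) + q.map (Int.castRingHom ℚ) * k := by
    obtain ⟨d, N, hd, hN⟩ := exists_map_eq_natCast_mul M
    exact ⟨d, hd, N, 0, by rw [hN, mul_zero, add_zero]⟩
  obtain ⟨he, N, k, hN⟩ := Nat.find_spec hex
  refine ⟨Nat.find hex, N, k, he, hN, fun p hp ⟨e, hpe⟩ hdvd => ?_⟩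
  obtain ⟨k', hk'⟩ := hdvd
  obtain ⟨k', rfl⟩ := map_surjective (Int.castRingHom (ZMod p)) (ZMod.ringHom_surjective _) k'
  obtain ⟨R, hR⟩ : C (p : ℤ) ∣ N - q * k' := (C_dvd_iff_dvd_coeff _ _).mpr fun i => by
    have := congrArg (fun f => coeff f i) hk'
    rw [← Polynomial.map_mul, ← sub_eq_zero] at this
    simp only [coeff_map] at this
    rwa [← map_sub, ← coeff_sub, eq_intCast, ZMod.intCast_zmod_eq_zero_iff_dvd] at this
  have hp0 : (p : ℚ) ≠ 0 := by exact_mod_cast hp.ne_zero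
  have he0 : 0 < e := Nat.pos_of_ne_zero (by rintro rfl; omega)
  refine Nat.find_min hex (m := e) (by rw [hpe]; exact (lt_mul_iff_one_lt_left he0).mpr hp.one_lt)
    ⟨he0, R, C (p : ℚ)⁻¹ * (k + k'.map (Int.castRingHom ℚ)), ?_⟩
  have hR' := congrArg (map (Int.castRingHom ℚ)) hR
  rw [Polynomial.map_sub, Polynomial.map_mul, Polynomial.map_mul, map_C, eq_intCast,
    Int.cast_natCast] at hR'
  rw [hpe] at hN
  push_cast at hN
  rw [C_mul] at hN
  have hpp : C (p : ℚ) * C (p : ℚ)⁻¹ = 1 := by rw [← C_mul, mul_inv_cancel₀ hp0, C_1]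
  refine mul_left_cancel₀ (C_ne_zero.mpr hp0) ?_
  linear_combination hN + hR' -
    q.map (Int.castRingHom ℚ) * (k + k'.map (Int.castRingHom ℚ)) * hpp

/-- A nonzero rational polynomial is proportional to a primitive integer polynomial. -/
lemma Polynomial.exists_isPrimitive_map_eq {Q : ℚ[X]} (hQ : Q ≠ 0) :
    ∃ (c : ℚ) (q : ℤ[X]), c ≠ 0 ∧ q.IsPrimitive ∧ q.map (Int.castRingHom ℚ) = C c * Q := by
  obtain ⟨d, N, hd, hN⟩ := exists_map_eq_natCast_mul Q
  have hN0 : N ≠ 0 := by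
    rintro rfl
    rw [Polynomial.map_zero] at hN
    exact mul_ne_zero (C_ne_zero.mpr (by exact_mod_cast hd.ne')) hQ hN.symm
  have hc : (N.content : ℚ) ≠ 0 := by exact_mod_cast content_eq_zero_iff.not.mpr hN0
  refine ⟨(N.content : ℚ)⁻¹ * d, N.primPart, mul_ne_zero (inv_ne_zero hc)
    (by exact_mod_cast hd.ne'), N.isPrimitive_primPart, mul_left_cancel₀ (C_ne_zero.mpr hc) ?_⟩
  rw [← mul_assoc, ← C_mul, mul_inv_cancel_left₀ hc, ← hN]
  conv_rhs => rw [N.eq_C_content_mul_primPart, Polynomial.map_mul, map_C, eq_intCast]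

namespace IsSexticField

open NumberField Module

variable {L : Type*} [Field L] [NumberField L] {θ I : 𝓞 L}

/-- A common zero of `q`, `h` and the sextic, in characteristic not dividing `2 * e`, is the
multiple zero of the sextic in characteristic `13`. -/
lemma thirteen_eq_zero {k : Type*} [Field k] {q h M : k[X]} {e t : k} (h2 : (2 : k) ≠ 0)
    (he : e ≠ 0) (heq : M ^ 2 - C (e ^ 2) * sexticPoly k = q * h) (ht : (sexticPoly k).IsRoot t)
    (hq : q.IsRoot t) (hh : h.IsRoot t) : (13 : k) = 0 ∧ t = 3 := by
  have h0 := congrArg (eval t) heq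
  have h1 := congrArg (eval t) (congrArg derivative heq)
  simp only [IsRoot.def] at ht hq hh
  simp only [eval_sub, eval_pow, eval_mul, ht, hq, hh, mul_zero, sub_zero] at h0
  have hM : M.eval t = 0 := by simpa using h0
  simp only [derivative_sub, derivative_pow, derivative_mul, derivative_C, eval_sub, eval_add,
    eval_mul, eval_pow, eval_C, hM, hq, hh, ht] at h1
  have hd : (derivative (sexticPoly k)).eval t = 0 := by
    simpa [he] using h1
  simp [sexticPoly] at hd ht
  have h104 : (2 : k) ^ 3 * 13 = 0 := by
    linear_combination (548 + 252 * t + 54 * t ^ 2 + 416 * t ^ 3 + 300 * t ^ 4) * ht +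
      (-111 - 278 * t - 87 * t ^ 2 - 21 * t ^ 3 - 86 * t ^ 4 - 50 * t ^ 5) * hd
  have h13 := (mul_eq_zero.mp h104).resolve_left (pow_ne_zero 3 h2)
  refine ⟨h13, ?_⟩
  have : (t - 3) ^ 2 = 0 := by
    linear_combination (33 * t + 33 * t ^ 2) * ht + (12 + 3 * t + 36 * t ^ 2 + 27 * t ^ 3) * hd -
      (3 * t ^ 0 + 15 * t ^ 1 + 32 * t ^ 2 + 72 * t ^ 3 + 72 * t ^ 4 + 39 * t ^ 5 + 45 * t ^ 6 +
        45 * t ^ 7 + 15 * t ^ 8) * h13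
  exact sub_eq_zero.mp (pow_eq_zero_iff two_ne_zero |>.mp this)

lemma isCoprime_aeval (hL : IsSexticField L (θ : L) (I : L)) {q h M : ℤ[X]} {e : ℕ} (he : 0 < e)
    (hdeg : q.natDegree ≤ 2) (hprim : q.IsPrimitive)
    (hmin : ∀ p : ℕ, p.Prime → p ∣ e →
        ¬ q.map (Int.castRingHom (ZMod p)) ∣ M.map (Int.castRingHom (ZMod p)))
    (heq : M ^ 2 - C ((e : ℤ) ^ 2) * sexticPoly ℤ = q * h) :
    IsCoprime (aeval θ q) (aeval θ h) := by
  by_contra hcop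
  rw [← Ideal.isCoprime_span_singleton_iff, Ideal.isCoprime_iff_sup_eq] at hcop
  obtain ⟨P, hP, hle⟩ := Ideal.exists_le_maximal _ hcop
  let k := 𝓞 L ⧸ P
  let _ : Field k := Ideal.Quotient.field P
  let f : 𝓞 L →+* k := Ideal.Quotient.mk P
  have hqθ : f (aeval θ q) = 0 := Ideal.Quotient.eq_zero_iff_mem.mpr
    (hle (Ideal.mem_sup_left (Ideal.mem_span_singleton_self _)))
  have hhθ : f (aeval θ h) = 0 := Ideal.Quotient.eq_zero_iff_mem.mpr
    (hle (Ideal.mem_sup_right (Ideal.mem_span_singleton_self _)))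
  have hev : ∀ g : ℤ[X], (g.map (Int.castRingHom k)).eval (f θ) = f (aeval θ g) := fun g => by
    rw [eval_map, aeval_def, hom_eval₂]
    congr 1
  have hFθ : (sexticPoly k).IsRoot (f θ) := by
    rw [IsRoot.def, ← map_sexticPoly (Int.castRingHom k), hev, aeval_def, eval₂_sexticPoly,
      hL.root', map_zero]
  have heqk := congrArg (Polynomial.map (Int.castRingHom k)) heq
  simp only [Polynomial.map_sub, Polynomial.map_mul, Polynomial.map_pow, map_C,
    map_sexticPoly] at heqk
  have hqr : (q.map (Int.castRingHom k)).IsRoot (f θ) := (hev q).trans hqθ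
  have hhr : (h.map (Int.castRingHom k)).IsRoot (f θ) := (hev h).trans hhθ
  by_cases hek : (e : k) = 0
  · obtain ⟨p, hp⟩ := CharP.exists k
    have hpe : p ∣ e := (CharP.cast_eq_zero_iff k p e).mp hek
    have hpp : p.Prime := (CharP.char_is_prime_or_zero k p).resolve_right (by
      rintro rfl
      rw [zero_dvd_iff] at hpe
      omega)
    have : Fact p.Prime := ⟨hpp⟩
    refine hmin p hpp hpe ?_
    have hmap : ∀ g : ℤ[X], (g.map (Int.castRingHom (ZMod p))).map (ZMod.castHom dvd_rfl k) =
        g.map (Int.castRingHom k) := fun g => by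
      rw [Polynomial.map_map]
      congr 1
      exact RingHom.ext_int _ _
    rw [← map_dvd_map' (ZMod.castHom dvd_rfl k), hmap, hmap]
    refine dvd_of_sq_eq_mul_of_isRoot (hprim.map_ne_zero_of_prime hpp)
      (natDegree_map_le.trans hdeg) ?_ hqr hhr
    rw [← heqk]
    simp [hek]
  by_cases h2 : (2 : k) = 0
  · have ht : (f θ) ^ 3 = (f θ) ^ 2 + 1 := by
      simp [sexticPoly] at hFθ
      rw [← sub_eq_zero, ← pow_eq_zero_iff two_ne_zero]
      linear_combination hFθ - (2 * f θ ^ 5 + 2 * f θ ^ 3 + 2 * f θ ^ 2 + 2 * f θ) * h2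
    have hq3 := eval_eq_sum_range' (Nat.lt_succ_of_le
      (natDegree_map_le.trans hdeg)) (f θ) (p := q.map (Int.castRingHom k))
    rw [hqr] at hq3
    simp [Finset.sum_range_succ] at hq3
    exact hprim.not_two_dvd_coeff hdeg (coeff_even_of_eq_zero h2 ht hq3.symm)
  · obtain ⟨h13, ht⟩ := thirteen_eq_zero h2 (e := (e : k)) hek (by simpa using heqk) hFθ hqr hhr
    have : CharP k 13 := (CharP.charP_iff_prime_eq_zero (by norm_num)).mpr (by exact_mod_cast h13)
    have hdvd : ∀ g : ℤ[X], (g.map (Int.castRingHom k)).IsRoot (f θ) → 13 ∣ g.eval 3 := by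
      intro g hg
      rw [ht, IsRoot.def, show (3 : k) = Int.castRingHom k 3 by simp, eval_map_apply, eq_intCast,
        CharP.intCast_eq_zero_iff k 13] at hg
      exact_mod_cast hg
    obtain ⟨a, ha⟩ := hdvd q hqr
    obtain ⟨b, hb⟩ := hdvd h hhr
    have h3 := congrArg (eval 3) heq
    simp [ha, hb, sexticPoly] at h3
    refine hek ((CharP.cast_eq_zero_iff k 13 e).mpr ?_)
    have hp : Prime (13 : ℤ) := by norm_num
    obtain ⟨m, hm⟩ : (13 : ℤ) ∣ M.eval 3 := hp.dvd_of_dvd_pow (n := 2)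
      ⟨13 * a * b + 109 * e ^ 2, by linear_combination h3⟩
    rw [hm] at h3
    have : (13 : ℤ) ∣ e ^ 2 * 109 := ⟨m ^ 2 - a * b, by linarith⟩
    exact_mod_cast hp.dvd_of_dvd_pow ((hp.dvd_or_dvd this).resolve_right (by norm_num))

lemma exists_mul_eq_sq (hL : IsSexticField L (θ : L) (I : L)) {q : Fin 3 → ℚ} {M : Fin 4 → ℚ}
    {h : Fin 5 → ℚ} (hq : q ≠ 0) (hs : IsState q M h) : ∃ (c : ℚ) (z : L), c ≠ 0 ∧
      (c : L) * (q 0 + q 1 * (θ : L) + q 2 * (θ : L) ^ 2) = z ^ 2 := by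
  let Q : ℚ[X] := C (q 2) * X ^ 2 + C (q 1) * X + C (q 0)
  let N : ℚ[X] := C (M 3) * X ^ 3 + C (M 2) * X ^ 2 + C (M 1) * X + C (M 0)
  let H : ℚ[X] := C (h 4) * X ^ 4 + C (h 3) * X ^ 3 + C (h 2) * X ^ 2 + C (h 1) * X + C (h 0)
  have hQ0 : Q ≠ 0 := fun h0 => hq <| by
    funext i
    have h0' := congrArg (fun f => coeff f (i : ℕ)) h0
    fin_cases i <;> simpa [Q, coeff_X, coeff_C] using h0'
  have hQN : N ^ 2 - sexticPoly ℚ = Q * H := by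
    rw [isState_iff] at hs
    obtain ⟨h0, h1, h2, h3, h4, h5, h6⟩ := hs
    have g0 := congrArg C h0
    have g1 := congrArg C h1
    have g2 := congrArg C h2
    have g3 := congrArg C h3
    have g4 := congrArg C h4
    have g5 := congrArg C h5
    have g6 := congrArg C h6
    simp only [map_sub, map_add, map_mul, map_pow, map_ofNat, map_one] at g0 g1 g2 g3 g4 g5 g6
    simp only [sexticPoly, N, Q, H, map_ofNat]
    linear_combination g0 + X * g1 + X ^ 2 * g2 + X ^ 3 * g3 + X ^ 4 * g4 + X ^ 5 * g5 + X ^ 6 * g6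
  obtain ⟨c, p, hc, hprim, hp⟩ := exists_isPrimitive_map_eq hQ0
  obtain ⟨e, R, k, he, hR, hmin⟩ := exists_lowest_terms p N
  have hdvd : p ∣ R ^ 2 - C ((e : ℤ) ^ 2) * sexticPoly ℤ := by
    rw [IsPrimitive.Int.dvd_iff_map_cast_dvd_map_cast _ _ hprim]
    refine Dvd.intro (C (e : ℚ) ^ 2 * C c⁻¹ * H - 2 * C (e : ℚ) * N * k +
      p.map (Int.castRingHom ℚ) * k ^ 2) ?_
    have hcc : C c * C c⁻¹ = 1 := by rw [← C_mul, mul_inv_cancel₀ hc, C_1]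
    rw [Polynomial.map_sub, Polynomial.map_mul, Polynomial.map_pow, map_C, map_sexticPoly,
      eq_intCast, Int.cast_pow, Int.cast_natCast, C_pow]
    linear_combination (C (e : ℚ) * N - p.map (Int.castRingHom ℚ) * k +
      R.map (Int.castRingHom ℚ)) * hR - C (e : ℚ) ^ 2 * hQN +
      C (e : ℚ) ^ 2 * Q * H * hcc + C (e : ℚ) ^ 2 * C c⁻¹ * H * hp
  obtain ⟨g, hg⟩ := hdvd
  have hdeg : p.natDegree ≤ 2 := by
    rw [← natDegree_map_eq_of_injective (RingHom.injective_int (Int.castRingHom ℚ)), hp]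
    exact (natDegree_C_mul_le _ _).trans natDegree_quadratic_le
  have hcop := hL.isCoprime_aeval he hdeg hprim hmin hg
  have hmul : aeval θ p * aeval θ g = aeval θ R ^ 2 := by
    rw [← map_mul, ← hg, map_sub, map_mul, aeval_def θ (sexticPoly ℤ), eval₂_sexticPoly, hL.root',
      mul_zero, sub_zero, map_pow]
  have := hL.isPrincipalIdealRing
  obtain ⟨z, u, hz⟩ := exists_associated_pow_of_mul_eq_pow' hcop hmul
  have hp3 : aeval θ p = (p.coeff 0 : 𝓞 L) + p.coeff 1 * θ + p.coeff 2 * θ ^ 2 := by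
    rw [aeval_eq_sum_range' (Nat.lt_succ_of_le hdeg)]
    simp [Finset.sum_range_succ]
  obtain ⟨y, hy⟩ := hL.isSquare_of_eq_unit_mul_sq (q := ![p.coeff 0, p.coeff 1, p.coeff 2])
    (ε := u) (z := z) (fun h2 => by
      exact hprim.not_two_dvd_coeff hdeg ⟨h2 0, h2 1, h2 2⟩) (hp3.symm.trans
        (by rw [← hz, mul_comm]))
  refine ⟨c, y, hc, ?_⟩
  have hcoeff : ∀ i, (p.coeff i : ℚ) = c * Q.coeff i := fun i => by
    rw [← coeff_C_mul, ← hp, coeff_map, eq_intCast]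
  have hc0 := hcoeff 0
  have hc1 := hcoeff 1
  have hc2 := hcoeff 2
  simp [Q, coeff_X, coeff_C] at hc0 hc1 hc2
  have hy' := congrArg (algebraMap (𝓞 L) L) hy
  simp only [map_add, map_mul, map_pow, map_intCast, Matrix.cons_val] at hy'
  rw [← hy']
  have hcast : ∀ n : ℤ, (n : L) = ((n : ℚ) : L) := fun n => by norm_cast
  rw [hcast, hcast, hcast, hc0, hc1, hc2]
  push_cast
  ring

end IsSexticField

lemma halfStep : HalfStep := by
  obtain ⟨L, _, _, θ, I, hL⟩ := exists_isSexticField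
  let θ' : NumberField.RingOfIntegers L := ⟨θ, hL.isIntegral_theta⟩
  let I' : NumberField.RingOfIntegers L := ⟨I, hL.isIntegral_im⟩
  have hL' : IsSexticField L (θ' : L) (I' : L) := hL
  exact hL'.halfStep fun q M h hq hs => hL'.exists_mul_eq_sq hq hs

end HalfStep

/-- In a quadratic field every element is a rational combination of `1` and a given irrational
element. -/
lemma exists_eq_add_mul_of_finrank_eq_two {K : Type*} [Field K] [CharZero K]
    (hdeg : Module.finrank ℚ K = 2) {x : K} (hx : ∀ r : ℚ, x ≠ r) (z : K) :
    ∃ a b : ℚ, z = a + b * x := by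
  have hli : LinearIndependent ℚ ![1, x] := by
    rw [LinearIndependent.pair_iff]
    intro s t hst
    simp only [Algebra.smul_def, eq_ratCast, mul_one] at hst
    have ht : t = 0 := by
      by_contra ht
      refine hx (-s / t) ?_
      have : (t : K) ≠ 0 := by exact_mod_cast ht
      push_cast
      field_simp
      linear_combination hst
    subst ht
    simpa using hst
  have hspan := hli.span_eq_top_of_card_eq_finrank (by simp [hdeg])
  have hz : z ∈ Submodule.span ℚ (Set.range ![1, x]) := by rw [hspan]; trivial
  rw [Matrix.range_cons, Matrix.range_cons, Matrix.range_empty, Set.union_empty,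
    Set.singleton_union, Submodule.mem_span_pair] at hz
  obtain ⟨a, b, rfl⟩ := hz
  exact ⟨a, b, by simp [Algebra.smul_def]⟩

/-- A monic quadratic dividing `M ^ 2 - F`, where `F` is the sextic, is one of three. -/
lemma eq_zero_of_add_mul_eq_zero {K : Type*} [Field K] [CharZero K] {x : K}
    (hx : ∀ r : ℚ, x ≠ r) {a b : ℚ} (h : (a : K) + b * x = 0) : a = 0 ∧ b = 0 := by
  have hb : b = 0 := by
    by_contra hb
    refine hx (-a / b) ?_
    have : (b : K) ≠ 0 := by exact_mod_cast hb
    push_cast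
    field_simp
    linear_combination h
  subst hb
  simpa using h

lemma eq_of_rem_eq_zero {q0 q1 m0 m1 h0 h1 h2 h3 h4 : ℚ} (e4 : h4 = -1) (e3 : h3 = -2 - q1 * h4)
    (e2 : h2 = -1 - q1 * h3 - q0 * h4) (e1 : h1 = -2 - q1 * h2 - q0 * h3)
    (e0 : h0 = m1 ^ 2 - 6 - q1 * h1 - q0 * h2) (r1 : 2 * m0 * m1 - 4 - q1 * h0 - q0 * h1 = 0)
    (r0 : m0 ^ 2 - 1 - q0 * h0 = 0) :
    q0 = 0 ∧ q1 = 0 ∨ q0 = 0 ∧ q1 = 1 ∨ q0 = 1 ∧ q1 = 2 := by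
  obtain ⟨k, hk, h⟩ := isKnown_of_isState halfStep (q := ![q0, q1, 1]) (M := ![m0, m1, 0, 0])
    (h := ![h0, h1, h2, h3, h4]) (fun h => by simpa using congrFun h 2) (by
      rw [isState_iff]
      simp
      refine ⟨?_, ?_, ?_, ?_, ?_, ?_, ?_⟩ <;> linarith)
  have h02 := h 0 2
  have h12 := h 1 2
  simp only [knownQuads, List.mem_cons, List.not_mem_nil, or_false] at hk
  rcases hk with rfl | rfl | rfl | rfl | rfl | rfl <;> simp at h02 h12 <;> simp [h02, h12]

lemma rational_of_sq_eq_sextic {K : Type*} [Field K] [CharZero K] (hdeg : Module.finrank ℚ K = 2)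
    {t y : K} (h : y ^ 2 = t ^ 6 + 2 * t ^ 5 + t ^ 4 + 2 * t ^ 3 + 6 * t ^ 2 + 4 * t + 1)
    (ht0 : t ≠ 0) (ht1 : t ≠ -1) : ∃ r : ℚ, t = r := by
  by_contra hr
  push Not at hr
  obtain ⟨v, u, huv⟩ := exists_eq_add_mul_of_finrank_eq_two hdeg hr (t ^ 2)
  obtain ⟨m0, m1, rfl⟩ := exists_eq_add_mul_of_finrank_eq_two hdeg hr y
  obtain ⟨h4, e4⟩ : ∃ x : ℚ, x = -1 := ⟨_, rfl⟩
  obtain ⟨h3, e3⟩ : ∃ x : ℚ, x = -2 - (-u) * h4 := ⟨_, rfl⟩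
  obtain ⟨h2, e2⟩ : ∃ x : ℚ, x = -1 - (-u) * h3 - (-v) * h4 := ⟨_, rfl⟩
  obtain ⟨h1, e1⟩ : ∃ x : ℚ, x = -2 - (-u) * h2 - (-v) * h3 := ⟨_, rfl⟩
  obtain ⟨h0, e0⟩ : ∃ x : ℚ, x = m1 ^ 2 - 6 - (-u) * h1 - (-v) * h2 := ⟨_, rfl⟩
  obtain ⟨r0, r1⟩ := eq_zero_of_add_mul_eq_zero hr (a := m0 ^ 2 - 1 - (-v) * h0)
    (b := 2 * m0 * m1 - 4 - (-u) * h0 - (-v) * h1) (by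
    have g4 := congrArg (Rat.cast : ℚ → K) e4
    have g3 := congrArg (Rat.cast : ℚ → K) e3
    have g2 := congrArg (Rat.cast : ℚ → K) e2
    have g1 := congrArg (Rat.cast : ℚ → K) e1
    have g0 := congrArg (Rat.cast : ℚ → K) e0
    push_cast at g0 g1 g2 g3 g4 ⊢
    linear_combination h - (h0 + h1 * t + h2 * t ^ 2 + h3 * t ^ 3 + h4 * t ^ 4 : K) * huv +
      t ^ 2 * g0 + t ^ 3 * g1 + t ^ 4 * g2 + t ^ 5 * g3 + t ^ 6 * g4)
  rcases eq_of_rem_eq_zero e4 e3 e2 e1 e0 r1 r0 with ⟨hv, hu⟩ | ⟨hv, hu⟩ | ⟨hv, hu⟩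
  · rw [neg_eq_zero.mp hv, neg_eq_zero.mp hu] at huv
    exact ht0 (by simpa using huv)
  · rw [neg_eq_zero.mp hv, neg_eq_iff_eq_neg.mp hu] at huv
    rcases mul_eq_zero.mp (show t * (t + 1) = 0 by push_cast at huv; linear_combination huv)
      with h | h
    exacts [ht0 h, ht1 (eq_neg_of_add_eq_zero_left h)]
  · rw [neg_eq_iff_eq_neg.mp hv, neg_eq_iff_eq_neg.mp hu] at huv
    have : (t + 1) ^ 2 = 0 := by push_cast at huv; linear_combination huv
    exact ht1 (eq_neg_of_add_eq_zero_left (pow_eq_zero_iff two_ne_zero |>.mp this))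

lemma eq_zero_or_of_sq_eq_sextic {t y : ℚ}
    (h : y ^ 2 = t ^ 6 + 2 * t ^ 5 + t ^ 4 + 2 * t ^ 3 + 6 * t ^ 2 + 4 * t + 1) :
    t = 0 ∨ t = -1 := by
  by_cases hy : y = 0
  · have hd : t * (t + 1) = 0 := by
      rw [hy] at h
      have := sq_nonneg (t ^ 3 + t ^ 2 - 2 * t - 1)
      nlinarith [sq_nonneg (t * (t + 1))]
    rcases mul_eq_zero.mp hd with h | h
    exacts [.inl h, .inr (by linarith)]
  obtain ⟨m1, hm1⟩ : ∃ x : ℚ, 2 * y * x = 6 * t ^ 5 + 10 * t ^ 4 + 4 * t ^ 3 + 6 * t ^ 2 +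
    12 * t + 4 := ⟨_, mul_div_cancel₀ _ (mul_ne_zero two_ne_zero hy)⟩
  have := eq_of_rem_eq_zero (q0 := t ^ 2) (q1 := -2 * t) (m0 := y - m1 * t) (m1 := m1) rfl rfl rfl
    rfl rfl (by linear_combination hm1) (by linear_combination h - t * hm1)
  rcases this with ⟨h0, -⟩ | ⟨h0, h1⟩ | ⟨h0, h1⟩
  · exact .inl (by simpa using h0)
  · nlinarith
  · exact .inr (by linarith)

lemma HasExactPeriod.exists_parameter {K : Type*} [Field K] [CharZero K] {c β : K}
    (h : HasExactPeriod c 3 β) : ∃ t : K, t ≠ 0 ∧ t ≠ -1 ∧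
      (t * (t + 1)) ^ 2 * (-7 - 4 * c) = (t ^ 3 + t ^ 2 - 2 * t - 1) ^ 2 := by
  obtain ⟨h3, hne⟩ := h
  have h1 := hne 1 le_rfl (by norm_num)
  have h2 := hne 2 (by norm_num) (by norm_num)
  simp only [Function.iterate_succ, Function.iterate_zero, Function.comp_apply, id, fc]
    at h1 h2 h3
  obtain ⟨x, hx⟩ : ∃ x, β ^ 2 + c = x := ⟨_, rfl⟩
  rw [hx] at h1 h2 h3
  obtain ⟨z, hz⟩ : ∃ z, x ^ 2 + c = z := ⟨_, rfl⟩
  rw [hz] at h2 h3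
  obtain ⟨d, rfl⟩ : ∃ d, x = β + d := ⟨x - β, by ring⟩
  obtain ⟨t, ht⟩ : ∃ t, 2 * β + d = t := ⟨_, rfl⟩
  have hd : d ≠ 0 := fun hd => h1 (by rw [hd, add_zero])
  have hz' : z = β + d + d * t := by linear_combination hx - hz + d * ht
  have ht1 : t ≠ -1 := fun h => h2 (by rw [hz', h]; ring)
  have hsum : t * (β + d + z) * (1 + t) + (1 + t) ^ 2 = 0 := by
    have : d * (t * (β + d + z) + (1 + t)) = 0 := by
      linear_combination h3 - hz - (1 + β + d + z) * hz'
    linear_combination (1 + t) * (mul_eq_zero.mp this).resolve_left hd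
  have ht0 : t ≠ 0 := by
    rintro rfl
    simp at hsum
  have hs : t * (t + d + d * t) + (1 + t) = 0 := by
    have : (1 + t) * (t * (t + d + d * t) + (1 + t)) = 0 := by
      linear_combination hsum - t * (1 + t) * hz' - t * (1 + t) * ht
    exact (mul_eq_zero.mp this).resolve_left fun h => ht1 (by linear_combination h)
  refine ⟨t, ht0, ht1, ?_⟩
  have hc : 4 * c = 2 * (t + d) - (t - d) ^ 2 := by
    linear_combination 4 * hx + (2 - 2 * β - t + d) * ht
  rw [hc]
  have hd' : d * (t * (t + 1)) = -(t ^ 2 + t + 1) := by linear_combination hs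
  linear_combination
    (d * (t * (t + 1)) - (t ^ 2 + t + 1) - (2 * t + 2) * (t * (t + 1))) * hd'

lemma HasPreperiodicType.exists_parameter {K : Type*} [Field K] {c α : K}
    (h : HasPreperiodicType c 2 2 α) : ∃ P : K, P ^ 2 + P + c + 1 = 0 ∧ α ^ 2 = -P - c := by
  obtain ⟨⟨h2, hne⟩, h3⟩ := h
  have h1 := hne 1 le_rfl (by norm_num)
  simp only [Function.iterate_succ, Function.iterate_zero, Function.comp_apply, id, fc,
    Nat.reduceAdd, Nat.reduceSub] at h1 h2 h3
  obtain ⟨a, ha⟩ : ∃ a, α ^ 2 + c = a := ⟨_, rfl⟩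
  rw [ha] at h1 h2 h3
  obtain ⟨p, hp⟩ : ∃ p, a ^ 2 + c = p := ⟨_, rfl⟩
  rw [hp] at h1 h2 h3
  obtain ⟨P, hP⟩ : ∃ P, p ^ 2 + c = P := ⟨_, rfl⟩
  rw [hP] at h1 h2 h3
  have hpP : p + P + 1 = 0 := by
    have : (P - p) * (p + P + 1) = 0 := by linear_combination h2 - hP
    exact (mul_eq_zero.mp this).resolve_left (sub_ne_zero.mpr h1)
  have haP : a + P = 0 := by
    have : (P - a) * (a + P) = 0 := by linear_combination h2 - hp
    exact (mul_eq_zero.mp this).resolve_left (sub_ne_zero.mpr h3)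
  exact ⟨P, by linear_combination h2 + hpP, by linear_combination ha + haP⟩

lemma Rat.sq_ne_quartic (x y : ℚ) : y ^ 2 ≠ x ^ 4 + 14 * x ^ 2 + 65 := by
  intro h
  have hx : x * x.den = x.num := Rat.mul_den_eq_num x
  have hsq : (y * x.den ^ 2) ^ 2 =
      ((x.num ^ 4 + 14 * x.num ^ 2 * x.den ^ 2 + 65 * x.den ^ 4 : ℤ) : ℚ) := by
    push_cast
    rw [← hx]
    linear_combination (x.den : ℚ) ^ 4 * h
  obtain ⟨w, hw⟩ : ∃ w : ℤ, (w : ℚ) = y * x.den ^ 2 := by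
    have hyi : IsIntegral ℤ (y * x.den ^ 2) := by
      refine IsIntegral.of_pow two_pos ?_
      rw [hsq]
      exact isIntegral_algebraMap
    exact IsIntegrallyClosed.isIntegral_iff.mp hyi
  rw [← hw] at hsq
  have := eq_zero_of_sq_eq_quartic _ x.num x.den w rfl
    (Int.isCoprime_iff_gcd_eq_one.mpr x.reduced) (by exact_mod_cast hsq)
  exact x.den_ne_zero (by exact_mod_cast this)

lemma HasPreperiodicType.not_hasExactPeriod {K : Type*} [Field K] [CharZero K]
    (hdeg : Module.finrank ℚ K = 2) {c α β : K} (hα : HasPreperiodicType c 2 2 α) :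
    ¬HasExactPeriod c 3 β := by
  intro hβ
  obtain ⟨t, ht0, ht1, ht⟩ := hβ.exists_parameter
  obtain ⟨P, hP, hαP⟩ := hα.exists_parameter
  have hy : ((2 * P + 1) * (t * (t + 1))) ^ 2 =
      t ^ 6 + 2 * t ^ 5 + t ^ 4 + 2 * t ^ 3 + 6 * t ^ 2 + 4 * t + 1 := by
    linear_combination ht + 4 * (t * (t + 1)) ^ 2 * hP
  obtain ⟨t, rfl⟩ := rational_of_sq_eq_sextic hdeg hy ht0 ht1
  have ht0' : t ≠ 0 := by exact_mod_cast ht0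
  have ht1' : t + 1 ≠ 0 := fun h => ht1 (by exact_mod_cast eq_neg_of_add_eq_zero_left h)
  obtain ⟨x, hx⟩ : ∃ x : ℚ, x * (t * (t + 1)) = t ^ 3 + t ^ 2 - 2 * t - 1 :=
    ⟨_, div_mul_cancel₀ _ (mul_ne_zero ht0' ht1')⟩
  obtain ⟨e, he⟩ : ∃ e : ℚ, 4 * e = -7 - x ^ 2 := ⟨(-7 - x ^ 2) / 4, by ring⟩
  obtain rfl : c = e := by
    have hD : ((t : K) * (t + 1)) ^ 2 ≠ 0 := by
      exact_mod_cast pow_ne_zero 2 (mul_ne_zero ht0' ht1')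
    have hx' := congrArg (Rat.cast : ℚ → K) hx
    have he' := congrArg (Rat.cast : ℚ → K) he
    push_cast at hx' he'
    refine mul_left_cancel₀ hD (mul_left_cancel₀ (by norm_num : (4 : K) ≠ 0) ?_)
    linear_combination -ht - (t * (t + 1) : K) ^ 2 * he' +
      (x * (t * (t + 1)) + (t ^ 3 + t ^ 2 - 2 * t - 1) : K) * hx'
  have hPr : ∀ r : ℚ, P ≠ r := by
    rintro r rfl
    rcases eq_zero_or_of_sq_eq_sextic (t := t) (y := (2 * r + 1) * (t * (t + 1)))
      (by exact_mod_cast hy) with h | h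
    exacts [ht0' h, ht1' (by rw [h]; ring)]
  obtain ⟨a, b, rfl⟩ := exists_eq_add_mul_of_finrank_eq_two hdeg hPr α
  have hlin : ((a ^ 2 - b ^ 2 * (e + 1) + e : ℚ) : K) +
      ((2 * a * b - b ^ 2 + 1 : ℚ) : K) * P = 0 := by
    push_cast
    linear_combination hαP - (b : K) ^ 2 * hP
  obtain ⟨hA, hB⟩ := eq_zero_of_add_mul_eq_zero hPr hlin
  refine Rat.sq_ne_quartic x (4 * (a ^ 2 - a * b + b ^ 2 * (e + 1))) ?_
  have hx2 : x ^ 2 = -7 - 4 * e := by linear_combination he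
  have hx4 : x ^ 4 = (-7 - 4 * e) ^ 2 := by rw [← hx2]; ring
  rw [hx4, hx2]
  linear_combination 16 * (a ^ 2 - b ^ 2 * (e + 1) - e - (2 * a * b - b ^ 2)) * hA +
    16 * (e + (e + 1) * (2 * a * b - b ^ 2 - 1)) * hB

theorem no_type_2_2_with_period_3 {K : Type*} [Field K] [NumberField K]
    (hdeg : Module.finrank ℚ K = 2) (c : K) :
    (¬∃ α β : K, HasPreperiodicType c 2 2 α ∧ HasExactPeriod c 3 β) ∧
    (∀ t w : ℚ,
      w ^ 2 = (t ^ 3 - 3 * t - 1) * (t ^ 3 + 2 * t ^ 2 - t - 1) *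
          (t ^ 6 + 2 * t ^ 5 + 4 * t ^ 4 + 8 * t ^ 3 + 9 * t ^ 2 + 4 * t + 1) ↔
        ((t, w) = (0, 1) ∨ (t, w) = (0, -1) ∨ (t, w) = (-1, 1) ∨ (t, w) = (-1, -1))) := by
  exact ⟨fun ⟨_, _, hα, hβ⟩ => hα.not_hasExactPeriod hdeg hβ, rational_points_of_dynamical_curve⟩
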